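/- Let X be a non-empty subshift of edge-to-edge rhombus tilings on a finite shapeset 𝒯, given by a computable enumeration of forbidden patterns. Then Domino(X) is many-one equivalent to the classical Domino problem on ℤ² (Wang tiles on the square), i.e., Domino(X) is Π⁰₁-complete: it is co-computably enumerable and every co-computably enumerable problem many-one reduces to it. In particular, Domino(X) is undecidable. -/

import Mathlib

open Set Metric

noncomputable section

/-- Points of the euclidean plane. -/
abbrev Pt : Type := EuclideanSpace ℝ (Fin 2)

/-- A rhombus tile in the plane, given by a position (a distinguished vertex)
and its two edge vectors. -/
structure Rhombus where
  pos : Pt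
  u : Pt
  v : Pt

namespace Rhombus

/-- A genuine rhombus: linearly independent edge vectors of equal euclidean length. -/
def IsValid (r : Rhombus) : Prop :=
  LinearIndependent ℝ ![r.u, r.v] ∧ ‖r.u‖ = ‖r.v‖

/-- The support of a rhombus: the closed parallelogram it spans. -/
def support (r : Rhombus) : Set Pt :=
  {x | ∃ s t : ℝ, s ∈ Icc (0 : ℝ) 1 ∧ t ∈ Icc (0 : ℝ) 1 ∧ x = r.pos + s • r.u + t • r.v}

/-- The four vertices of a rhombus. -/
def vertices (r : Rhombus) : Set Pt :=
  {r.pos, r.pos + r.u, r.pos + r.v, r.pos + r.u + r.v}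

/-- The four (closed) edges of a rhombus, indexed as in the paper:
edge `0` from `pos` to `pos + u`, edge `1` from `pos + u` to `pos + u + v`,
edge `2` from `pos + u + v` to `pos + v`, edge `3` from `pos + v` to `pos`. -/
def edge (r : Rhombus) : Fin 4 → Set Pt :=
  ![segment ℝ r.pos (r.pos + r.u),
    segment ℝ (r.pos + r.u) (r.pos + r.u + r.v),
    segment ℝ (r.pos + r.u + r.v) (r.pos + r.v),
    segment ℝ (r.pos + r.v) r.pos]

/-- The set of edges of a rhombus. -/
def edges (r : Rhombus) : Set (Set Pt) := Set.range r.edge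

/-- Translation of a rhombus by a vector. -/
def translate (r : Rhombus) (w : Pt) : Rhombus := ⟨r.pos + w, r.u, r.v⟩

/-- The center of a rhombus. -/
def center (r : Rhombus) : Pt := r.pos + (2⁻¹ : ℝ) • r.u + (2⁻¹ : ℝ) • r.v

/-- Two rhombi are translates of each other (same shape up to translation). -/
def SameShape (r s : Rhombus) : Prop := r.u = s.u ∧ r.v = s.v

/-- `w` is one of the two edge directions of `r` (up to sign). -/
def HasEdgeDir (r : Rhombus) (w : Pt) : Prop :=
  r.u = w ∨ r.u = -w ∨ r.v = w ∨ r.v = -w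

end Rhombus

/-- Two rhombi are in edge-to-edge position: they are disjoint, share exactly one
common vertex, or share exactly one full common edge. -/
def EdgeToEdgePair (r s : Rhombus) : Prop :=
  r.support ∩ s.support = ∅ ∨
  (∃ p, p ∈ r.vertices ∧ p ∈ s.vertices ∧ r.support ∩ s.support = {p}) ∨
  (∃ e, e ∈ r.edges ∧ e ∈ s.edges ∧ r.support ∩ s.support = e)

/-- An edge-to-edge rhombus tiling of the plane: a covering of the plane
without overlap where any two tiles are disjoint, share exactly one vertex or
share a full common edge. -/
def IsTiling (x : Set Rhombus) : Prop :=
  (∀ r ∈ x, r.IsValid) ∧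
  (⋃ r ∈ x, r.support) = univ ∧
  ∀ r ∈ x, ∀ s ∈ x, r ≠ s → EdgeToEdgePair r s

/-- Every tile of `x` is a translate of a shape of the shapeset `T`. -/
def UsesShapes (T : Set Rhombus) (x : Set Rhombus) : Prop :=
  ∀ r ∈ x, ∃ s ∈ T, r.SameShape s

/-- An edge-to-edge tiling whose tiles are translates of shapes of `T`. -/
def IsTilingOn (T : Set Rhombus) (x : Set Rhombus) : Prop :=
  IsTiling x ∧ UsesShapes T x

/-- Support of a patch. -/
def PatchSupport (P : Set Rhombus) : Set Pt := ⋃ r ∈ P, r.support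

/-- A patch: a finite nonempty edge-to-edge set of rhombi whose support is
simply connected (no holes). -/
def IsPatch (P : Set Rhombus) : Prop :=
  P.Finite ∧ P.Nonempty ∧ (∀ r ∈ P, r.IsValid) ∧
  (∀ r ∈ P, ∀ s ∈ P, r ≠ s → EdgeToEdgePair r s) ∧
  SimplyConnectedSpace (PatchSupport P)

/-- Translation of a set of rhombi. -/
def translatePatch (P : Set Rhombus) (w : Pt) : Set Rhombus :=
  (fun r => r.translate w) '' P

/-- The pattern `f` appears in `x`: some translate of `f` is a sub-collection of `x`. -/
def Appears (f : Set Rhombus) (x : Set Rhombus) : Prop :=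
  ∃ w : Pt, translatePatch f w ⊆ x

/-- Vertices of a patch. -/
def PatchVertices (P : Set Rhombus) : Set Pt := ⋃ r ∈ P, r.vertices

/-- The support of `P` contains a disk of radius `ρ` centered at a vertex of `P`. -/
def HasRadius (P : Set Rhombus) (ρ : ℝ) : Prop :=
  ∃ c ∈ PatchVertices P, closedBall c ρ ⊆ PatchSupport P

/-- `P` has minimal radius `ρ`: its support contains a disk of radius `ρ` centered
at one of its vertices, and removing any tile breaks this property. -/
def MinimalRadius (P : Set Rhombus) (ρ : ℝ) : Prop :=
  HasRadius P ρ ∧ ∀ r ∈ P, ¬ HasRadius (P \ {r}) ρ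

/-- A rhombus Wang tile: a rhombus with a colour (a natural number) on each edge. -/
structure ColoredRhombus where
  shape : Rhombus
  color : Fin 4 → ℕ

namespace ColoredRhombus

def translate (t : ColoredRhombus) (w : Pt) : ColoredRhombus :=
  ⟨t.shape.translate w, t.color⟩

/-- Two coloured tiles are equal up to translation. -/
def SameTile (t s : ColoredRhombus) : Prop :=
  t.shape.SameShape s.shape ∧ t.color = s.color

end ColoredRhombus

/-- The colour-erasing operator `π`. -/
def eraseColors (x : Set ColoredRhombus) : Set Rhombus := ColoredRhombus.shape '' x

def translateColoredPatch (P : Set ColoredRhombus) (w : Pt) : Set ColoredRhombus :=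
  (fun t => t.translate w) '' P

/-- Any two tiles sharing an edge carry the same colour on the shared edge. -/
def ColorMatching (x : Set ColoredRhombus) : Prop :=
  ∀ t ∈ x, ∀ s ∈ x, t.shape ≠ s.shape →
    ∀ i j : Fin 4, t.shape.edge i = s.shape.edge j → t.color i = s.color j

/-- No two distinct coloured tiles occupy the same rhombus. -/
def ShapeInjective (x : Set ColoredRhombus) : Prop :=
  ∀ t ∈ x, ∀ s ∈ x, t.shape = s.shape → t = s

/-- A valid tiling by rhombus Wang tiles. -/
def IsColoredTiling (x : Set ColoredRhombus) : Prop :=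
  IsTiling (eraseColors x) ∧ ShapeInjective x ∧ ColorMatching x

/-- A valid patch of rhombus Wang tiles. -/
def IsColoredPatch (x : Set ColoredRhombus) : Prop :=
  IsPatch (eraseColors x) ∧ ShapeInjective x ∧ ColorMatching x

/-- All tiles of `x` are translates of tiles of the tileset `T`. -/
def TilesFrom (T : Set ColoredRhombus) (x : Set ColoredRhombus) : Prop :=
  ∀ t ∈ x, ∃ s ∈ T, t.SameTile s

/-- A subshift on the shapeset `T`: a set of `T`-tilings that is invariant under
translation and closed for the tiling topology (a tiling all of whose finite
patterns appear in tilings of `X` belongs to `X`). -/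
def IsSubshift (T : Set Rhombus) (X : Set (Set Rhombus)) : Prop :=
  (∀ x ∈ X, IsTilingOn T x) ∧
  (∀ x ∈ X, ∀ w : Pt, translatePatch x w ∈ X) ∧
  (∀ x, IsTilingOn T x →
    (∀ P, P ⊆ x → P.Finite → P.Nonempty → ∃ y ∈ X, Appears P y) → x ∈ X)

/-- The shape `r` is uniformly recurrent in the tiling `x`: for some `R > 0`,
every disk of radius `R` contains an occurrence (a translate) of `r`. -/
def UniformlyRecurrentIn (r : Rhombus) (x : Set Rhombus) : Prop :=
  ∃ R : ℝ, 0 < R ∧ ∀ p : Pt, ∃ s ∈ x, s.SameShape r ∧ s.support ⊆ closedBall p R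

/-- A shape uniformly recurrent subshift: every shape appearing somewhere in `X`
is uniformly recurrent in every tiling of `X`. -/
def ShapeUniformlyRecurrent (X : Set (Set Rhombus)) : Prop :=
  ∀ r : Rhombus, (∃ y ∈ X, ∃ s ∈ y, s.SameShape r) →
    ∀ x ∈ X, UniformlyRecurrentIn r x

/-- The restriction of `X` to the tilings using only shapes of `T'`. -/
def restrictShapes (T' : Set Rhombus) (X : Set (Set Rhombus)) : Set (Set Rhombus) :=
  {x ∈ X | UsesShapes T' x}

/-- The subshift on `T` defined by the sequence `F` of forbidden patterns. -/
def SubshiftOfForbidden (T : Set Rhombus) (F : ℕ → Set Rhombus) : Set (Set Rhombus) :=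
  {x | IsTilingOn T x ∧ ∀ n : ℕ, ¬ Appears (F n) x}

/-- A chain of rhombuses of normal vector `w` in the tiling `x`: a bi-infinite
sequence of tiles in which any two consecutive tiles share a full common edge of
direction `w`, the chain crossing each of its tiles from one of its two
`w`-edges to the other one. -/
structure Chain (x : Set Rhombus) (w : Pt) where
  seq : ℤ → Rhombus
  mem : ∀ n : ℤ, seq n ∈ x
  shares : ∀ n : ℤ, ∃ a : Pt,
    segment ℝ a (a + w) ∈ (seq n).edges ∧
    segment ℝ a (a + w) ∈ (seq (n + 1)).edges ∧
    (seq n).support ∩ (seq (n + 1)).support = segment ℝ a (a + w)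
  progress : ∀ n : ℤ,
    (seq (n - 1)).support ∩ (seq n).support ≠ (seq n).support ∩ (seq (n + 1)).support

/-- The set of tiles of a chain. -/
def Chain.tiles {x : Set Rhombus} {w : Pt} (c : Chain x w) : Set Rhombus :=
  Set.range c.seq

/-- A symbolic Wang tile on the shapeset indexed by `Fin k`: a shape index
together with the four edge colours `(a₀, a₁, a₂, a₃)`. -/
abbrev SymbTile (k : ℕ) : Type := Fin k × ℕ × ℕ × ℕ × ℕ

/-- The colours of a symbolic tile, as a function on edge indices. -/
def SymbTile.colors {k : ℕ} (t : SymbTile k) : Fin 4 → ℕ :=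
  ![t.2.1, t.2.2.1, t.2.2.2.1, t.2.2.2.2]

/-- The geometric coloured tile `t` is a translate of the symbolic tile `p`. -/
def Realizes {k : ℕ} (shapes : Fin k → Rhombus) (t : ColoredRhombus) (p : SymbTile k) :
    Prop :=
  t.shape.SameShape (shapes p.1) ∧ t.color = SymbTile.colors p

/-- The Domino problem on the subshift `X`: given a tileset `T`, decide whether
there is a valid tiling by translates of tiles of `T` whose colour-erased image
belongs to `X`. -/
def DominoPred {k : ℕ} (shapes : Fin k → Rhombus) (X : Set (Set Rhombus))
    (T : List (SymbTile k)) : Prop :=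
  ∃ x : Set ColoredRhombus, IsColoredTiling x ∧
    (∀ t ∈ x, ∃ p ∈ T, Realizes shapes t p) ∧ eraseColors x ∈ X

/-- A displacement code: a formal integer combination of edge vectors of the shapes. -/
abbrev Disp (k : ℕ) : Type := List (Fin k × ℤ × ℤ)

/-- The vector coded by a displacement code. -/
def dispVec {k : ℕ} (shapes : Fin k → Rhombus) (d : Disp k) : Pt :=
  (d.map (fun e => (e.2.1 : ℝ) • (shapes e.1).u + (e.2.2 : ℝ) • (shapes e.1).v)).sum

/-- A code for a pattern of (uncoloured) shapes: each entry is a shape index and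
the displacement of the corresponding tile. -/
abbrev PatternCode (k : ℕ) : Type := List (Fin k × Disp k)

/-- The pattern coded by a pattern code. -/
def decodePattern {k : ℕ} (shapes : Fin k → Rhombus) (c : PatternCode k) : Set Rhombus :=
  {r | ∃ e ∈ c, r = (shapes e.1).translate (dispVec shapes e.2)}

/-- A code for a pattern of coloured tiles. -/
abbrev ColoredCode (k : ℕ) : Type := List (SymbTile k × Disp k)

/-- The coloured pattern coded by a coloured pattern code. -/
def decodeColored {k : ℕ} (shapes : Fin k → Rhombus) (c : ColoredCode k) :
    Set ColoredRhombus :=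
  {t | ∃ e ∈ c,
    t = ColoredRhombus.mk ((shapes e.1.1).translate (dispVec shapes e.2))
          (SymbTile.colors e.1)}

/-- A decision problem is `Π⁰₁` (co-computably enumerable): there is a total
computable `f` such that `A x ↔ ∀ n, f x n = true`. -/
def Pi01 {α : Type} [Primcodable α] (A : α → Prop) : Prop :=
  ∃ f : α → ℕ → Bool, Computable₂ f ∧ ∀ a, A a ↔ ∀ n : ℕ, f a n = true

/-- A decision problem is `Π⁰₁`-hard: every `Π⁰₁` problem many-one reduces to it. -/
def Pi01Hard {α : Type} [Primcodable α] (A : α → Prop) : Prop :=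
  ∀ (β : Type) [Primcodable β], ∀ B : β → Prop, Pi01 B → ManyOneReducible B A

/-- A classical (square) Wang tile `(a₀, a₁, a₂, a₃)`: colours on the south,
east, north and west edges. -/
abbrev WangTile : Type := ℕ × ℕ × ℕ × ℕ

/-- The classical Domino problem: the tiles of `T` admit a valid tiling of `ℤ²`
(matching colours on shared edges). -/
def WangDomino (T : List WangTile) : Prop :=
  ∃ f : ℤ × ℤ → WangTile, (∀ p : ℤ × ℤ, f p ∈ T) ∧
    (∀ i j : ℤ, (f (i, j)).2.1 = (f (i + 1, j)).2.2.2) ∧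
    (∀ i j : ℤ, (f (i, j)).2.2.1 = (f (i, j + 1)).1)

open Set Metric
section

/-- Compactness for Wang tilings. -/
theorem wang_compact (W : List WangTile)
    (h : ∀ q : ℕ, ∃ f : ℤ × ℤ → WangTile,
      (∀ i j : ℤ, 0 ≤ i → i < q → 0 ≤ j → j < q → f (i, j) ∈ W) ∧
      (∀ i j : ℤ, 0 ≤ i → i + 1 < q → 0 ≤ j → j < q → (f (i, j)).2.1 = (f (i + 1, j)).2.2.2) ∧
      (∀ i j : ℤ, 0 ≤ i → i < q → 0 ≤ j → j + 1 < q → (f (i, j)).2.2.1 = (f (i, j + 1)).1)) :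
    WangDomino W := by
  choose f hf hh hv using h
  let U : Ultrafilter ℕ := Filter.hyperfilter ℕ
  have hU : (U : Filter ℕ) ≤ Filter.atTop := by
    rw [← Nat.cofinite_eq_atTop]; exact Filter.hyperfilter_le_cofinite
  let g : ℕ → ℤ × ℤ → WangTile := fun n p => f (2 * n + 2) (p.1 + n, p.2 + n)
  have ev : ∀ p : ℤ × ℤ, ∀ᶠ n : ℕ in U, |p.1| + 1 ≤ (n : ℤ) ∧ |p.2| + 1 ≤ (n : ℤ) := by
    intro p
    apply hU
    filter_upwards [Filter.eventually_ge_atTop ((|p.1| + |p.2| + 1).toNat)] with n hn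
    have := abs_nonneg p.1
    have := abs_nonneg p.2
    omega
  have lim : ∀ p : ℤ × ℤ, ∃ w ∈ W, ∀ᶠ n in U, g n p = w := by
    intro p
    have : ∀ᶠ n in U, ∃ w ∈ {w | w ∈ W}, g n p = w := by
      filter_upwards [ev p] with n hn
      refine ⟨_, hf _ _ _ ?_ ?_ ?_ ?_, rfl⟩
      all_goals
        have := abs_le.1 (show |p.1| ≤ n - 1 by omega)
        have := abs_le.1 (show |p.2| ≤ n - 1 by omega)
        push_cast
        omega
    rw [Ultrafilter.eventually_exists_mem_iff (List.finite_toSet W)] at this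
    exact this
  choose F hFW hF using lim
  refine ⟨F, hFW, ?_, ?_⟩
  · intro i j
    obtain ⟨n, hn, h1, h2⟩ := ((ev (i, j)).and ((hF (i, j)).and (hF (i + 1, j)))).exists
    rw [← h1, ← h2]
    have := abs_le.1 (show |i| ≤ n - 1 by simp at hn; omega)
    have := abs_le.1 (show |j| ≤ n - 1 by simp at hn; omega)
    have := hh (2 * n + 2) (i + n) (j + n) (by omega) (by push_cast; omega) (by omega)
      (by push_cast; omega)
    simp only [g]
    rw [this]
    congr 4
    ring_nf
  · intro i j
    obtain ⟨n, hn, h1, h2⟩ := ((ev (i, j)).and ((hF (i, j)).and (hF (i, j + 1)))).exists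
    rw [← h1, ← h2]
    have := abs_le.1 (show |i| ≤ n - 1 by simp at hn; omega)
    have := abs_le.1 (show |j| ≤ n - 1 by simp at hn; omega)
    have := hv (2 * n + 2) (i + n) (j + n) (by omega) (by push_cast; omega) (by omega)
      (by push_cast; omega)
    simp only [g]
    rw [this]
    congr 3
    ring_nf

end

open Set Metric
section

namespace PLayer

theorem dv {a b c : ℤ} (h : a ∣ b) (e : c = b) : a ∣ c := e ▸ h

open Classical in
/-- Clipped difference of valuations `j - ν(m)`. -/
def E (p : ℤ) (j : ℕ) (m : ℤ) : ℤ :=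
  2 - (if p ^ j ∣ p * m then 1 else 0) - (if p ^ j ∣ m then 1 else 0)
    - (if p ^ (j + 1) ∣ m then 1 else 0) - (if p ^ (j + 2) ∣ m then 1 else 0)

/-- counter condition -/
def Q (p : ℤ) (δ N B : ℤ) : Prop :=
  (δ = 1 → ¬ p ∣ N ∧ p ^ 2 ∣ B - N) ∧ (δ = 0 → p ∣ N ∧ ¬ p ^ 2 ∣ N ∧ p ^ 3 ∣ p * B - N) ∧
  (δ = -1 → p ^ 2 ∣ N ∧ ¬ p ^ 3 ∣ N) ∧ (δ = -2 → p ^ 3 ∣ N)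

/-- half of the inductive hypothesis (columns) -/
def IHh (p : ℤ) (K : ℕ) (α β : ℤ) (A : ℤ → ℤ) (δ : ℤ → ℤ → ℤ) : Prop :=
  ∀ j < K, ∀ x a, x - α = p ^ j * a → ¬ p ∣ a →
    p ^ 2 ∣ A x - a ∧ ∀ y, δ x y = E p j (y - β)

theorem E_congr {p : ℤ} {j : ℕ} {m m' : ℤ} (h : p ^ (j + 2) ∣ m - m') : E p j m = E p j m' := by
  have key : ∀ i, i ≤ j + 2 → (p ^ i ∣ m ↔ p ^ i ∣ m') := by
    intro i hi
    have h1 : p ^ i ∣ m - m' := (pow_dvd_pow p hi).trans h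
    constructor
    · intro h2; simpa using dvd_sub h2 h1
    · intro h2; simpa using dvd_add h1 h2
  have k2 : p ^ j ∣ p * m ↔ p ^ j ∣ p * m' := by
    have h1 : p ^ j ∣ p * m - p * m' := by
      rw [← mul_sub]; exact Dvd.dvd.mul_left ((pow_dvd_pow p (by omega)).trans h) _
    constructor
    · intro h2; simpa using dvd_sub h2 h1
    · intro h2; simpa using dvd_add h1 h2
  simp only [E, key j (by omega), key (j+1) (by omega), key (j+2) (by omega), k2]

theorem E_range (p : ℤ) (j : ℕ) (m : ℤ) : -2 ≤ E p j m ∧ E p j m ≤ 2 := by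
  unfold E; split_ifs <;> omega

theorem E_two {p : ℤ} {K : ℕ} {m : ℤ} (h : ¬ p ^ K ∣ m) (hp : 2 ≤ p) : E p (K + 1) m = 2 := by
  have h0 : p ≠ 0 := by omega
  have h1 : ¬ p ^ (K+1) ∣ p * m := by
    rw [pow_succ', mul_dvd_mul_iff_left h0]; exact h
  have h2 : ∀ i, ¬ p ^ (K + i) ∣ m := fun i hi => h ((pow_dvd_pow p (by omega)).trans hi)
  simp only [E, h1, h2 1, add_assoc, h2 (1 + 1), h2 (1+2)]; simp

theorem E_mul {p : ℤ} {K : ℕ} {m : ℤ} (hp : 2 ≤ p) : E p (K + 1) (p ^ K * m) = E p 1 m := by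
  have h0 : p ^ K ≠ 0 := by positivity
  have h1 : p ^ (K+1) ∣ p * (p ^ K * m) := ⟨m, by ring⟩
  have h1' : p ^ 1 ∣ p * m := ⟨m, by ring⟩
  have h2 : ∀ i, p ^ (K + i) ∣ p ^ K * m ↔ p ^ i ∣ m := fun i => by
    rw [pow_add, mul_dvd_mul_iff_left h0]
  simp only [E, h1, h1', h2 1, add_assoc, h2 (1 + 1), h2 (1+2)]

theorem E_low {p : ℤ} {i K : ℕ} (h : i + 2 ≤ K) (a : ℤ) : E p i (p ^ K * a) = -2 := by
  have h2 : ∀ i, i ≤ K → p ^ i ∣ p ^ K * a := fun i hi => Dvd.dvd.mul_right (pow_dvd_pow p hi) _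
  have h1 : p ^ i ∣ p * (p ^ K * a) := Dvd.dvd.mul_left (h2 i (by omega)) _
  simp only [E, h2 i (by omega), h2 (i+1) (by omega), h2 (i+2) (by omega), h1]; simp

theorem E_mid {p : ℤ} (hp : 2 ≤ p) (i : ℕ) {a : ℤ} (ha : ¬ p ∣ a) : E p i (p ^ (i+1) * a) = -1 := by
  have h0 : p ^ (i+1) ≠ 0 := by positivity
  have h2 : ∀ j, j ≤ i+1 → p ^ j ∣ p ^ (i+1) * a :=
    fun j hi => Dvd.dvd.mul_right (pow_dvd_pow p hi) _
  have h1 : p ^ i ∣ p * (p ^ (i+1) * a) := Dvd.dvd.mul_left (h2 i (by omega)) _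
  have h3 : ¬ p ^ (i+2) ∣ p ^ (i+1) * a := by
    rw [show i + 2 = (i+1)+1 by ring, pow_succ, mul_dvd_mul_iff_left h0]; exact ha
  simp only [E, h2 i (by omega), h2 (i+1) (by omega), h3, h1]; simp

/-- every nonzero-level integer decomposes below level `K` or is divisible by `p^K` -/
theorem level_lt {p : ℤ} {K : ℕ} {m : ℤ} (h : ¬ p ^ K ∣ m) :
    ∃ j < K, ∃ b, m = p ^ j * b ∧ ¬ p ∣ b := by
  induction K with
  | zero => simp at h
  | succ K ih =>
    by_cases h1 : p ^ K ∣ m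
    · obtain ⟨b, rfl⟩ := h1
      refine ⟨K, by omega, b, rfl, ?_⟩
      intro hb
      exact h (by rw [pow_succ]; exact mul_dvd_mul_left _ hb)
    · obtain ⟨j, hj, b, hb⟩ := ih h1
      exact ⟨j, by omega, b, hb⟩

open Classical in
theorem column_step {p : ℤ} (hp : 2 ≤ p) {K : ℕ} {α β : ℤ} {B : ℤ → ℤ}
    {δ : ℤ → ℤ → ℤ} {v : ℤ → ℤ}
    (ihB : IHh p (K + 1) β α B (fun y x => - δ x y))
    {x a : ℤ} (hx : x - α = p ^ (K + 1) * a) (ha : ¬ p ∣ a)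
    (hr : ∀ y, -2 ≤ δ x y ∧ δ x y ≤ 2)
    (hv : ∀ y, p ^ 3 ∣ v y - v (y - 1) - (if δ x y ≤ 1 then 1 else 0))
    (hQ : ∀ y, Q p (δ x y) (v y) (B y)) :
    ∃ t : ℤ, p ^ 2 * t = v β ∧ (∀ y, δ x y = E p (K + 1) (y - β + p ^ (K + 2) * t)) ∧
      (∀ y b, y - β = p ^ (K + 1) * b → ¬ p ∣ b → p ^ 2 ∣ B y - (b + p * t)) := by
  have hpK : 0 < p ^ K := by positivity
  have p23 : p ^ 2 ∣ p ^ 3 := pow_dvd_pow p (by omega)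
  -- rows of low level
  have low : ∀ y, ¬ p ^ K ∣ y - β → δ x y = 2 := by
    intro y hy
    obtain ⟨j, hj, b, hb, hb'⟩ := level_lt hy
    have := (ihB j (by omega) y b hb hb').2 x
    simp only at this
    rw [hx, E_low (by omega)] at this; omega
  have mid : ∀ m, ¬ p ∣ m → δ x (β + p ^ K * m) = 1 ∧ p ^ 2 ∣ B (β + p ^ K * m) - m := by
    intro m hm
    have := ihB K (by omega) (β + p ^ K * m) m (by ring) hm
    refine ⟨?_, this.1⟩
    have := this.2 x
    simp only at this
    rw [hx, E_mid hp _ ha] at this; omega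
  -- constancy between multiples
  have const : ∀ m : ℤ, ∀ i : ℕ, (i : ℤ) < p ^ K →
      p ^ 3 ∣ v (β + p ^ K * m + i) - v (β + p ^ K * m) := by
    intro m i
    induction i with
    | zero => intro _; simp
    | succ i ih =>
      intro hi
      push_cast at hi
      have h1 := ih (by omega)
      have h2 := hv (β + p ^ K * m + (i + 1 : ℕ))
      rw [low (β + p ^ K * m + (i + 1 : ℕ))] at h2
      · simp only [show ¬ ((2 : ℤ) ≤ 1) by norm_num, if_false] at h2
        have e : β + p ^ K * m + ((i + 1 : ℕ) : ℤ) - 1 = β + p ^ K * m + i := by push_cast; ring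
        rw [e] at h2
        have := dvd_add h1 h2
        refine dv this ?_; ring
      · intro h
        have h3 : p ^ K ∣ ((i : ℤ) + 1) := by
          have := dvd_sub h (Dvd.intro m rfl : p ^ K ∣ p ^ K * m)
          refine dv this ?_; push_cast; ring
        have := Int.le_of_dvd (by omega) h3
        omega
  let N : ℤ → ℤ := fun m => v (β + p ^ K * m)
  have hN : ∀ m, p ^ 3 ∣ N m - N (m - 1) - (if δ x (β + p ^ K * m) ≤ 1 then 1 else 0) := by
    intro m
    have h1 := hv (β + p ^ K * m)
    have h2 := const (m - 1) (p ^ K - 1).toNat (by rw [Int.toNat_of_nonneg] <;> omega)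
    rw [Int.toNat_of_nonneg (by omega)] at h2
    have e : β + p ^ K * (m - 1) + (p ^ K - 1) = β + p ^ K * m - 1 := by ring
    rw [e] at h2
    have := dvd_add h1 h2
    refine dv this ?_
    simp only [N]; ring
  have hNmid : ∀ m, ¬ p ∣ m → p ^ 2 ∣ N m - m := by
    intro m hm
    obtain ⟨h1, h2⟩ := mid m hm
    have := ((hQ (β + p ^ K * m)).1 h1).2
    have := dvd_sub h2 this
    refine dv this ?_; ring
  have hNmid1 : ∀ m, ¬ p ∣ m → p ^ 3 ∣ N m - N (m - 1) - 1 := by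
    intro m hm
    have := hN m
    rw [(mid m hm).1] at this
    simpa using this
  have hle : ∀ m, p ∣ m → δ x (β + p ^ K * m) ≤ 1 := by
    intro m hm
    by_contra hcon
    have h1 := hN m
    rw [if_neg hcon] at h1
    have n1 : ¬ p ∣ m + 1 := fun h => by
      have : p ∣ 1 := by simpa using dvd_sub h hm
      have := Int.le_of_dvd (by omega) this; omega
    have n2 : ¬ p ∣ m - 1 := fun h => by
      have : p ∣ 1 := by simpa using dvd_sub hm h
      have := Int.le_of_dvd (by omega) this; omega
    have h2 := hNmid1 (m + 1) n1
    have h3 := hNmid _ n1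
    have h4 := hNmid _ n2
    have e : m + 1 - 1 = m := by ring
    rw [e] at h2
    have : p ^ 2 ∣ 1 := by
      have := dvd_add (dvd_sub h3 h4) (dvd_neg.2 (dvd_add (p23.trans h1) (p23.trans h2)))
      have h5 := (dvd_neg.2 this)
      ring_nf at this
      simpa using this
    have := Int.le_of_dvd (by omega) this
    nlinarith
  have hN1 : ∀ m, p ^ 3 ∣ N m - N (m - 1) - 1 := by
    intro m
    by_cases hm : p ∣ m
    · have := hN m
      rw [if_pos (hle m hm)] at this; exact this
    · exact hNmid1 m hm
  have hNall : ∀ m, p ^ 3 ∣ N m - (m + N 0) := by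
    intro m
    induction m using Int.induction_on with
    | zero => simp
    | succ i ih =>
      have := dvd_add ih (hN1 (i + 1))
      refine dv this ?_
      rw [add_sub_cancel_right]; ring
    | pred i ih =>
      have := dvd_sub ih (hN1 (-i))
      refine dv this ?_
      ring
  have n1 : ¬ p ∣ 1 := fun h => by
    have := Int.le_of_dvd (by omega) h; omega
  obtain ⟨t, ht⟩ : p ^ 2 ∣ N 0 := by
    have h1 := hNmid 1 n1
    have h2 := p23.trans (hNall 1)
    have := dvd_sub h1 h2
    refine dv this ?_; ring
  have N0 : N 0 = v β := by simp [N]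
  have hNt : ∀ m, p ^ 3 ∣ N m - (m + p ^ 2 * t) := by
    intro m; rw [← ht]; exact hNall m
  have pm : ∀ m, p ∣ m → p ∣ N m := by
    intro m hm
    have h1 := (Dvd.intro_left (p^2) (by ring : p ^ 2 * p = p ^ 3)).trans (hNt m)
    have h2 : p ∣ m + p ^ 2 * t := dvd_add hm ⟨p * t, by ring⟩
    simpa using dvd_add h1 h2
  have hδ : ∀ m, p ∣ m → δ x (β + p ^ K * m) = E p 1 (m + p ^ 2 * t) := by
    intro m hm
    obtain ⟨q1, q2, q3, q4⟩ := hQ (β + p ^ K * m)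
    change _ = 1 → ¬ p ∣ N m ∧ _ at q1
    change _ = 0 → p ∣ N m ∧ ¬ p ^ 2 ∣ N m ∧ _ at q2
    change _ = -1 → p ^ 2 ∣ N m ∧ ¬ p ^ 3 ∣ N m at q3
    change _ = -2 → p ^ 3 ∣ N m at q4
    have h0 := pm m hm
    have hl := hle m hm
    obtain ⟨hr1, hr2⟩ := hr (β + p ^ K * m)
    rw [← E_congr (hNt m)]
    have c1 : p ^ 1 ∣ p * N m := ⟨N m, by ring⟩
    have c2 : p ^ 1 ∣ N m := by simpa using h0
    simp only [E, c1, c2, if_true]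
    have cases : δ x (β + p ^ K * m) = 1 ∨ δ x (β + p ^ K * m) = 0 ∨
      δ x (β + p ^ K * m) = -1 ∨ δ x (β + p ^ K * m) = -2 := by omega
    rcases cases with h | h | h | h
    · exact absurd h0 (q1 h).1
    · have := (q2 h).2.1
      rw [h, if_neg (by simpa using this), if_neg (by intro h'; exact this (p23.trans h'))]; simp
    · have := q3 h
      rw [h, if_pos (by simpa using this.1), if_neg (by simpa using this.2)]; simp
    · have := q4 h
      rw [h, if_pos (by simpa using p23.trans this), if_pos (by simpa using this)]; simp
  refine ⟨t, by rw [← ht, N0], ?_, ?_⟩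
  · intro y
    by_cases hy : p ^ K ∣ y - β
    · obtain ⟨m, hm⟩ := hy
      have ey : y = β + p ^ K * m := by linarith
      have : y - β + p ^ (K + 2) * t = p ^ K * (m + p ^ 2 * t) := by rw [hm]; ring
      rw [this, E_mul hp]
      by_cases hpm : p ∣ m
      · rw [ey]; exact hδ m hpm
      · rw [ey, (mid m hpm).1]
        have c1 : p ^ 1 ∣ p * (m + p ^ 2 * t) := by rw [pow_one]; exact Dvd.intro _ rfl
        have c2 : ¬ p ∣ m + p ^ 2 * t := by
          intro h
          apply hpm
          have h2 : p ∣ p ^ 2 * t := ⟨p * t, by ring⟩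
          simpa using dvd_sub h h2
        have c3 : ∀ i, i ≠ 0 → ¬ p ^ i ∣ m + p ^ 2 * t := fun i hi h => c2 ((dvd_pow_self p hi).trans h)
        simp [E, c2, c3]
    · rw [low y hy, E_two _ hp]
      intro h
      apply hy
      have h2 : p ^ K ∣ p ^ (K + 2) * t := Dvd.dvd.mul_right (pow_dvd_pow p (by omega)) _
      simpa using dvd_sub h h2
  · intro y b hb hpb
    have ey : y = β + p ^ K * (p * b) := by rw [pow_succ] at hb; linarith
    have hd := hδ (p * b) ⟨b, rfl⟩
    have e0 : E p 1 (p * b + p ^ 2 * t) = 0 := by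
      have h2 : p * b + p ^ 2 * t = p * (b + p * t) := by ring
      have c0 : ¬ p ∣ b + p * t := by
        intro h; apply hpb; simpa using dvd_sub h (Dvd.intro t rfl : p ∣ p * t)
      have c1 : p ^ 1 ∣ p * (p * (b + p * t)) := by rw [pow_one]; exact Dvd.intro _ rfl
      have c2 : p ^ 1 ∣ p * (b + p * t) := by rw [pow_one]; exact Dvd.intro _ rfl
      have c3 : ¬ p ^ (1+1) ∣ p * (b + p * t) := by
        rw [pow_succ, pow_one, mul_dvd_mul_iff_left (by omega)]; exact c0
      have c4 : ¬ p ^ (1+2) ∣ p * (b + p * t) := fun h => c3 ((pow_dvd_pow p (by omega)).trans h)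
      rw [h2]
      simp only [E, c1, c2, c3, c4]; simp
    rw [e0] at hd
    have := ((hQ (β + p ^ K * (p * b))).2.1 hd).2.2
    have h3 := hNt (p * b)
    change p ^ 3 ∣ p * _ - N (p * b) at this
    have h4 := dvd_add this h3
    rw [ey]
    have h5 : p * p ^ 2 ∣ p * (B (β + p ^ K * (p * b)) - (b + p * t)) := by
      rw [show p * p ^ 2 = p ^ 3 by ring]; refine dv h4 ?_; ring
    exact (mul_dvd_mul_iff_left (by omega)).1 h5

open Classical in
theorem half_step {p : ℤ} (hp : 2 ≤ p) {K : ℕ} {α β : ℤ} {c B : ℤ → ℤ}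
    {δ v : ℤ → ℤ → ℤ}
    (ihB : IHh p (K + 1) β α B (fun y x => - δ x y))
    (hc : ∀ x, p ^ 2 ∣ c x - (x - α))
    (hr : ∀ x y, -2 ≤ δ x y ∧ δ x y ≤ 2)
    (hv : ∀ x y, p ∣ c x → p ^ 3 ∣ v x y - v x (y - 1) - (if δ x y ≤ 1 then 1 else 0))
    (hQ : ∀ x y, p ∣ c x → Q p (δ x y) (v x y) (B y)) :
    ∃ β' : ℤ, p ^ (K + 2) ∣ β' - β ∧
      (∀ x a, x - α = p ^ (K + 1) * a → ¬ p ∣ a → ∀ y, δ x y = E p (K + 1) (y - β')) ∧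
      (∀ y b, y - β' = p ^ (K + 1) * b → ¬ p ∣ b → p ^ 2 ∣ B y - b) := by
  have n1 : ¬ p ∣ 1 := fun h => by
    have := Int.le_of_dvd (by omega) h; omega
  have key : ∀ x a, x - α = p ^ (K + 1) * a → ¬ p ∣ a →
    ∃ t : ℤ, (∀ y, δ x y = E p (K + 1) (y - β + p ^ (K + 2) * t)) ∧
      (∀ y b, y - β = p ^ (K + 1) * b → ¬ p ∣ b → p ^ 2 ∣ B y - (b + p * t)) := by
    intro x a hx ha
    have pc : p ∣ c x := by
      have h1 := (dvd_pow_self p (by norm_num : 2 ≠ 0)).trans (hc x)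
      have h2 : p ∣ x - α := by rw [hx, pow_succ']; exact ⟨p ^ K * a, by ring⟩
      simpa using dvd_add h1 h2
    obtain ⟨t, -, ht⟩ := column_step hp ihB hx ha (hr x) (fun y => hv x y pc) (fun y => hQ x y pc)
    exact ⟨t, ht⟩
  obtain ⟨t0, h1, h2⟩ := key (α + p ^ (K + 1)) 1 (by ring) n1
  refine ⟨β - p ^ (K + 2) * t0, ⟨-t0, by ring⟩, ?_, ?_⟩
  · intro x a hx ha y
    obtain ⟨t, h3, h4⟩ := key x a hx ha
    have h5 := h2 (β + p ^ (K + 1)) 1 (by ring) n1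
    have h6 := h4 (β + p ^ (K + 1)) 1 (by ring) n1
    have h7 : p * p ∣ p * (t - t0) := by
      rw [← pow_two]; refine dv (dvd_sub h5 h6) ?_; ring
    obtain ⟨s, hs⟩ := (mul_dvd_mul_iff_left (by omega : p ≠ 0)).1 h7
    rw [h3 y]
    apply E_congr
    have : t = t0 + p * s := by linarith
    rw [this]
    exact ⟨s, by ring⟩
  · intro y b hb hpb
    have := h2 y (b - p * t0) (by linear_combination hb) (by
      intro h; apply hpb; simpa using dvd_add h (Dvd.intro t0 rfl : p ∣ p * t0))
    simpa using this

theorem IHh_shift {p : ℤ} {K : ℕ} {α β α' β' : ℤ} {A : ℤ → ℤ} {δ : ℤ → ℤ → ℤ}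
    (h : IHh p (K + 1) α β A δ) (ha : p ^ (K + 2) ∣ α' - α) (hb : p ^ (K + 2) ∣ β' - β) :
    IHh p (K + 1) α' β' A δ := by
  intro j hj x a hx hpa
  obtain ⟨s, hs⟩ := ha
  obtain ⟨i, hi⟩ := Nat.exists_eq_add_of_le (show j + 2 ≤ K + 2 by omega)
  have e : x - α = p ^ j * (a + p ^ 2 * (p ^ i * s)) := by
    have : x - α = p ^ j * a + p ^ (K + 2) * s := by linear_combination hx + hs
    rw [this, hi]; ring
  obtain ⟨h1, h2⟩ := h j hj x _ e (by
    intro h; apply hpa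
    have h3 : p ∣ p ^ 2 * (p ^ i * s) := ⟨p * (p ^ i * s), by ring⟩
    simpa using dvd_sub h h3)
  refine ⟨?_, ?_⟩
  · refine dv (dvd_add h1 (Dvd.intro _ rfl : p ^ 2 ∣ p ^ 2 * (p ^ i * s))) ?_; ring
  · intro y
    rw [h2 y]
    apply E_congr
    refine dv ((pow_dvd_pow p (show j + 2 ≤ K + 2 by omega)).trans hb) ?_
    ring

open Classical in
/-- The local rules of the `p`-adic layer. -/
structure Layer (p : ℤ) (c A d B : ℤ → ℤ) (δ v h : ℤ → ℤ → ℤ) : Prop where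
  hr : ∀ x y, -2 ≤ δ x y ∧ δ x y ≤ 2
  hc : ∀ x, p ^ 2 ∣ c (x + 1) - c x - 1
  hd : ∀ y, p ^ 2 ∣ d (y + 1) - d y - 1
  r0c : ∀ x y, ¬ p ∣ c x → p ^ 2 ∣ A x - c x ∧ δ x y = E p 0 (d y)
  r0d : ∀ x y, ¬ p ∣ d y → p ^ 2 ∣ B y - d y ∧ δ x y = - E p 0 (c x)
  r1v : ∀ x y, p ∣ c x → p ^ 3 ∣ v x y - v x (y - 1) - (if δ x y ≤ 1 then 1 else 0)
  r1Q : ∀ x y, p ∣ c x → Q p (δ x y) (v x y) (B y)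
  r2h : ∀ x y, p ∣ d y → p ^ 3 ∣ h x y - h (x - 1) y - (if -δ x y ≤ 1 then 1 else 0)
  r2Q : ∀ x y, p ∣ d y → Q p (-δ x y) (h x y) (A x)

theorem phase {p : ℤ} {c : ℤ → ℤ} (hc : ∀ x, p ^ 2 ∣ c (x + 1) - c x - 1) :
    ∀ x, p ^ 2 ∣ c x - (x - (- c 0)) := by
  intro x
  induction x using Int.induction_on with
  | zero => simp
  | succ i ih => refine dv (dvd_add ih (hc i)) ?_; ring
  | pred i ih =>
    have := hc (-i - 1)
    rw [sub_add_cancel] at this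
    refine dv (dvd_sub ih this) ?_; ring

theorem Layer.sound {p : ℤ} (hp : 2 ≤ p) {c A d B : ℤ → ℤ} {δ v h : ℤ → ℤ → ℤ}
    (L : Layer p c A d B δ v h) (K : ℕ) :
    ∃ α β : ℤ, (∀ x, p ^ 2 ∣ c x - (x - α)) ∧ (∀ y, p ^ 2 ∣ d y - (y - β)) ∧
      IHh p (K + 1) α β A δ ∧ IHh p (K + 1) β α B (fun y x => - δ x y) := by
  have p12 : p ∣ p ^ 2 := dvd_pow_self p (by norm_num)
  induction K with
  | zero =>
    refine ⟨-c 0, -d 0, phase L.hc, phase L.hd, ?_, ?_⟩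
    · intro j hj x a hx ha
      obtain rfl : j = 0 := by omega
      have h0 := phase L.hc x
      have hx' : x - -c 0 = a := by simpa using hx
      rw [hx'] at h0
      have h1 : ¬ p ∣ c x := fun h => ha (by simpa using dvd_sub h (p12.trans h0))
      refine ⟨?_, ?_⟩
      · refine dv (dvd_add (L.r0c x 0 h1).1 h0) ?_; ring
      · intro y
        rw [(L.r0c x y h1).2]
        exact E_congr (phase L.hd y)
    · intro j hj x a hx ha
      obtain rfl : j = 0 := by omega
      have h0 := phase L.hd x
      have hx' : x - -d 0 = a := by simpa using hx
      rw [hx'] at h0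
      have h1 : ¬ p ∣ d x := fun h => ha (by simpa using dvd_sub h (p12.trans h0))
      refine ⟨?_, ?_⟩
      · refine dv (dvd_add (L.r0d 0 x h1).1 h0) ?_; ring
      · intro y
        simp only
        rw [(L.r0d y x h1).2, neg_neg]
        exact E_congr (phase L.hc y)
  | succ K ih =>
    obtain ⟨α, β, hc, hd, ih1, ih2⟩ := ih
    obtain ⟨β', hβ, h1, h2⟩ := half_step hp ih2 hc L.hr L.r1v L.r1Q
    obtain ⟨α', hα, h3, h4⟩ := half_step (δ := fun y x => - δ x y) (v := fun y x => h x y) hp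
      (by simpa using ih1) hd
      (fun y x => by have := L.hr x y; constructor <;> omega) (fun y x => L.r2h x y)
      (fun y x => L.r2Q x y)
    have p2K : p ^ 2 ∣ p ^ (K + 2) := pow_dvd_pow p (by omega)
    have lev : ∀ γ γ' z a : ℤ, p ^ (K + 2) ∣ γ' - γ → z - γ' = p ^ (K + 1) * a → ¬ p ∣ a →
        ∃ a', z - γ = p ^ (K + 1) * a' ∧ ¬ p ∣ a' := by
      rintro γ γ' z a ⟨s, hs⟩ hz ha
      refine ⟨a + p * s, by linear_combination hz + hs, ?_⟩
      intro h; apply ha; simpa using dvd_sub h (Dvd.intro s rfl : p ∣ p * s)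
    refine ⟨α', β', ?_, ?_, ?_, ?_⟩
    · intro x; refine dv (dvd_add (hc x) (p2K.trans hα)) ?_; ring
    · intro x; refine dv (dvd_add (hd x) (p2K.trans hβ)) ?_; ring
    · intro j hj x a hx ha
      rcases Nat.lt_succ_iff_lt_or_eq.1 hj with hj | rfl
      · exact IHh_shift ih1 hα hβ j hj x a hx ha
      · obtain ⟨a', ha', ha''⟩ := lev α α' x a hα hx ha
        exact ⟨h4 x a hx ha, h1 x a' ha' ha''⟩
    · intro j hj x a hx ha
      rcases Nat.lt_succ_iff_lt_or_eq.1 hj with hj | rfl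
      · exact IHh_shift ih2 hβ hα j hj x a hx ha
      · obtain ⟨a', ha', ha''⟩ := lev β β' x a hβ hx ha
        exact ⟨h2 x a hx ha, h3 x a' ha' ha''⟩

end PLayer
end

open Set Metric
section

namespace PR
variable {α β γ σ : Type} [Primcodable α] [Primcodable β] [Primcodable γ] [Primcodable σ]

theorem ex_mem {f : α → List β} {p : α → β → Prop} (hf : Primrec f) (hp : PrimrecRel p) :
    PrimrecPred fun a => ∃ b ∈ f a, p a b :=
  (PrimrecRel.exists_mem_list (R := fun b a => p a b) hp.swap).comp hf Primrec.id

theorem all_mem {f : α → List β} {p : α → β → Prop} (hf : Primrec f) (hp : PrimrecRel p) :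
    PrimrecPred fun a => ∀ b ∈ f a, p a b :=
  (PrimrecRel.forall_mem_list (R := fun b a => p a b) hp.swap).comp hf Primrec.id

theorem mem {f : α → List β} {g : α → β} (hf : Primrec f) (hg : Primrec g) :
    PrimrecPred fun a => g a ∈ f a := by
  refine (ex_mem (p := fun a b => g a = b) hf ?_).of_eq ?_
  · exact PrimrecRel.comp₂ Primrec.eq (hg.comp₂ Primrec₂.left) Primrec₂.right
  · intro a; simp

open Classical in
theorem filter {f : α → List β} {p : α → β → Prop} (hf : Primrec f) (hp : PrimrecRel p) :
    Primrec fun a => (f a).filter (fun b => decide (p a b)) := by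
  have : Primrec fun a => (f a).filterMap (fun b => if p a b then some b else none) := by
    refine Primrec.listFilterMap hf ?_
    exact Primrec.ite (c := fun x : α × β => p x.1 x.2) hp
      (Primrec.option_some.comp Primrec.snd) (Primrec.const none)
  refine this.of_eq fun a => ?_
  rw [← List.filterMap_eq_filter]
  congr 1
  ext b
  simp [Option.guard]

theorem imp {p q : α → Prop} (hp : PrimrecPred p) (hq : PrimrecPred q) :
    PrimrecPred fun a => p a → q a := by
  refine (hp.not.or hq).of_eq fun a => ?_
  tauto

theorem constP (p : Prop) : PrimrecPred fun _ : α => p := by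
  classical
  exact Primrec.primrecPred (Primrec.const (decide p))

theorem flatMap_fixed {D : Type} (L : List D) {w : D → α → List σ} (h : ∀ d ∈ L, Primrec (w d)) :
    Primrec fun a => L.flatMap (fun d => w d a) := by
  induction L with
  | nil => exact Primrec.const []
  | cons d L ih =>
    have h1 := h d (by simp)
    have h2 := ih (fun d' hd => h d' (by simp [hd]))
    exact (Primrec.list_append.comp h1 h2).of_eq fun a => by simp

theorem map_fixed {D : Type} (L : List D) {w : D → α → σ} (h : ∀ d ∈ L, Primrec (w d)) :
    Primrec fun a => L.map (fun d => w d a) := by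
  induction L with
  | nil => exact Primrec.const []
  | cons d L ih =>
    have h1 := h d (by simp)
    have h2 := ih (fun d' hd => h d' (by simp [hd]))
    exact (Primrec.list_cons.comp h1 h2).of_eq fun a => by simp

theorem all_fixed {D : Type} (L : List D) {p : D → α → Prop} (h : ∀ d ∈ L, PrimrecPred (p d)) :
    PrimrecPred fun a => ∀ d ∈ L, p d a := by
  induction L with
  | nil => exact (constP True).of_eq (by simp)
  | cons d L ih =>
    exact ((h d (by simp)).and (ih fun d' hd => h d' (by simp [hd]))).of_eq fun a => by simp

theorem ex_fixed {D : Type} (L : List D) {p : D → α → Prop} (h : ∀ d ∈ L, PrimrecPred (p d)) :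
    PrimrecPred fun a => ∃ d ∈ L, p d a := by
  induction L with
  | nil => exact (constP False).of_eq (by simp)
  | cons d L ih =>
    exact ((h d (by simp)).or (ih fun d' hd => h d' (by simp [hd]))).of_eq fun a => by simp

theorem product {f : α → List β} {g : α → List γ} (hf : Primrec f) (hg : Primrec g) :
    Primrec fun a => f a ×ˢ g a := by
  refine Primrec.of_eq (f := fun a => (f a).flatMap fun b => (g a).map fun c => (b, c)) ?_ ?_
  · refine Primrec.list_flatMap hf ?_
    refine Primrec.list_map (hg.comp Primrec.fst) ?_
    exact (Primrec.pair (Primrec.snd.comp Primrec.fst) Primrec.snd)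
  · intro a; rfl

end PR
end

open Set Metric
section

namespace PLayer

open Classical in
/-- Local cell rule. -/
structure CellOK (p : ℤ) (c A d B δ vs vn hw he : ℤ) : Prop where
  hr : -2 ≤ δ ∧ δ ≤ 2
  r0c : ¬ p ∣ c → p ^ 2 ∣ A - c ∧ δ = E p 0 d
  r0d : ¬ p ∣ d → p ^ 2 ∣ B - d ∧ δ = - E p 0 c
  r1v : p ∣ c → p ^ 3 ∣ vn - vs - (if δ ≤ 1 then 1 else 0)
  r1Q : p ∣ c → Q p δ vn B
  r2h : p ∣ d → p ^ 3 ∣ he - hw - (if -δ ≤ 1 then 1 else 0)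
  r2Q : p ∣ d → Q p (-δ) he A

theorem dvd_iff_of_sub {k n a a' : ℤ} (h : n ∣ a - a') (hk : k ∣ n) : k ∣ a ↔ k ∣ a' := by
  have h1 := hk.trans h
  constructor
  · intro h2; simpa using dvd_sub h2 h1
  · intro h2; simpa using dvd_add h1 h2

theorem Q_congr {p δ N N' B B' : ℤ} (hN : p ^ 3 ∣ N - N') (hB : p ^ 2 ∣ B - B')
    (h : Q p δ N B) : Q p δ N' B' := by
  have e1 : p ∣ N ↔ p ∣ N' := dvd_iff_of_sub hN (dvd_pow_self p (by norm_num))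
  have e2 : p ^ 2 ∣ N ↔ p ^ 2 ∣ N' := dvd_iff_of_sub hN (pow_dvd_pow p (by norm_num))
  have e3 : p ^ 3 ∣ N ↔ p ^ 3 ∣ N' := dvd_iff_of_sub hN dvd_rfl
  have e4 : p ^ 2 ∣ B - N ↔ p ^ 2 ∣ B' - N' := by
    refine dvd_iff_of_sub (n := p ^ 2) ?_ dvd_rfl
    have := dvd_sub hB ((pow_dvd_pow p (by norm_num : 2 ≤ 3)).trans hN)
    refine dv this ?_; ring
  have e5 : p ^ 3 ∣ p * B - N ↔ p ^ 3 ∣ p * B' - N' := by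
    refine dvd_iff_of_sub (n := p ^ 3) ?_ dvd_rfl
    have h1 : p ^ 3 ∣ p * (B - B') := by rw [pow_succ']; exact mul_dvd_mul_left p hB
    refine dv (dvd_sub h1 hN) ?_; ring
  unfold Q at h ⊢
  rw [← e1, ← e2, ← e3, ← e4, ← e5]; exact h

theorem CellOK.congr {p c A d B δ vs vn hw he c' A' d' B' vs' vn' hw' he' : ℤ}
    (h : CellOK p c A d B δ vs vn hw he)
    (hc : p ^ 2 ∣ c - c') (hA : p ^ 2 ∣ A - A') (hd : p ^ 2 ∣ d - d') (hB : p ^ 2 ∣ B - B')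
    (h1 : p ^ 3 ∣ vs - vs') (h2 : p ^ 3 ∣ vn - vn') (h3 : p ^ 3 ∣ hw - hw')
    (h4 : p ^ 3 ∣ he - he') : CellOK p c' A' d' B' δ vs' vn' hw' he' := by
  have p12 : p ∣ p ^ 2 := dvd_pow_self p (by norm_num)
  have ec : p ∣ c ↔ p ∣ c' := dvd_iff_of_sub hc p12
  have ed : p ∣ d ↔ p ∣ d' := dvd_iff_of_sub hd p12
  have eE : E p 0 d = E p 0 d' := E_congr (by simpa using hd)
  have eE' : E p 0 c = E p 0 c' := E_congr (by simpa using hc)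
  refine ⟨h.hr, ?_, ?_, ?_, ?_, ?_, ?_⟩
  · rw [← ec, ← eE]; intro hh
    obtain ⟨a, b⟩ := h.r0c hh
    refine ⟨?_, b⟩
    refine dv (dvd_add (dvd_sub a hA) hc) ?_; ring
  · rw [← ed, ← eE']; intro hh
    obtain ⟨a, b⟩ := h.r0d hh
    refine ⟨?_, b⟩
    refine dv (dvd_add (dvd_sub a hB) hd) ?_; ring
  · rw [← ec]; intro hh
    refine dv (dvd_add (dvd_sub (h.r1v hh) h2) h1) ?_; ring
  · rw [← ec]; intro hh; exact Q_congr h2 hB (h.r1Q hh)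
  · rw [← ed]; intro hh
    refine dv (dvd_add (dvd_sub (h.r2h hh) h4) h3) ?_; ring
  · rw [← ed]; intro hh; exact Q_congr h4 hA (h.r2Q hh)

/-- existence of a level -/
theorem exists_level {p : ℤ} (hp : 2 ≤ p) {x : ℤ} (hx : 1 ≤ x) :
    ∃ j : ℕ, ∃ a, x = p ^ j * a ∧ ¬ p ∣ a := by
  have : ¬ p ^ (x.toNat) ∣ x := by
    intro h
    have h1 := Int.le_of_dvd (by omega) h
    have h2 : (x.toNat : ℤ) < p ^ x.toNat := by
      have := Nat.lt_pow_self (n := x.toNat) (a := p.toNat) (by omega)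
      have h3 : ((p.toNat ^ x.toNat : ℕ) : ℤ) = p ^ x.toNat := by
        push_cast; rw [Int.toNat_of_nonneg (by omega)]
      rw [← h3]; exact_mod_cast this
    omega
  obtain ⟨j, -, b, hb⟩ := level_lt this
  exact ⟨j, b, hb⟩

open Classical in
/-- the level (valuation) -/
def lev (p x : ℤ) : ℕ := if h : ∃ j : ℕ, ∃ a, x = p ^ j * a ∧ ¬ p ∣ a then h.choose else 0

theorem lev_spec {p : ℤ} (hp : 2 ≤ p) {x : ℤ} (hx : 1 ≤ x) :
    ∃ a, x = p ^ lev p x * a ∧ ¬ p ∣ a := by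
  have h := exists_level hp hx
  unfold lev; rw [dif_pos h]; exact h.choose_spec

theorem pow_dvd_level {p : ℤ} (hp : 2 ≤ p) {i j : ℕ} {b : ℤ} (hb : ¬ p ∣ b) :
    p ^ j ∣ p ^ i * b ↔ j ≤ i := by
  constructor
  · intro h
    by_contra hcon
    obtain ⟨k, rfl⟩ := Nat.exists_eq_add_of_lt (by omega : i < j)
    have h0 : p ^ i ≠ 0 := by positivity
    rw [show i + k + 1 = i + (k + 1) by ring, pow_add, mul_dvd_mul_iff_left h0] at h
    exact hb ((dvd_pow_self p (by omega)).trans h)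
  · intro h; exact Dvd.dvd.mul_right (pow_dvd_pow p h) _

theorem E_level {p : ℤ} (hp : 2 ≤ p) {i j : ℕ} {b : ℤ} (hb : ¬ p ∣ b) :
    E p j (p ^ i * b) = max (-2) (min 2 ((j : ℤ) - i)) := by
  have h1 : p * (p ^ i * b) = p ^ (i + 1) * b := by ring
  unfold E
  rw [h1]
  simp only [pow_dvd_level hp hb]
  split_ifs <;> omega

theorem lev_le {p : ℤ} (hp : 2 ≤ p) {x : ℤ} (hx : 1 ≤ x) : (lev p x : ℤ) ≤ x := by
  obtain ⟨a, ha, hpa⟩ := lev_spec hp hx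
  have h1 : p ^ lev p x ∣ x := Dvd.intro a ha.symm
  have h2 := Int.le_of_dvd (by omega) h1
  have := Nat.lt_pow_self (n := lev p x) (a := p.toNat) (by omega)
  have h3 : ((p.toNat ^ lev p x : ℕ) : ℤ) = p ^ lev p x := by
    push_cast; rw [Int.toNat_of_nonneg (by omega)]
  have h4 : (lev p x : ℤ) < p ^ lev p x := by rw [← h3]; exact_mod_cast this
  omega

theorem floor_step {m : ℤ} (hm : 0 < m) (y : ℤ) :
    y / m - (y - 1) / m = if m ∣ y then 1 else 0 := by
  split_ifs with h
  · obtain ⟨k, rfl⟩ := h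
    rw [Int.mul_ediv_cancel_left _ (by omega)]
    have : (m * k - 1) / m = k - 1 := by
      rw [show m * k - 1 = (m - 1) + m * (k - 1) by ring, Int.add_mul_ediv_left _ _ (by omega),
        Int.ediv_eq_zero_of_lt (by omega) (by omega)]; ring
    rw [this]; ring
  · have h1 := Int.emod_add_mul_ediv y m
    have h2 := Int.emod_nonneg y (by omega : m ≠ 0)
    have h3 := Int.emod_lt_of_pos y hm
    have h4 : y % m ≠ 0 := fun h' => h (Int.dvd_of_emod_eq_zero h')
    have : (y - 1) / m = y / m := by
      rw [show y - 1 = (y % m - 1) + m * (y / m) by omega, Int.add_mul_ediv_left _ _ (by omega),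
        Int.ediv_eq_zero_of_lt (by omega) (by omega)]; ring
    omega

/-- unit part -/
def upart (p x : ℤ) : ℤ := x / p ^ lev p x
/-- canonical counter -/
def cnt (p x y : ℤ) : ℤ := y / p ^ (lev p x - 1)
/-- canonical delta -/
def del (p x y : ℤ) : ℤ := E p (lev p x) y

theorem del_eq {p : ℤ} (hp : 2 ≤ p) {x y : ℤ} (hy : 1 ≤ y) :
    del p x y = max (-2) (min 2 ((lev p x : ℤ) - lev p y)) := by
  obtain ⟨b, hb, hpb⟩ := lev_spec hp hy
  unfold del
  conv_lhs => rw [hb]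
  exact E_level hp hpb

theorem dvd_iff_lev {p : ℤ} (hp : 2 ≤ p) {x : ℤ} (hx : 1 ≤ x) (j : ℕ) :
    p ^ j ∣ x ↔ j ≤ lev p x := by
  obtain ⟨b, hb, hpb⟩ := lev_spec hp hx
  conv_lhs => rw [hb]
  exact pow_dvd_level hp hpb

theorem canon_half {p : ℤ} (hp : 2 ≤ p) {x y : ℤ} (hx : 1 ≤ x) (hy : 1 ≤ y) (h : p ∣ x) :
    p ^ 3 ∣ cnt p x y - cnt p x (y - 1) - (if del p x y ≤ 1 then 1 else 0) ∧
      Q p (del p x y) (cnt p x y) (upart p y) := by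
  have h1 : 1 ≤ lev p x := (dvd_iff_lev hp hx 1).1 (by simpa using h)
  obtain ⟨K, hK⟩ := Nat.exists_eq_add_of_le' h1
  have hpK : 0 < p ^ K := by positivity
  have hd := del_eq hp (x := x) hy
  obtain ⟨b, hb, hpb⟩ := lev_spec hp hy
  have hup : upart p y = b := by
    unfold upart; conv_lhs => rw [hb]
    rw [← hb]
    conv_lhs => lhs; rw [hb]
    exact Int.mul_ediv_cancel_left _ (by positivity)
  constructor
  · unfold cnt
    rw [hK, Nat.add_sub_cancel, floor_step hpK]
    have : p ^ K ∣ y ↔ del p x y ≤ 1 := by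
      rw [dvd_iff_lev hp hy, hd, hK]; push_cast; omega
    simp only [this]; simp
  · have hN : ∀ i, lev p y = K + i → cnt p x y = p ^ i * b := by
      intro i hi
      unfold cnt
      rw [hK, Nat.add_sub_cancel]
      conv_lhs => rw [hb, hi, pow_add, mul_assoc]
      exact Int.mul_ediv_cancel_left _ (by omega)
    rw [hup]
    rw [hK] at hd
    push_cast at hd
    refine ⟨?_, ?_, ?_, ?_⟩
    · intro h2
      have := hN 0 (by omega)
      rw [this]; simp [hpb]
    · intro h2
      have := hN 1 (by omega)
      rw [this]
      refine ⟨⟨b, by ring⟩, ?_, by simp⟩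
      rw [pow_dvd_level hp hpb]; omega
    · intro h2
      have := hN 2 (by omega)
      rw [this]
      refine ⟨⟨b, by ring⟩, ?_⟩
      rw [pow_dvd_level hp hpb]; omega
    · intro h2
      have := hN (lev p y - K) (by omega)
      rw [this, pow_dvd_level hp hpb]; omega

theorem lev_zero {p : ℤ} (hp : 2 ≤ p) {x : ℤ} (hx : 1 ≤ x) (h : ¬ p ∣ x) : lev p x = 0 := by
  by_contra h0
  exact h (by simpa using (dvd_iff_lev hp hx 1).2 (by omega))

theorem canon {p : ℤ} (hp : 2 ≤ p) {x y : ℤ} (hx : 1 ≤ x) (hy : 1 ≤ y) :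
    CellOK p x (upart p x) y (upart p y) (del p x y)
      (cnt p x (y - 1)) (cnt p x y) (cnt p y (x - 1)) (cnt p y x) := by
  have anti : del p y x = - del p x y := by
    rw [del_eq hp hx, del_eq hp hy]; omega
  refine ⟨?_, ?_, ?_, ?_, ?_, ?_, ?_⟩
  · rw [del_eq hp hy]; omega
  · intro h
    have := lev_zero hp hx h
    constructor
    · unfold upart; rw [this]; simp
    · unfold del; rw [this]
  · intro h
    have := lev_zero hp hy h
    constructor
    · unfold upart; rw [this]; simp
    · rw [← neg_eq_iff_eq_neg, ← anti]; unfold del; rw [this]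
  · intro h; exact (canon_half hp hx hy h).1
  · intro h; exact (canon_half hp hx hy h).2
  · intro h; rw [← anti]; exact (canon_half hp hy hx h).1
  · intro h; rw [← anti]; exact (canon_half hp hy hx h).2

end PLayer
end

open Set Metric
section

namespace PLayer

/-- reduction of an integer modulo `n` -/
def red (n : ℕ) [NeZero n] (z : ℤ) : Fin n :=
  ⟨(z % n).toNat, by
    have h : 0 < n := Nat.pos_of_neZero n
    have := Int.emod_nonneg z (show (n : ℤ) ≠ 0 by omega)
    have := Int.emod_lt_of_pos z (show (0 : ℤ) < n by omega)
    omega⟩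

theorem red_dvd (n : ℕ) [NeZero n] (z : ℤ) : (n : ℤ) ∣ z - ((red n z : ℕ) : ℤ) := by
  have h : 0 < n := Nat.pos_of_neZero n
  have := Int.emod_nonneg z (show (n : ℤ) ≠ 0 by omega)
  simp only [red]
  rw [Int.toNat_of_nonneg this]
  exact Int.dvd_self_sub_emod

theorem red_eq {n : ℕ} [NeZero n] {z z' : ℤ} (h : (n : ℤ) ∣ z - z') : red n z = red n z' := by
  apply Fin.ext
  simp only [red]
  congr 1
  exact (Int.modEq_iff_dvd.2 h).symm

/-- The data of the `p`-layer of a cell. -/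
structure LD (p : ℕ) where
  c : Fin (p ^ 2)
  A : Fin (p ^ 2)
  d : Fin (p ^ 2)
  B : Fin (p ^ 2)
  δ : Fin 5
  vs : Fin (p ^ 3)
  vn : Fin (p ^ 3)
  hw : Fin (p ^ 3)
  he : Fin (p ^ 3)

instance (p : ℕ) : Finite (LD p) := by
  refine Finite.of_injective (β := Fin (p ^ 2) × Fin (p ^ 2) × Fin (p ^ 2) × Fin (p ^ 2) × Fin 5 ×
    Fin (p ^ 3) × Fin (p ^ 3) × Fin (p ^ 3) × Fin (p ^ 3))
    (fun t => (t.c, t.A, t.d, t.B, t.δ, t.vs, t.vn, t.hw, t.he)) ?_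
  rintro ⟨⟩ ⟨⟩ h
  simpa using h

variable {p : ℕ} [NeZero p]

def LD.dz (t : LD p) : ℤ := ((t.δ : ℕ) : ℤ) - 2

def LD.OK (t : LD p) : Prop :=
  CellOK p (t.c : ℕ) (t.A : ℕ) (t.d : ℕ) (t.B : ℕ) t.dz (t.vs : ℕ) (t.vn : ℕ) (t.hw : ℕ) (t.he : ℕ)

def LD.south (t : LD p) : ℕ := Encodable.encode (t.c, t.A, t.vs, t.d)
def LD.north (t : LD p) : ℕ := Encodable.encode (t.c, t.A, t.vn, red (p ^ 2) (((t.d : ℕ) : ℤ) + 1))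
def LD.west (t : LD p) : ℕ := Encodable.encode (t.d, t.B, t.hw, t.c)
def LD.east (t : LD p) : ℕ := Encodable.encode (t.d, t.B, t.he, red (p ^ 2) (((t.c : ℕ) : ℤ) + 1))

/-- soundness of tilings by layer data -/
theorem LD.layer (f : ℤ → ℤ → LD p) (ok : ∀ x y, (f x y).OK)
    (hh : ∀ x y, (f x y).east = (f (x + 1) y).west)
    (hv : ∀ x y, (f x y).north = (f x (y + 1)).south) :
    Layer p (fun x => ((f x 0).c : ℕ)) (fun x => ((f x 0).A : ℕ)) (fun y => ((f 0 y).d : ℕ))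
      (fun y => ((f 0 y).B : ℕ)) (fun x y => (f x y).dz) (fun x y => ((f x y).vn : ℕ))
      (fun x y => ((f x y).he : ℕ)) ∧
      (∀ x y, (f x y).c = (f x 0).c) ∧ (∀ x y, (f x y).d = (f 0 y).d) := by
  simp only [LD.north, LD.south, LD.east, LD.west, Encodable.encode_inj, Prod.mk.injEq] at hh hv
  have cst : ∀ {β : Type} (g : ℤ → β), (∀ y, g y = g (y + 1)) → ∀ y, g y = g 0 := by
    intro β g h y
    induction y using Int.induction_on with
    | zero => rfl
    | succ i ih => rw [← h, ih]
    | pred i ih => rw [h, sub_add_cancel, ih]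
  have hc : ∀ x y, (f x y).c = (f x 0).c := fun x => cst (fun y => (f x y).c) (fun y => (hv x y).1)
  have hA : ∀ x y, (f x y).A = (f x 0).A := fun x => cst (fun y => (f x y).A) (fun y => (hv x y).2.1)
  have hd : ∀ x y, (f x y).d = (f 0 y).d :=
    fun x y => cst (fun x => (f x y).d) (fun x => (hh x y).1) x
  have hB : ∀ x y, (f x y).B = (f 0 y).B :=
    fun x y => cst (fun x => (f x y).B) (fun x => (hh x y).2.1) x
  have hvs : ∀ x y, (f x y).vs = (f x (y - 1)).vn := fun x y => by
    have := (hv x (y - 1)).2.2.1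
    rw [sub_add_cancel] at this; exact this.symm
  have hhw : ∀ x y, (f x y).hw = (f (x - 1) y).he := fun x y => by
    have := (hh (x - 1) y).2.2.1
    rw [sub_add_cancel] at this; exact this.symm
  have ok' : ∀ x y, CellOK p ((f x 0).c : ℕ) ((f x 0).A : ℕ) ((f 0 y).d : ℕ) ((f 0 y).B : ℕ)
      (f x y).dz ((f x (y - 1)).vn : ℕ) ((f x y).vn : ℕ) ((f (x - 1) y).he : ℕ) ((f x y).he : ℕ) := by
    intro x y
    have := ok x y
    unfold LD.OK at this
    rw [hc, hA, hd, hB, hvs, hhw] at this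
    exact this
  refine ⟨⟨fun x y => (ok' x y).hr, ?_, ?_, fun x y => (ok' x y).r0c, fun x y => (ok' x y).r0d,
    fun x y => (ok' x y).r1v, fun x y => (ok' x y).r1Q, fun x y => (ok' x y).r2h,
    fun x y => (ok' x y).r2Q⟩, hc, hd⟩
  · intro x
    have h1 := (hh x 0).2.2.2
    have h2 := red_dvd (p ^ 2) ((((f x 0).c : ℕ) : ℤ) + 1)
    rw [h1] at h2
    push_cast at h2
    refine dv (dvd_neg.2 h2) ?_
    ring
  · intro x
    have h1 := (hv 0 x).2.2.2
    have h2 := red_dvd (p ^ 2) ((((f 0 x).d : ℕ) : ℤ) + 1)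
    rw [h1] at h2
    push_cast at h2
    refine dv (dvd_neg.2 h2) ?_
    ring

/-- canonical layer data -/
def LD.canon (p : ℕ) [NeZero p] (x y : ℤ) : LD p where
  c := red (p ^ 2) x
  A := red (p ^ 2) (upart p x)
  d := red (p ^ 2) y
  B := red (p ^ 2) (upart p y)
  δ := red 5 (del p x y + 2)
  vs := red (p ^ 3) (cnt p x (y - 1))
  vn := red (p ^ 3) (cnt p x y)
  hw := red (p ^ 3) (cnt p y (x - 1))
  he := red (p ^ 3) (cnt p y x)

theorem LD.canon_dz (p : ℕ) [NeZero p] (x y : ℤ) : (LD.canon p x y).dz = del p x y := by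
  have := E_range p (lev p x) y
  simp only [LD.canon, LD.dz, red]
  unfold del
  rw [Int.emod_eq_of_lt] <;> omega

theorem LD.canon_OK {p : ℕ} [NeZero p] (hp : 2 ≤ p) {x y : ℤ} (hx : 1 ≤ x) (hy : 1 ≤ y) :
    (LD.canon p x y).OK := by
  have r2 : ∀ z, (p : ℤ) ^ 2 ∣ z - ((red (p ^ 2) z : ℕ) : ℤ) := fun z => by
    have := red_dvd (p ^ 2) z; push_cast at this; exact this
  have r3 : ∀ z, (p : ℤ) ^ 3 ∣ z - ((red (p ^ 3) z : ℕ) : ℤ) := fun z => by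
    have := red_dvd (p ^ 3) z; push_cast at this; exact this
  have h := PLayer.canon (p := p) (by exact_mod_cast hp) hx hy
  unfold LD.OK
  rw [LD.canon_dz]
  exact h.congr (r2 _) (r2 _) (r2 _) (r2 _) (r3 _) (r3 _) (r3 _) (r3 _)

theorem red_red {n : ℕ} [NeZero n] (z : ℤ) : red n (((red n z : ℕ) : ℤ) + 1) = red n (z + 1) := by
  apply red_eq
  have := red_dvd n z
  refine dv (dvd_neg.2 this) ?_; ring

theorem LD.canon_h (x y : ℤ) : (LD.canon p x y).east = (LD.canon p (x + 1) y).west := by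
  simp [LD.canon, LD.east, LD.west, red_red]

theorem LD.canon_v (x y : ℤ) : (LD.canon p x y).north = (LD.canon p x (y + 1)).south := by
  simp [LD.canon, LD.north, LD.south, red_red]

end PLayer

namespace Quad
open PLayer

/-- tables: symbols, horizontal pairs, vertical pairs, first column, first row -/
abbrev TB : Type := List ℕ × List (ℕ × ℕ) × List (ℕ × ℕ) × List ℕ × List ℕ

/-- the seeded quadrant problem -/
def QuadP (t : TB) : Prop := ∀ N : ℕ, ∃ g : ℕ → ℕ → ℕ, ∀ j ≤ N, ∀ k ≤ N,
  g j k ∈ t.1 ∧ (j + 1 ≤ N → (g j k, g (j + 1) k) ∈ t.2.1) ∧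
    (k + 1 ≤ N → (g j k, g j (k + 1)) ∈ t.2.2.1) ∧
  (j = 0 → g j k ∈ t.2.2.2.1) ∧ (k = 0 → g j k ∈ t.2.2.2.2)

abbrev DD : Type := LD 2 × LD 3

/-- the rule connecting layers and symbols `(g, f, q)` -/
def Rule (d : DD) (t : TB) (s : ℕ × ℕ × ℕ) : Prop :=
  (d.1.dz = 0 → s.2.2 = s.1) ∧ (d.1.dz = -1 → (s.1, s.2.2) ∈ t.2.2.1) ∧
  (d.2.dz = 0 → s.2.2 = s.2.1) ∧ (d.2.dz = 1 → (s.2.1, s.2.2) ∈ t.2.1) ∧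
  (¬ (3 : ℤ) ∣ ((d.2.c : ℕ) : ℤ) → s.2.2 ∈ t.2.2.2.1) ∧
  (¬ (2 : ℤ) ∣ ((d.1.d : ℕ) : ℤ) → s.2.2 ∈ t.2.2.2.2)

/-- Wang tile of a cell -/
def mkTile (d : DD) (s : ℕ × ℕ × ℕ) : WangTile :=
  (Nat.pair (Nat.pair d.1.south d.2.south) s.1, Nat.pair (Nat.pair d.1.east d.2.east) s.2.1,
   Nat.pair (Nat.pair d.1.north d.2.north) s.1, Nat.pair (Nat.pair d.1.west d.2.west) s.2.1)

instance : Fintype DD := Fintype.ofFinite _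

open Classical in
def good : List DD := (Finset.univ.filter (fun d : DD => d.1.OK ∧ d.2.OK)).toList

theorem mem_good {d : DD} : d ∈ good ↔ d.1.OK ∧ d.2.OK := by simp [good]

open Classical in
def WQ (t : TB) : List WangTile :=
  good.flatMap fun d => ((t.1 ×ˢ (t.1 ×ˢ t.1)).filter (fun s => decide (Rule d t s))).map (mkTile d)

theorem mem_WQ {t : TB} {w : WangTile} : w ∈ WQ t ↔ ∃ d : DD, d.1.OK ∧ d.2.OK ∧
    ∃ s : ℕ × ℕ × ℕ, s.1 ∈ t.1 ∧ s.2.1 ∈ t.1 ∧ s.2.2 ∈ t.1 ∧ Rule d t s ∧ w = mkTile d s := by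
  simp only [WQ, List.mem_flatMap, mem_good, List.mem_map, List.mem_filter, decide_eq_true_eq]
  constructor
  · rintro ⟨d, ⟨h1, h2⟩, s, ⟨h3, h4⟩, rfl⟩
    obtain ⟨a, b, c⟩ := s
    have h3 : a ∈ t.1 ∧ b ∈ t.1 ∧ c ∈ t.1 := by simpa using h3
    exact ⟨d, h1, h2, (a, b, c), h3.1, h3.2.1, h3.2.2, h4, rfl⟩
  · rintro ⟨d, h1, h2, ⟨a, b, c⟩, h3, h4, h5, h6, rfl⟩
    exact ⟨d, ⟨h1, h2⟩, (a, b, c), ⟨by simpa using ⟨h3, h4, h5⟩, h6⟩, rfl⟩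

theorem WQ_primrec : Primrec WQ := by
  refine PR.flatMap_fixed _ fun d _ => ?_
  have hS : Primrec (fun t : TB => t.1) := Primrec.fst
  refine Primrec.list_map (PR.filter (PR.product hS (PR.product hS hS)) ?_) ?_
  · have a1 : Primrec (fun x : TB × ℕ × ℕ × ℕ => x.2.1) := Primrec.fst.comp Primrec.snd
    have a2 : Primrec (fun x : TB × ℕ × ℕ × ℕ => x.2.2.1) :=
      Primrec.fst.comp (Primrec.snd.comp Primrec.snd)
    have a3 : Primrec (fun x : TB × ℕ × ℕ × ℕ => x.2.2.2) :=
      Primrec.snd.comp (Primrec.snd.comp Primrec.snd)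
    have t2 : Primrec (fun x : TB × ℕ × ℕ × ℕ => x.1.2.1) :=
      Primrec.fst.comp (Primrec.snd.comp Primrec.fst)
    have t3 : Primrec (fun x : TB × ℕ × ℕ × ℕ => x.1.2.2.1) :=
      Primrec.fst.comp (Primrec.snd.comp (Primrec.snd.comp Primrec.fst))
    have t4 : Primrec (fun x : TB × ℕ × ℕ × ℕ => x.1.2.2.2.1) :=
      Primrec.fst.comp (Primrec.snd.comp (Primrec.snd.comp (Primrec.snd.comp Primrec.fst)))
    have t5 : Primrec (fun x : TB × ℕ × ℕ × ℕ => x.1.2.2.2.2) :=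
      Primrec.snd.comp (Primrec.snd.comp (Primrec.snd.comp (Primrec.snd.comp Primrec.fst)))
    have key : PrimrecPred (fun x : TB × ℕ × ℕ × ℕ => Rule d x.1 x.2) := by
      unfold Rule
      refine (PR.imp (PR.constP _) (Primrec.eq.comp a3 a1)).and ?_
      refine (PR.imp (PR.constP _) (PR.mem t3 (Primrec.pair a1 a3))).and ?_
      refine (PR.imp (PR.constP _) (Primrec.eq.comp a3 a2)).and ?_
      refine (PR.imp (PR.constP _) (PR.mem t2 (Primrec.pair a2 a3))).and ?_
      refine (PR.imp (PR.constP _) (PR.mem t4 a3)).and ?_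
      exact (PR.imp (PR.constP _) (PR.mem t5 a3))
    exact key
  · have a1 : Primrec (fun x : TB × ℕ × ℕ × ℕ => x.2.1) := Primrec.fst.comp Primrec.snd
    have a2 : Primrec (fun x : TB × ℕ × ℕ × ℕ => x.2.2.1) :=
      Primrec.fst.comp (Primrec.snd.comp Primrec.snd)
    have np : ∀ c : ℕ, ∀ {f : TB × ℕ × ℕ × ℕ → ℕ}, Primrec f →
      Primrec (fun x => Nat.pair c (f x)) := fun c f hf =>
        Primrec₂.natPair.comp (Primrec.const c) hf
    exact Primrec.pair (np _ a1) (Primrec.pair (np _ a2) (Primrec.pair (np _ a1) (np _ a2)))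

theorem exists_crt (α₂ α₃ : ℤ) (j k : ℕ) : ∃ x : ℤ,
    (∃ a, x - α₂ = 2 ^ k * a ∧ ¬ (2 : ℤ) ∣ a) ∧ (∃ a, x - α₃ = 3 ^ j * a ∧ ¬ (3 : ℤ) ∣ a) := by
  have cop : IsCoprime ((2 : ℤ) ^ (k + 1)) (3 ^ (j + 1)) :=
    IsCoprime.pow (by rw [Int.isCoprime_iff_gcd_eq_one]; rfl)
  obtain ⟨u, v, huv⟩ := cop
  refine ⟨(α₂ + 2 ^ k) * (v * 3 ^ (j + 1)) + (α₃ + 3 ^ j) * (u * 2 ^ (k + 1)), ⟨1 + 2 * (u *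
    ((α₃ + 3 ^ j) - (α₂ + 2 ^ k))), ?_, by omega⟩, ⟨1 + 3 * (v *
    ((α₂ + 2 ^ k) - (α₃ + 3 ^ j))), ?_, by omega⟩⟩
  · have : v * 3 ^ (j + 1) = 1 - u * 2 ^ (k + 1) := by linarith
    rw [this]; ring
  · have : u * 2 ^ (k + 1) = 1 - v * 3 ^ (j + 1) := by linarith
    rw [this]; ring

theorem mkTile_h {d d' : DD} {s s' : ℕ × ℕ × ℕ} (h : (mkTile d s).2.1 = (mkTile d' s').2.2.2) :
    d.1.east = d'.1.west ∧ d.2.east = d'.2.west ∧ s.2.1 = s'.2.1 := by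
  simpa [mkTile, Nat.pair_eq_pair, and_assoc] using h

theorem mkTile_v {d d' : DD} {s s' : ℕ × ℕ × ℕ} (h : (mkTile d s).2.2.1 = (mkTile d' s').1) :
    d.1.north = d'.1.south ∧ d.2.north = d'.2.south ∧ s.1 = s'.1 := by
  simpa [mkTile, Nat.pair_eq_pair, and_assoc] using h

theorem const_int {β : Type} (g : ℤ → β) (h : ∀ y, g y = g (y + 1)) : ∀ y, g y = g 0 := by
  intro y
  induction y using Int.induction_on with
  | zero => rfl
  | succ i ih => rw [← h, ih]
  | pred i ih => rw [h, sub_add_cancel, ih]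

theorem WQ_sound {t : TB} (h : WangDomino (WQ t)) : QuadP t := by
  obtain ⟨w, hw, hh, hv⟩ := h
  have hw' : ∀ x y : ℤ, _ := fun x y => mem_WQ.1 (hw (x, y))
  choose d ok2 ok3 s hs1 hs2 hs3 hR hwt using hw'
  have hh' : ∀ x y, (d x y).1.east = (d (x+1) y).1.west ∧ (d x y).2.east = (d (x+1) y).2.west ∧
      (s x y).2.1 = (s (x+1) y).2.1 := fun x y => mkTile_h (by rw [← hwt x y, ← hwt (x + 1) y]; exact hh x y)
  have hv' : ∀ x y, (d x y).1.north = (d x (y+1)).1.south ∧ (d x y).2.north = (d x (y+1)).2.south ∧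
      (s x y).1 = (s x (y+1)).1 := fun x y => mkTile_v (by rw [← hwt x y, ← hwt x (y + 1)]; exact hv x y)
  obtain ⟨L2, c2, d2⟩ := LD.layer (fun x y => (d x y).1) ok2 (fun x y => (hh' x y).1)
    (fun x y => (hv' x y).1)
  obtain ⟨L3, c3, d3⟩ := LD.layer (fun x y => (d x y).2) ok3 (fun x y => (hh' x y).2.1)
    (fun x y => (hv' x y).2.1)
  have hG : ∀ x y, (s x y).1 = (s x 0).1 := fun x => const_int (fun y => (s x y).1)
    (fun y => (hv' x y).2.2)
  have hF : ∀ x y, (s x y).2.1 = (s 0 y).2.1 := fun x y => const_int (fun x => (s x y).2.1)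
    (fun x => (hh' x y).2.2) x
  intro N
  obtain ⟨α2, β2, pc2, pd2, IA2, IB2⟩ := L2.sound (by norm_num) (N + 1)
  obtain ⟨α3, β3, pc3, pd3, IA3, IB3⟩ := L3.sound (by norm_num) (N + 1)
  choose X hX2 hX3 using fun j k => exists_crt α2 α3 j k
  choose Y hY2 hY3 using fun j k => exists_crt β2 β3 j k
  have D2 : ∀ j k j' k', k ≤ N → (d (X j k) (Y j' k')).1.dz = max (-2) (min 2 ((k : ℤ) - k')) := by
    intro j k j' k' hk
    obtain ⟨a, ha, ha'⟩ := hX2 j k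
    obtain ⟨b, hb, hb'⟩ := hY2 j' k'
    have := (IA2 k (by omega) _ a ha ha').2 (Y j' k')
    rw [hb] at this
    have e := E_level (p := 2) (by norm_num) (i := k') (j := k) hb'
    rw [← e]; exact this
  have D3 : ∀ j k j' k', j ≤ N + 1 → (d (X j k) (Y j' k')).2.dz = max (-2) (min 2 ((j : ℤ) - j')) := by
    intro j k j' k' hk
    obtain ⟨a, ha, ha'⟩ := hX3 j k
    obtain ⟨b, hb, hb'⟩ := hY3 j' k'
    have := (IA3 j (by omega) _ a ha ha').2 (Y j' k')
    rw [hb] at this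
    have e := E_level (p := 3) (by norm_num) (i := j') (j := j) hb'
    rw [← e]; exact this
  have eGF : ∀ j k, j ≤ N → k ≤ N → (s (X j k) 0).1 = (s 0 (Y j k)).2.1 := by
    intro j k hj hk
    obtain ⟨r1, r2, r3, r4, r5, r6⟩ := hR (X j k) (Y j k)
    rw [← hG _ (Y j k), ← hF (X j k), ← r1, ← r3]
    · rw [D3 _ _ _ _ (by omega)]; simp
    · rw [D2 _ _ _ _ (by omega)]; simp
  refine ⟨fun j k => (s (X j k) 0).1, fun j hj k hk => ⟨?_, ?_, ?_, ?_, ?_⟩⟩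
  · exact hs1 _ _
  · intro hj1
    obtain ⟨r1, r2, r3, r4, r5, r6⟩ := hR (X (j + 1) k) (Y j k)
    have := r4 (by rw [D3 _ _ _ _ (by omega)]; push_cast; omega)
    rw [r1 (by rw [D2 _ _ _ _ hk]; simp), hG, hF, ← eGF j k hj hk] at this
    exact this
  · intro hk1
    obtain ⟨r1, r2, r3, r4, r5, r6⟩ := hR (X j k) (Y j (k + 1))
    have := r2 (by rw [D2 _ _ _ _ hk]; push_cast; omega)
    rw [r3 (by rw [D3 _ _ _ _ (by omega)]; simp), hG, hF, ← eGF j (k + 1) hj hk1] at this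
    exact this
  · rintro rfl
    obtain ⟨r1, r2, r3, r4, r5, r6⟩ := hR (X 0 k) (Y 0 k)
    have := r5 (by
      rw [c3]
      obtain ⟨a, ha, ha'⟩ := hX3 0 k
      have := pc3 (X 0 k)
      simp only [pow_zero, one_mul] at ha
      rw [ha] at this
      intro h
      exact ha' ((dvd_iff_of_sub this (by norm_num)).1 h))
    rw [r1 (by rw [D2 _ _ _ _ hk]; simp), hG] at this
    exact this
  · rintro rfl
    obtain ⟨r1, r2, r3, r4, r5, r6⟩ := hR (X j 0) (Y j 0)
    have := r6 (by
      rw [d2]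
      obtain ⟨a, ha, ha'⟩ := hY2 j 0
      have := pd2 (Y j 0)
      simp only [pow_zero, one_mul] at ha
      rw [ha] at this
      intro h
      exact ha' ((dvd_iff_of_sub this (by norm_num)).1 h))
    rw [r1 (by rw [D2 _ _ _ _ hk]; simp), hG] at this
    exact this

theorem WQ_complete {t : TB} (h : QuadP t) : WangDomino (WQ t) := by
  apply wang_compact
  intro q
  obtain ⟨g, hg⟩ := h (q + 1)
  let d : ℤ → ℤ → DD := fun x y => (LD.canon 2 (x + 1) (y + 1), LD.canon 3 (x + 1) (y + 1))
  let l2 : ℤ → ℕ := fun x => lev 2 (x + 1)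
  let l3 : ℤ → ℕ := fun x => lev 3 (x + 1)
  have hl2 : ∀ x : ℤ, 0 ≤ x → x < q → l2 x ≤ q := fun x hx hx' => by
    have := lev_le (p := 2) (by norm_num) (show 1 ≤ x + 1 by omega)
    simp only [l2]; omega
  have hl3 : ∀ x : ℤ, 0 ≤ x → x < q → l3 x ≤ q := fun x hx hx' => by
    have := lev_le (p := 3) (by norm_num) (show 1 ≤ x + 1 by omega)
    simp only [l3]; omega
  let s : ℤ → ℤ → ℕ × ℕ × ℕ := fun x y => (g (l3 x) (l2 x), g (l3 y) (l2 y), g (l3 x) (l2 y))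
  refine ⟨fun z => mkTile (d z.1 z.2) (s z.1 z.2), ?_, ?_, ?_⟩
  · intro i j hi hi' hj hj'
    rw [mem_WQ]
    have i2 := hl2 i hi hi'
    have i3 := hl3 i hi hi'
    have j2 := hl2 j hj hj'
    have j3 := hl3 j hj hj'
    refine ⟨d i j, LD.canon_OK (by norm_num) (by omega) (by omega),
      LD.canon_OK (by norm_num) (by omega) (by omega), s i j, (hg _ (by omega) _ (by omega)).1,
      (hg _ (by omega) _ (by omega)).1, (hg _ (by omega) _ (by omega)).1, ?_, rfl⟩
    have e2 : (d i j).1.dz = max (-2) (min 2 ((l2 i : ℤ) - l2 j)) := by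
      simp only [d]; rw [LD.canon_dz]; exact del_eq (by norm_num) (by omega)
    have e3 : (d i j).2.dz = max (-2) (min 2 ((l3 i : ℤ) - l3 j)) := by
      simp only [d]; rw [LD.canon_dz]; exact del_eq (by norm_num) (by omega)
    refine ⟨?_, ?_, ?_, ?_, ?_, ?_⟩
    · intro h; rw [e2] at h
      have : l2 i = l2 j := by omega
      simp only [s, this]
    · intro h; rw [e2] at h
      have : l2 j = l2 i + 1 := by omega
      simp only [s, this]
      exact (hg _ (by omega) _ (by omega)).2.2.1 (by omega)
    · intro h; rw [e3] at h
      have : l3 i = l3 j := by omega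
      simp only [s, this]
    · intro h; rw [e3] at h
      have : l3 i = l3 j + 1 := by omega
      simp only [s, this]
      exact (hg _ (by omega) _ (by omega)).2.1 (by omega)
    · intro h
      refine (hg _ (by omega) _ (by omega)).2.2.2.1 ?_
      refine lev_zero (by norm_num) (by omega) ?_
      have := red_dvd (3 ^ 2) (i + 1)
      rwa [dvd_iff_of_sub this (by norm_num)]
    · intro h
      refine (hg _ (by omega) _ (by omega)).2.2.2.2 ?_
      refine lev_zero (by norm_num) (by omega) ?_
      have := red_dvd (2 ^ 2) (j + 1)
      rwa [dvd_iff_of_sub this (by norm_num)]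
  · intro i j _ _ _ _
    have h1 := LD.canon_h (p := 2) (i + 1) (j + 1)
    have h2 := LD.canon_h (p := 3) (i + 1) (j + 1)
    simp only [mkTile, d, h1, h2, s]
  · intro i j _ _ _ _
    have h1 := LD.canon_v (p := 2) (i + 1) (j + 1)
    have h2 := LD.canon_v (p := 3) (i + 1) (j + 1)
    simp only [mkTile, d, h1, h2, s]

theorem WQ_iff (t : TB) : QuadP t ↔ WangDomino (WQ t) := ⟨WQ_complete, WQ_sound⟩

end Quad
end

open Set Metric
section
namespace AMach
open Quad

variable {Q A : Type} (nxt : Q → A → Option Q) (upd : Q → Bool → A → A → A → A)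

/-- one step of an array machine -/
def astep (c : Q × (ℕ → A)) : Option (Q × (ℕ → A)) :=
  (nxt c.1 (c.2 0)).map fun q' =>
    (q', fun j => upd c.1 (decide (j = 0)) (c.2 (j - 1)) (c.2 j) (c.2 (j + 1)))

structure Cell (Q A : Type) where
  f : Bool
  q : Q
  top : A
  p : A
  x : A
  n : A

instance [Finite Q] [Finite A] : Finite (Cell Q A) :=
  Finite.of_injective (fun c : Cell Q A => (c.f, c.q, c.top, c.p, c.x, c.n)) (by
    rintro ⟨⟩ ⟨⟩ h; simp at h; simp [h])

def HC (c d : Cell Q A) : Prop := d.f = false ∧ c.q = d.q ∧ c.top = d.top ∧ c.x = d.p ∧ c.n = d.x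
def VC (c d : Cell Q A) : Prop := nxt c.q c.top = some d.q ∧ d.x = upd c.q c.f c.p c.x c.n
def CC (c : Cell Q A) : Prop := c.f = true ∧ c.x = c.top ∧ c.p = c.x

variable [Finite Q] [Finite A]

def cells : List (Cell Q A) := by
  haveI := Fintype.ofFinite (Cell Q A)
  exact (Finset.univ : Finset (Cell Q A)).toList

theorem mem_cells (c : Cell Q A) : c ∈ (cells : List (Cell Q A)) := by simp [cells]

def code (c : Cell Q A) : ℕ := (Finite.equivFin (Cell Q A) c : ℕ)

theorem code_inj {c d : Cell Q A} : code c = code d ↔ c = d := by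
  simp [code, Fin.val_inj]

variable {D : Type} (inp : Option D → A) (q0 : Q)

open Classical in
def tables (L : List D) : TB :=
  ((cells : List (Cell Q A)).flatMap fun c => (List.range (L.length + 1)).map fun i => Nat.pair (code c) i,
   ((cells : List (Cell Q A)) ×ˢ (cells : List (Cell Q A))).flatMap fun cd =>
      if HC cd.1 cd.2 then (List.range (L.length + 1)).map fun i =>
        (Nat.pair (code cd.1) i, Nat.pair (code cd.2) (min (i + 1) L.length)) else [],
   ((cells : List (Cell Q A)) ×ˢ (cells : List (Cell Q A))).flatMap fun cd =>
      if VC nxt upd cd.1 cd.2 then (List.range (L.length + 1)).map fun i =>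
        (Nat.pair (code cd.1) i, Nat.pair (code cd.2) i) else [],
   (cells : List (Cell Q A)).flatMap fun c => if CC c then [Nat.pair (code c) 0] else [],
   (cells : List (Cell Q A)).flatMap fun c => if c.q = q0 then
      ((List.range (L.length + 1)).filter (fun i => decide (inp L[i]? = c.x))).map
        fun i => Nat.pair (code c) i else [])

theorem mem_S {L : List D} {n : ℕ} : n ∈ (tables nxt upd inp q0 L).1 ↔
    ∃ c : Cell Q A, ∃ i ≤ L.length, n = Nat.pair (code c) i := by
  simp only [tables, List.mem_flatMap, List.mem_map, List.mem_range, mem_cells, true_and]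
  constructor
  · rintro ⟨c, i, h, rfl⟩; exact ⟨c, i, by omega, rfl⟩
  · rintro ⟨c, i, h, rfl⟩; exact ⟨c, i, by omega, rfl⟩

theorem mem_H {L : List D} {c d : Cell Q A} {i j : ℕ} :
    (Nat.pair (code c) i, Nat.pair (code d) j) ∈ (tables nxt upd inp q0 L).2.1 ↔
    HC c d ∧ i ≤ L.length ∧ j = min (i + 1) L.length := by
  simp only [tables, List.mem_flatMap, Prod.exists]
  constructor
  · rintro ⟨c', d', -, h⟩
    split_ifs at h with h'
    · simp only [List.mem_map, List.mem_range, Prod.mk.injEq, Nat.pair_eq_pair, code_inj] at h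
      obtain ⟨i', h1, ⟨rfl, rfl⟩, rfl, rfl⟩ := h
      exact ⟨h', by omega, rfl⟩
    · simp at h
  · rintro ⟨h1, h2, rfl⟩
    refine ⟨c, d, by simp [mem_cells], ?_⟩
    rw [if_pos h1]
    simp only [List.mem_map, List.mem_range]
    exact ⟨i, by omega, rfl⟩

theorem mem_V {L : List D} {c d : Cell Q A} {i j : ℕ} :
    (Nat.pair (code c) i, Nat.pair (code d) j) ∈ (tables nxt upd inp q0 L).2.2.1 ↔
    VC nxt upd c d ∧ i ≤ L.length ∧ j = i := by
  simp only [tables, List.mem_flatMap, Prod.exists]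
  constructor
  · rintro ⟨c', d', -, h⟩
    split_ifs at h with h'
    · simp only [List.mem_map, List.mem_range, Prod.mk.injEq, Nat.pair_eq_pair, code_inj] at h
      obtain ⟨i', h1, ⟨rfl, rfl⟩, rfl, rfl⟩ := h
      exact ⟨h', by omega, rfl⟩
    · simp at h
  · rintro ⟨h1, h2, rfl⟩
    refine ⟨c, d, by simp [mem_cells], ?_⟩
    rw [if_pos h1]
    simp only [List.mem_map, List.mem_range]
    exact ⟨_, by omega, rfl⟩

theorem mem_C {L : List D} {c : Cell Q A} {i : ℕ} :
    Nat.pair (code c) i ∈ (tables nxt upd inp q0 L).2.2.2.1 ↔ CC c ∧ i = 0 := by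
  simp only [tables, List.mem_flatMap]
  constructor
  · rintro ⟨c', -, h⟩
    split_ifs at h with h'
    · simp only [List.mem_singleton, Nat.pair_eq_pair, code_inj] at h
      obtain ⟨rfl, rfl⟩ := h
      exact ⟨h', rfl⟩
    · simp at h
  · rintro ⟨h1, rfl⟩
    exact ⟨c, mem_cells _, by rw [if_pos h1]; simp⟩

theorem mem_R {L : List D} {c : Cell Q A} {i : ℕ} :
    Nat.pair (code c) i ∈ (tables nxt upd inp q0 L).2.2.2.2 ↔
      c.q = q0 ∧ i ≤ L.length ∧ inp L[i]? = c.x := by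
  simp only [tables, List.mem_flatMap]
  constructor
  · rintro ⟨c', -, h⟩
    split_ifs at h with h'
    · simp only [List.mem_map, List.mem_filter, List.mem_range, decide_eq_true_eq, Nat.pair_eq_pair,
        code_inj] at h
      obtain ⟨i', ⟨h1, h2⟩, rfl, rfl⟩ := h
      exact ⟨h', by omega, h2⟩
    · simp at h
  · rintro ⟨h1, h2, h3⟩
    refine ⟨c, mem_cells _, ?_⟩
    rw [if_pos h1]
    simp only [List.mem_map, List.mem_filter, List.mem_range, decide_eq_true_eq]
    exact ⟨i, ⟨by omega, h3⟩, rfl⟩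

/-- the run never halts -/
def NonHalt (L : List D) : Prop := ∃ s : ℕ → Q × (ℕ → A), s 0 = (q0, fun j => inp L[j]?) ∧
  ∀ t, astep nxt upd (s t) = some (s (t + 1))

theorem quad_of_nonhalt {L : List D} (h : NonHalt nxt upd inp q0 L) :
    QuadP (tables nxt upd inp q0 L) := by
  obtain ⟨s, s0, hs⟩ := h
  intro N
  let cl : ℕ → ℕ → Cell Q A := fun j t => ⟨decide (j = 0), (s t).1, (s t).2 0, (s t).2 (j - 1),
    (s t).2 j, (s t).2 (j + 1)⟩
  refine ⟨fun j t => Nat.pair (code (cl j t)) (min j L.length), fun j hj t ht => ⟨?_, ?_, ?_, ?_, ?_⟩⟩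
  · rw [mem_S]; exact ⟨_, _, by omega, rfl⟩
  · intro _
    rw [mem_H]
    refine ⟨⟨by simp [cl], rfl, rfl, by simp [cl], rfl⟩, by omega, by omega⟩
  · intro _
    rw [mem_V]
    have := hs t
    unfold astep at this
    rw [Option.map_eq_some_iff] at this
    obtain ⟨q', h1, h2⟩ := this
    refine ⟨⟨?_, ?_⟩, by omega, rfl⟩
    · simp only [cl]; rw [h1, ← h2]
    · simp only [cl]; rw [← h2]
  · rintro rfl
    rw [mem_C]
    exact ⟨⟨by simp [cl], rfl, by simp [cl]⟩, by simp⟩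
  · rintro rfl
    rw [mem_R]
    refine ⟨by simp [cl, s0], by omega, ?_⟩
    simp only [cl, s0]
    rcases le_total j L.length with h | h
    · rw [min_eq_left h]
    · rw [min_eq_right h, List.getElem?_eq_none le_rfl, List.getElem?_eq_none h]

theorem nonhalt_of_quad {L : List D} (h : QuadP (tables nxt upd inp q0 L)) :
    NonHalt nxt upd inp q0 L := by
  have key : ∀ t, ∃ s : ℕ → Q × (ℕ → A), s 0 = (q0, fun j => inp L[j]?) ∧
      ∀ t' < t, astep nxt upd (s t') = some (s (t' + 1)) := by
    intro t
    obtain ⟨g, hg⟩ := h (2 * t + 1)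
    have h1 : ∀ j t', ∃ c : Cell Q A, ∃ i, j ≤ 2 * t + 1 → t' ≤ 2 * t + 1 → i ≤ L.length ∧
        g j t' = Nat.pair (code c) i := by
      intro j t'
      by_cases hj : j ≤ 2 * t + 1 ∧ t' ≤ 2 * t + 1
      · obtain ⟨c, i, h1, h2⟩ := (mem_S nxt upd inp q0).1 (hg j hj.1 t' hj.2).1
        exact ⟨c, i, fun _ _ => ⟨h1, h2⟩⟩
      · obtain ⟨c, i, h1, h2⟩ := (mem_S nxt upd inp q0).1 (hg 0 (by omega) 0 (by omega)).1
        exact ⟨c, i, fun h h' => absurd ⟨h, h'⟩ hj⟩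
    choose cl ix hc using h1
    have hH : ∀ j t', j + 1 ≤ 2 * t + 1 → t' ≤ 2 * t + 1 → HC (cl j t') (cl (j + 1) t') ∧
        ix (j + 1) t' = min (ix j t' + 1) L.length := by
      intro j t' hj ht
      have := (hg j (by omega) t' ht).2.1 hj
      rw [(hc j t' (by omega) ht).2, (hc (j + 1) t' hj ht).2, mem_H] at this
      exact ⟨this.1, this.2.2⟩
    have hV : ∀ j t', j ≤ 2 * t + 1 → t' + 1 ≤ 2 * t + 1 → VC nxt upd (cl j t') (cl j (t' + 1)) := by
      intro j t' hj ht
      have := (hg j (by omega) t' (by omega)).2.2.1 ht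
      rw [(hc j t' (by omega) (by omega)).2, (hc j (t' + 1) hj ht).2, mem_V] at this
      exact this.1
    have hC : ∀ t', t' ≤ 2 * t + 1 → CC (cl 0 t') ∧ ix 0 t' = 0 := by
      intro t' ht
      have := (hg 0 (by omega) t' (by omega)).2.2.2.1 rfl
      rw [(hc 0 t' (by omega) (by omega)).2, mem_C] at this
      exact this
    have hR : ∀ j, j ≤ 2 * t + 1 → (cl j 0).q = q0 ∧ inp L[ix j 0]? = (cl j 0).x := by
      intro j hj
      have := (hg j (by omega) 0 (by omega)).2.2.2.2 rfl
      rw [(hc j 0 (by omega) (by omega)).2, mem_R] at this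
      exact ⟨this.1, this.2.2⟩
    have hix : ∀ j, j ≤ 2 * t + 1 → ix j 0 = min j L.length := by
      intro j
      induction j with
      | zero => intro _; rw [(hC 0 (by omega)).2]; simp
      | succ j ih => intro hj; rw [(hH j 0 hj (by omega)).2, ih (by omega)]; omega
    have hrow : ∀ t', t' ≤ 2 * t + 1 → ∀ j, j ≤ 2 * t + 1 → (cl j t').q = (cl 0 t').q ∧
        (cl j t').top = (cl 0 t').x ∧ (cl j t').f = decide (j = 0) ∧ (cl j t').p = (cl (j - 1) t').x ∧
        (j + 1 ≤ 2 * t + 1 → (cl j t').n = (cl (j + 1) t').x) := by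
      intro t' ht j
      induction j with
      | zero =>
        intro _
        obtain ⟨⟨a, b, c⟩, -⟩ := hC t' ht
        exact ⟨rfl, b.symm, by simp [a], c, fun h => (hH 0 t' h ht).1.2.2.2.2⟩
      | succ j ih =>
        intro hj
        obtain ⟨a, b, c, d, e⟩ := ih (by omega)
        obtain ⟨⟨a', b', c', d', e'⟩, -⟩ := hH j t' hj ht
        exact ⟨b'.symm.trans a, c'.symm.trans b, by simp [a'], d'.symm, fun h => (hH (j + 1) t' h ht).1.2.2.2.2⟩
    -- actual run
    let stp : Q × (ℕ → A) → Q × (ℕ → A) := fun c => (astep nxt upd c).getD c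
    let s : ℕ → Q × (ℕ → A) := fun n => stp^[n] (q0, fun j => inp L[j]?)
    have hsucc : ∀ n, s (n + 1) = stp (s n) := fun n => Function.iterate_succ_apply' _ _ _
    have inv : ∀ t', t' ≤ t → (s t').1 = (cl 0 t').q ∧ (∀ j, j + t' ≤ 2 * t + 1 → (s t').2 j = (cl j t').x) ∧
        ∀ t'' < t', astep nxt upd (s t'') = some (s (t'' + 1)) := by
      intro t'
      induction t' with
      | zero =>
        intro _
        refine ⟨(hR 0 (by omega)).1.symm, ?_, by omega⟩
        intro j hj
        rw [← (hR j (by omega)).2, hix j (by omega)]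
        simp only [s, Function.iterate_zero, id]
        rcases le_total j L.length with h | h
        · rw [min_eq_left h]
        · rw [min_eq_right h, List.getElem?_eq_none le_rfl, List.getElem?_eq_none h]
      | succ t' ih =>
        intro ht
        obtain ⟨a, b, c⟩ := ih (by omega)
        have e1 : nxt (s t').1 ((s t').2 0) = some (cl 0 (t' + 1)).q := by
          have := (hV 0 t' (by omega) (by omega)).1
          rw [(hrow t' (by omega) 0 (by omega)).2.1] at this
          rw [a, b 0 (by omega)]; exact this
        have e2 : astep nxt upd (s t') = some (s (t' + 1)) := by
          rw [hsucc]; simp only [stp, astep, e1]; rfl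
        have e3 := e2
        simp only [astep, e1, Option.map_some, Option.some.injEq] at e3
        refine ⟨by rw [← e3], ?_, ?_⟩
        · intro j hj
          have := (hV j t' (by omega) (by omega)).2
          obtain ⟨r1, r2, r3, r4, r5⟩ := hrow t' (by omega) j (by omega)
          rw [this, r1, r3, r4, r5 (by omega), ← e3, ← a, ← b j (by omega), ← b (j - 1) (by omega),
            ← b (j + 1) (by omega)]
        · intro t'' h
          rcases Nat.lt_succ_iff_lt_or_eq.1 h with h | rfl
          · exact c _ h
          · exact e2
    exact ⟨s, rfl, (inv t le_rfl).2.2⟩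
  choose s s0 hs using key
  have agree : ∀ n t t', n ≤ t → n ≤ t' → s t n = s t' n := by
    intro n
    induction n with
    | zero => intro t t' _ _; rw [s0, s0]
    | succ n ih =>
      intro t t' h h'
      have h1 := hs t n (by omega)
      have h2 := hs t' n (by omega)
      rw [ih t t' (by omega) (by omega), h2] at h1
      exact (Option.some.inj h1).symm
  refine ⟨fun n => s n n, s0 0, fun t => ?_⟩
  show astep nxt upd (s t t) = some (s (t + 1) (t + 1))
  rw [agree t t (t + 1) le_rfl (by omega)]
  exact hs (t + 1) t (by omega)

open Classical in
theorem tables_primrec [Primcodable D] [Finite D] : Primrec (tables nxt upd inp q0) := by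
  have len : Primrec (fun L : List D => L.length) := Primrec.list_length
  have rg : Primrec (fun L : List D => List.range (L.length + 1)) :=
    Primrec.list_range.comp (Primrec.succ.comp len)
  have ifc : ∀ {σ : Type} [Primcodable σ] (P : Prop) [Decidable P] {f : List D → List σ}, Primrec f →
      Primrec (fun L => if P then f L else []) := by
    intro σ _ P _ f hf
    by_cases h : P
    · simp only [h, if_true]; exact hf
    · simp only [h, if_false]; exact Primrec.const _
  have np : ∀ c : ℕ, ∀ {f : List D × ℕ → ℕ}, Primrec f → Primrec (fun x => Nat.pair c (f x)) :=
    fun c f hf => Primrec₂.natPair.comp (Primrec.const c) hf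
  unfold tables
  refine Primrec.pair (PR.flatMap_fixed _ fun c _ => Primrec.list_map rg (np _ Primrec.snd))
    (Primrec.pair (PR.flatMap_fixed _ fun c _ => ifc _ (Primrec.list_map rg
      (Primrec.pair (np _ Primrec.snd) (np _ ?_)))) (Primrec.pair
      (PR.flatMap_fixed _ fun c _ => ifc _ (Primrec.list_map rg
      (Primrec.pair (np _ Primrec.snd) (np _ Primrec.snd)))) (Primrec.pair
      (PR.flatMap_fixed _ fun c _ => ifc _ (Primrec.const _))
      (PR.flatMap_fixed _ fun c _ => ifc _ (Primrec.list_map (PR.filter rg ?_) (np _ Primrec.snd))))))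
  · exact Primrec.nat_min.comp (Primrec.succ.comp Primrec.snd) (len.comp Primrec.fst)
  · have h1 : Primrec (fun x : List D × ℕ => x.1[x.2]?) := Primrec.list_getElem?.comp Primrec.fst Primrec.snd
    classical
    have h2 : PrimrecPred (fun o : Option D => inp o = c.x) := Primrec.primrecPred (Primrec.dom_finite _)
    exact h2.comp h1

end AMach
end

open Set Metric
section
namespace TMQ
open Turing PartrecToTM2 StateTransition Quad AMach

theorem nonterm {σ : Type} (f : σ → Option σ) (a : σ) :
    ¬ (StateTransition.eval f a).Dom ↔ ∃ s : ℕ → σ, s 0 = a ∧ ∀ t, f (s t) = some (s (t + 1)) := by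
  constructor
  · intro h
    have key : ∀ b, Reaches f a b → ∃ c, f b = some c := by
      intro b hb
      by_contra hc
      apply h
      have : f b = none := by
        cases e : f b with
        | none => rfl
        | some c => exact absurd ⟨c, e⟩ hc
      exact Part.dom_iff_mem.2 ⟨b, mem_eval.2 ⟨hb, this⟩⟩
    let g : σ → σ := fun b => (f b).getD b
    have hs : ∀ t, Reaches f a (g^[t] a) ∧ f (g^[t] a) = some (g^[t + 1] a) := by
      intro t
      have aux : ∀ b, Reaches f a b → f b = some (g b) := by
        intro b hb
        obtain ⟨c, hc⟩ := key b hb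
        simp [g, hc]
      induction t with
      | zero => exact ⟨Relation.ReflTransGen.refl, aux _ Relation.ReflTransGen.refl⟩
      | succ t ih =>
        have h1 : Reaches f a (g^[t + 1] a) := ih.1.tail ih.2
        refine ⟨h1, ?_⟩
        rw [aux _ h1, Function.iterate_succ_apply' g (t + 1)]
    exact ⟨fun t => g^[t] a, rfl, fun t => (hs t).2⟩
  · rintro ⟨s, rfl, hs⟩ h
    obtain ⟨b, hb⟩ := Part.dom_iff_mem.1 h
    have : ∀ t, b ∈ StateTransition.eval f (s t) := by
      intro t
      induction t with
      | zero => exact hb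
      | succ t ih => rw [← reaches_eval (Relation.ReflTransGen.single (hs t))]; exact ih
    have H : ∀ c, b ∈ StateTransition.eval f c → (∃ t, c = s t) → False := by
      intro c hc
      refine evalInduction (C := fun c => (∃ t, c = s t) → False) hc ?_
      rintro c' hc' ih ⟨t, rfl⟩
      exact ih _ (hs t) ⟨t + 1, rfl⟩
    exact H _ hb ⟨0, rfl⟩

abbrev St := TM2.Stmt (fun _ : K' => Γ') Λ' (Option Γ')
abbrev V := Option Γ'
abbrev A := K' → Option Γ'

instance : Finite K' := Finite.of_injective
  (fun k : K' => (match k with | .main => 0 | .rev => 1 | .aux => 2 | .stack => 3 : Fin 4))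
  (by intro a b; cases a <;> cases b <;> simp)

def ns : St → V → A → Option St × V
  | .push _ _ q, v, _ => (some q, v)
  | .peek k f q, v, a => (some q, f v (a k))
  | .pop k f q, v, a => (some q, f v (a k))
  | .load f q, v, _ => (some q, f v)
  | .branch f q₁ q₂, v, _ => (some (cond (f v) q₁ q₂), v)
  | .goto f, v, _ => (some (tr (f v)), v)
  | .halt, v, _ => (none, v)

def us : St → V → Bool → A → A → A → A
  | .push k f _, v, b, p, x, _ => Function.update x k (if b then some (f v) else p k)
  | .pop k _ _, _, _, _, x, n => Function.update x k (n k)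
  | _, _, _, _, x, _ => x

def content (S : K' → List Γ') (j : ℕ) : A := fun k => (S k)[j]?

variable (c : ToPartrec.Code)

abbrev supp : Finset (Option St) := TM2.stmts tr (codeSupp c Cont'.halt)

theorem tr_mem {l : Λ'} (h : l ∈ codeSupp c Cont'.halt) : some (tr l) ∈ supp c := by
  classical
  exact Finset.some_mem_insertNone.2 (Finset.mem_biUnion.2 ⟨l, h, TM2.stmts₁_self⟩)

theorem ns_mem {q : St} (h : some q ∈ supp c) (v : V) (a : A) : (ns q v a).1 ∈ supp c := by
  have sub : ∀ q', q' ∈ TM2.stmts₁ q → some q' ∈ supp c := fun q' h' => TM2.stmts_trans h' h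
  cases q with
  | push k f q => exact sub q (by simp [TM2.stmts₁, TM2.stmts₁_self])
  | peek k f q => exact sub q (by simp [TM2.stmts₁, TM2.stmts₁_self])
  | pop k f q => exact sub q (by simp [TM2.stmts₁, TM2.stmts₁_self])
  | load f q => exact sub q (by simp [TM2.stmts₁, TM2.stmts₁_self])
  | branch f q₁ q₂ =>
    refine sub _ ?_
    cases f v <;> simp [TM2.stmts₁, TM2.stmts₁_self]
  | goto f =>
    have := @TM2.stmts_supportsStmt _ _ _ _ ⟨trNormal c Cont'.halt⟩ _ _ _ (tr_supports c Cont'.halt) h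
    have h2 := this v
    exact tr_mem c h2
  | halt => simp [ns, supp, TM2.stmts]

abbrev QQ := {q : Option St // q ∈ supp c} × V

def nx (q : QQ c) (a : A) : Option (QQ c) :=
  match q with
  | (⟨none, _⟩, _) => none
  | (⟨some q, h⟩, v) => some (⟨(ns q v a).1, ns_mem c h v a⟩, (ns q v a).2)

def up (q : QQ c) (b : Bool) (p x n : A) : A :=
  match q with
  | (⟨none, _⟩, _) => x
  | (⟨some q, _⟩, v) => us q v b p x n

theorem content_push (S : K' → List Γ') (k : K') (g : Γ') (j : ℕ) :
    content (Function.update S k (g :: S k)) j =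
    Function.update (content S j) k (if decide (j = 0) = true then some g else content S (j - 1) k) := by
  funext k'
  by_cases h : k' = k
  · subst h
    cases j <;> simp [content]
  · simp [content, h]

theorem content_pop (S : K' → List Γ') (k : K') (j : ℕ) :
    content (Function.update S k (S k).tail) j =
    Function.update (content S j) k (content S (j + 1) k) := by
  funext k'
  by_cases h : k' = k
  · subst h
    simp [content]
  · simp [content, h]

/-- translation of configurations -/
def TR (a : Cfg') (b : QQ c × (ℕ → A)) : Prop :=
  b.1.1.1 = a.l.map tr ∧ b.1.2 = a.var ∧ b.2 = content a.stk

theorem aux_reach (q : St) (h : some q ∈ supp c) (v : V) (S : K' → List Γ') :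
    ∃ b, TR c (TM2.stepAux q v S) b ∧
      Reaches₁ (astep (nx c) (up c)) ((⟨some q, h⟩, v), content S) b := by
  have one : ∀ (q : St) (h : some q ∈ supp c) (v : V) (S : K' → List Γ') q' h' v' S',
      ns q v (content S 0) = (q', v') →
      (∀ j, us q v (decide (j = 0)) (content S (j - 1)) (content S j) (content S (j + 1)) = content S' j) →
      Reaches₁ (astep (nx c) (up c)) ((⟨some q, h⟩, v), content S) ((⟨q', h'⟩, v'), content S') := by
    intro q h v S q' h' v' S' e1 e2
    refine Relation.TransGen.single ?_
    simp only [astep, nx, up, Option.map_some, Option.mem_def, Option.some.injEq, Prod.mk.injEq]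
    refine ⟨⟨Subtype.ext ?_, ?_⟩, funext e2⟩
    · exact congrArg Prod.fst e1
    · exact congrArg Prod.snd e1
  have hm : ∀ (S : K' → List Γ') k, content S 0 k = (S k).head? := by
    intro S k; exact List.head?_eq_getElem?.symm
  have hn := ns_mem c h v (content S 0)
  induction q generalizing v S with
  | push k f q ih =>
    obtain ⟨b, hb, hr⟩ := ih hn v (Function.update S k (f v :: S k)) (ns_mem c hn _ _)
    refine ⟨b, hb, Relation.TransGen.trans (one _ h v S (some q) hn _ _ rfl ?_) hr⟩
    intro j; rw [content_push]; rfl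
  | peek k f q ih =>
    obtain ⟨b, hb, hr⟩ := ih hn (f v (S k).head?) S (ns_mem c hn _ _)
    refine ⟨b, hb, Relation.TransGen.trans (one _ h v S (some q) hn _ S (by simp [ns, hm]) ?_) hr⟩
    intro j; rfl
  | pop k f q ih =>
    obtain ⟨b, hb, hr⟩ := ih hn (f v (S k).head?) (Function.update S k (S k).tail) (ns_mem c hn _ _)
    refine ⟨b, hb, Relation.TransGen.trans (one _ h v S (some q) hn _ _ (by simp [ns, hm]) ?_) hr⟩
    intro j; rw [content_pop]; rfl
  | load f q ih =>
    obtain ⟨b, hb, hr⟩ := ih hn (f v) S (ns_mem c hn _ _)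
    exact ⟨b, hb, Relation.TransGen.trans (one _ h v S (some q) hn _ S rfl (fun j => rfl)) hr⟩
  | branch f q₁ q₂ ih1 ih2 =>
    cases e : f v with
    | true =>
      have hn' : some q₁ ∈ supp c := by simpa [ns, e] using hn
      obtain ⟨b, hb, hr⟩ := ih1 hn' v S (ns_mem c hn' _ _)
      refine ⟨b, by simpa [TM2.stepAux, e] using hb,
        Relation.TransGen.trans (one _ h v S (some q₁) hn' _ S (by simp [ns, e]) (fun j => rfl)) hr⟩
    | false =>
      have hn' : some q₂ ∈ supp c := by simpa [ns, e] using hn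
      obtain ⟨b, hb, hr⟩ := ih2 hn' v S (ns_mem c hn' _ _)
      refine ⟨b, by simpa [TM2.stepAux, e] using hb,
        Relation.TransGen.trans (one _ h v S (some q₂) hn' _ S (by simp [ns, e]) (fun j => rfl)) hr⟩
  | goto f =>
    exact ⟨_, ⟨rfl, rfl, rfl⟩, one _ h v S _ hn _ S rfl (fun j => rfl)⟩
  | halt =>
    exact ⟨_, ⟨rfl, rfl, rfl⟩, one _ h v S _ hn _ S rfl (fun j => rfl)⟩

theorem resp : Respects (TM2.step tr) (astep (nx c) (up c)) (TR c) := by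
  rintro ⟨l, v, S⟩ ⟨⟨⟨q, h⟩, v'⟩, r⟩ ⟨h1, h2, h3⟩
  simp only at h1 h2 h3
  subst h2 h3
  cases l with
  | none =>
    simp only [Option.map_none] at h1
    subst h1
    simp [TM2.step, astep, nx]
  | some l =>
    simp only [Option.map_some] at h1
    subst h1
    simp only [TM2.step]
    exact aux_reach c _ h _ _

def q0 : QQ c := (⟨some (tr (trNormal c Cont'.halt)), by
  exact tr_mem c (tr_supports c Cont'.halt).1⟩, none)

def toG : Fin 3 → Γ' := ![.bit0, .bit1, .cons]

def inp (o : Option (Fin 3)) : A := K'.rec (o.map toG) none none none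

theorem halt_iff (n : ℕ) (L : List (Fin 3)) (hL : L.map toG = trList [n]) :
    NonHalt (nx c) (up c) inp (q0 c) L ↔ ¬ (c.eval [n]).Dom := by
  have h1 := tr_eval_dom (resp c) (a₁ := init c [n]) (a₂ := (q0 c, content (K'.elim (trList [n]) [] [] [])))
    ⟨rfl, rfl, rfl⟩
  have h2 : (fun j => inp L[j]?) = content (K'.elim (trList [n]) [] [] []) := by
    rw [← hL]
    funext j k
    cases k <;> simp [inp, content, K'.elim]
  unfold NonHalt
  rw [h2, ← nonterm, h1, PartrecToTM2.tr_eval]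
  simp

def bits (n : ℕ) : List (Fin 3) :=
  if h : n = 0 then [] else (if n % 2 = 0 then 0 else 1) :: bits (n / 2)
termination_by n
decreasing_by omega

theorem bits_pos (p : PosNum) : (bits (p : ℕ)).map toG = trPosNum p := by
  have pos : ∀ p : PosNum, 0 < (p : ℕ) := PosNum.cast_pos
  induction p with
  | one => rw [bits]; simp [trPosNum, toG]; rw [bits]; simp
  | bit0 p ih =>
    have := pos p
    have e : ((PosNum.bit0 p : PosNum) : ℕ) = 2 * p := by simp [PosNum.cast_bit0]; try ring
    rw [bits, dif_neg (by omega), e, if_pos (by omega), List.map_cons, trPosNum]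
    rw [show 2 * (p : ℕ) / 2 = p by omega, ih]; rfl
  | bit1 p ih =>
    have := pos p
    have e : ((PosNum.bit1 p : PosNum) : ℕ) = 2 * p + 1 := by simp [PosNum.cast_bit1]; try ring
    rw [bits, dif_neg (by omega), e, if_neg (by omega), List.map_cons, trPosNum]
    rw [show (2 * (p : ℕ) + 1) / 2 = p by omega, ih]; rfl

theorem bits_spec (n : ℕ) : (bits n ++ [2]).map toG = trList [n] := by
  have : (bits n).map toG = trNat n := by
    unfold trNat
    have e : ((n : Num) : ℕ) = n := by simp
    cases h : (n : Num) with
    | zero => rw [h] at e; rw [← e]; simp [trNum]; rw [bits]; simp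
    | pos p => rw [h] at e; rw [← e, Num.cast_pos, bits_pos]; rfl
  rw [List.map_append, this]; rfl

theorem bits_primrec : Primrec bits := by
  have : Primrec₂ (fun (_ : Unit) n => bits n) := by
    refine Primrec.nat_strong_rec _ (g := fun _ l => some (if l.length = 0 then [] else
      (if l.length % 2 = 0 then 0 else 1) :: (l[l.length / 2]?).getD [])) ?_ ?_
    · have len : Primrec (fun x : Unit × List (List (Fin 3)) => x.2.length) :=
        Primrec.list_length.comp Primrec.snd
      refine Primrec.option_some.comp ?_
      refine Primrec.ite (Primrec.eq.comp len (Primrec.const 0)) (Primrec.const []) ?_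
      refine Primrec.list_cons.comp (Primrec.ite (Primrec.eq.comp (Primrec.nat_mod.comp len (Primrec.const 2))
        (Primrec.const 0)) (Primrec.const 0) (Primrec.const 1)) ?_
      refine Primrec.option_getD.comp (Primrec.list_getElem?.comp Primrec.snd
        (Primrec.nat_div.comp len (Primrec.const 2))) (Primrec.const [])
    · intro _ n
      rw [bits]
      simp only [List.length_map, List.length_range]
      split_ifs with h h2
      · rfl
      · have : n / 2 < n := by omega
        simp [this]
      · have : n / 2 < n := by omega
        simp [this]
  exact this.comp (Primrec.const ()) Primrec.id

end TMQ

open Quad in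
theorem wang_hard : Pi01Hard WangDomino := by
  intro β _ B hB
  obtain ⟨f, hf, hB⟩ := hB
  -- partial search
  let g : ℕ →. ℕ := fun n => (Part.ofOption (Encodable.decode (α := β) n)).bind fun b =>
    Nat.rfind (fun m => Part.some (!f b m))
  have hg : Partrec g := by
    refine Partrec.bind (Computable.ofOption Computable.decode) ?_
    refine Partrec.rfind (p := fun (x : ℕ × β) m => Part.some (!f x.2 m)) ?_
    have h1 : Computable (fun x : (ℕ × β) × ℕ => !f x.1.2 x.2) :=
      Primrec.not.to_comp.comp (hf.comp (Computable.snd.comp Computable.fst) Computable.snd)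
    exact h1
  obtain ⟨c, hc⟩ := Turing.ToPartrec.Code.exists_code (Nat.Partrec'.part_iff₁.2 hg)
  have hdom : ∀ b : β, ¬ (c.eval [Encodable.encode b]).Dom ↔ B b := by
    intro b
    have := hc (List.Vector.cons (Encodable.encode b) List.Vector.nil)
    replace this : c.eval [Encodable.encode b] = _ := this
    rw [this, hB]
    have : g (Encodable.encode b) = Nat.rfind (fun m => Part.some (!f b m)) := by
      simp [g, Part.bind_some]
    simp only [Part.map_eq_map, Part.map_Dom, List.Vector.head_cons, this]
    have rd := Nat.rfind_dom (p := fun m => Part.some (!f b m))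
    refine (not_congr rd).trans ?_
    constructor
    · intro h n
      by_contra hn
      refine h ⟨n, by simpa using hn, fun {_} _ => trivial⟩
    · rintro h ⟨n, hn, -⟩
      simp [h n] at hn
  refine ⟨fun b => WQ (AMach.tables (TMQ.nx c) (TMQ.up c) TMQ.inp (TMQ.q0 c)
    (TMQ.bits (Encodable.encode b) ++ [2])), ?_, ?_⟩
  · refine WQ_primrec.to_comp.comp ((AMach.tables_primrec _ _ _ _).to_comp.comp ?_)
    exact Computable.list_append.comp (TMQ.bits_primrec.to_comp.comp Computable.encode) (Computable.const [2])
  · intro b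
    rw [← WQ_iff, ← hdom, ← TMQ.halt_iff c _ _ (TMQ.bits_spec _)]
    exact ⟨AMach.quad_of_nonhalt _ _ _ _, AMach.nonhalt_of_quad _ _ _ _⟩
end

open Set Metric
section

namespace Geo

/-- determinant of two plane vectors -/
def dt (a b : Pt) : ℝ := a 0 * b 1 - a 1 * b 0

theorem dt_add_left (a b c : Pt) : dt (a + b) c = dt a c + dt b c := by simp [dt]; ring
theorem dt_add_right (a b c : Pt) : dt a (b + c) = dt a b + dt a c := by simp [dt]; ring
theorem dt_sub_left (a b c : Pt) : dt (a - b) c = dt a c - dt b c := by simp [dt]; ring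
theorem dt_sub_right (a b c : Pt) : dt a (b - c) = dt a b - dt a c := by simp [dt]; ring
theorem dt_smul_left (t : ℝ) (a b : Pt) : dt (t • a) b = t * dt a b := by simp [dt]; ring
theorem dt_smul_right (t : ℝ) (a b : Pt) : dt a (t • b) = t * dt a b := by simp [dt]; ring
theorem dt_neg_left (a b : Pt) : dt (-a) b = - dt a b := by simp [dt]; ring
theorem dt_neg_right (a b : Pt) : dt a (-b) = - dt a b := by simp [dt]; ring
theorem dt_self (a : Pt) : dt a a = 0 := by simp [dt]; ring
theorem dt_swap (a b : Pt) : dt b a = - dt a b := by simp [dt]; ring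

theorem dt_continuous (a : Pt) : Continuous (fun z => dt a z) := by unfold dt; fun_prop

theorem pt_ext {a b : Pt} (h0 : a 0 = b 0) (h1 : a 1 = b 1) : a = b := by
  ext i; fin_cases i
  · exact h0
  · exact h1

theorem decomp {c d : Pt} (h : dt c d ≠ 0) (z : Pt) :
    z = (dt z d / dt c d) • c + (dt c z / dt c d) • d := by
  apply pt_ext
  · simp only [PiLp.add_apply, PiLp.smul_apply, smul_eq_mul]
    field_simp
    simp [dt]; ring
  · simp only [PiLp.add_apply, PiLp.smul_apply, smul_eq_mul]
    field_simp
    simp [dt]; ring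

theorem coord_left {c d : Pt} (h : dt c d ≠ 0) (s t : ℝ) : dt (s • c + t • d) d / dt c d = s := by
  rw [dt_add_left, dt_smul_left, dt_smul_left, dt_self]; field_simp; ring

theorem coord_unique {c d : Pt} (h : dt c d ≠ 0) {q : Pt} {s t s' t' : ℝ}
    (e : q + s • c + t • d = q + s' • c + t' • d) : s = s' ∧ t = t' := by
  have h0 := congrArg (fun z : Pt => z 0) e
  have h1 := congrArg (fun z : Pt => z 1) e
  simp only [PiLp.add_apply, PiLp.smul_apply, smul_eq_mul] at h0 h1
  unfold dt at h
  constructor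
  · have : (s - s') * (c 0 * d 1 - c 1 * d 0) = 0 := by linear_combination d 1 * h0 - d 0 * h1
    rcases mul_eq_zero.1 this with h' | h'
    · linarith
    · exact absurd h' h
  · have : (t - t') * (c 0 * d 1 - c 1 * d 0) = 0 := by linear_combination c 0 * h1 - c 1 * h0
    rcases mul_eq_zero.1 this with h' | h'
    · linarith
    · exact absurd h' h

theorem dt_ne_of_valid {r : Rhombus} (h : r.IsValid) : dt r.u r.v ≠ 0 := by
  intro h0
  have hl := LinearIndependent.pair_iff.1 h.1
  unfold dt at h0
  have e1 := hl (r.v 1) (-(r.u 1)) (by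
    apply pt_ext
    · simp; linarith
    · simp; ring)
  have e2 := hl (r.v 0) (-(r.u 0)) (by
    apply pt_ext
    · simp; ring
    · simp; linarith)
  have e3 := hl 1 0 (by
    apply pt_ext
    · simp; linarith [e2.2]
    · simp; linarith [e1.2])
  exact one_ne_zero e3.1

/-- `r` is the parallelogram with corner `q` and edge vectors `c`, `d` -/
inductive Par (r : Rhombus) : Pt → Pt → Pt → Prop
  | base : Par r r.pos r.u r.v
  | swap {q c d : Pt} : Par r q c d → Par r q d c
  | flip {q c d : Pt} : Par r q c d → Par r (q + c) (-c) d

namespace Par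
variable {r : Rhombus} {q c d : Pt}

theorem flip2 (h : Par r q c d) : Par r (q + d) c (-d) := h.swap.flip.swap

theorem cross (h : Par r q c d) : Par r (q + c) d (-c) := h.flip.swap

theorem dt_ne (hv : r.IsValid) (h : Par r q c d) : dt c d ≠ 0 := by
  induction h with
  | base => exact dt_ne_of_valid hv
  | swap _ ih => rw [dt_swap]; exact neg_ne_zero.2 ih
  | flip _ ih => rw [dt_neg_left]; exact neg_ne_zero.2 ih

theorem norm_eq (hv : r.IsValid) (h : Par r q c d) : ‖c‖ = ‖r.u‖ ∧ ‖d‖ = ‖r.u‖ := by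
  induction h with
  | base => exact ⟨rfl, hv.2.symm⟩
  | swap _ ih => exact ⟨ih.2, ih.1⟩
  | flip _ ih => rw [norm_neg]; exact ih

theorem mem_support (h : Par r q c d) {x : Pt} : x ∈ r.support ↔
    ∃ s t : ℝ, s ∈ Icc (0 : ℝ) 1 ∧ t ∈ Icc (0 : ℝ) 1 ∧ x = q + s • c + t • d := by
  induction h with
  | base => exact Iff.rfl
  | swap _ ih =>
    rw [ih]
    constructor
    · rintro ⟨s, t, hs, ht, rfl⟩; exact ⟨t, s, ht, hs, by abel⟩
    · rintro ⟨s, t, hs, ht, rfl⟩; exact ⟨t, s, ht, hs, by abel⟩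
  | flip _ ih =>
    rw [ih]
    constructor
    · rintro ⟨s, t, hs, ht, rfl⟩
      exact ⟨1 - s, t, ⟨by linarith [hs.2], by linarith [hs.1]⟩, ht, by module⟩
    · rintro ⟨s, t, hs, ht, rfl⟩
      exact ⟨1 - s, t, ⟨by linarith [hs.2], by linarith [hs.1]⟩, ht, by module⟩

theorem interior_iff (h : Par r q c d) {x : Pt} :
    (∃ s t : ℝ, s ∈ Ioo (0 : ℝ) 1 ∧ t ∈ Ioo (0 : ℝ) 1 ∧ x = r.pos + s • r.u + t • r.v) ↔
    ∃ s t : ℝ, s ∈ Ioo (0 : ℝ) 1 ∧ t ∈ Ioo (0 : ℝ) 1 ∧ x = q + s • c + t • d := by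
  induction h with
  | base => exact Iff.rfl
  | swap _ ih =>
    rw [ih]
    constructor
    · rintro ⟨s, t, hs, ht, rfl⟩; exact ⟨t, s, ht, hs, by abel⟩
    · rintro ⟨s, t, hs, ht, rfl⟩; exact ⟨t, s, ht, hs, by abel⟩
  | flip _ ih =>
    rw [ih]
    constructor
    · rintro ⟨s, t, hs, ht, rfl⟩
      exact ⟨1 - s, t, ⟨by linarith [hs.2], by linarith [hs.1]⟩, ht, by module⟩
    · rintro ⟨s, t, hs, ht, rfl⟩
      exact ⟨1 - s, t, ⟨by linarith [hs.2], by linarith [hs.1]⟩, ht, by module⟩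

theorem vertices_eq (h : Par r q c d) : r.vertices = {q, q + c, q + d, q + c + d} := by
  induction h with
  | base => rfl
  | @swap q c d _ ih =>
    rw [ih, show q + c + d = q + d + c by abel]
    ext x; simp only [mem_insert_iff, mem_singleton_iff]; tauto
  | @flip q c d _ ih =>
    rw [ih, show q + c + -c = q by abel]
    ext x; simp only [mem_insert_iff, mem_singleton_iff]; tauto

theorem edges_eq (h : Par r q c d) : r.edges = {segment ℝ q (q + c), segment ℝ q (q + d),
    segment ℝ (q + c) (q + c + d), segment ℝ (q + d) (q + c + d)} := by
  induction h with
  | base =>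
    ext e
    simp only [Rhombus.edges, mem_range, mem_insert_iff, mem_singleton_iff]
    constructor
    · rintro ⟨i, rfl⟩
      fin_cases i
      · exact Or.inl rfl
      · exact Or.inr (Or.inr (Or.inl rfl))
      · exact Or.inr (Or.inr (Or.inr (segment_symm _ _ _)))
      · exact Or.inr (Or.inl (segment_symm _ _ _))
    · rintro (rfl | rfl | rfl | rfl)
      · exact ⟨0, rfl⟩
      · exact ⟨3, segment_symm _ _ _⟩
      · exact ⟨1, rfl⟩
      · exact ⟨2, segment_symm _ _ _⟩
  | @swap q c d _ ih =>
    rw [ih, show q + c + d = q + d + c by abel]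
    ext x; simp only [mem_insert_iff, mem_singleton_iff]; tauto
  | @flip q c d _ ih =>
    rw [ih, show q + c + -c = q by abel]
    ext x; simp only [mem_insert_iff, mem_singleton_iff,
      segment_symm ℝ (q + c) q, segment_symm ℝ (q + c + d) (q + d)]; tauto

theorem of_vertex {v : Pt} (hv : v ∈ r.vertices) : ∃ c d, Par r v c d := by
  rcases hv with rfl | rfl | rfl | rfl
  · exact ⟨_, _, base⟩
  · exact ⟨_, _, base.flip⟩
  · exact ⟨_, _, base.flip2⟩
  · exact ⟨_, _, base.flip.flip2⟩

theorem of_edge {e : Set Pt} (he : e ∈ r.edges) : ∃ q c d, Par r q c d ∧ e = segment ℝ q (q + c) := by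
  rw [edges_eq base] at he
  rcases he with rfl | rfl | rfl | rfl
  · exact ⟨_, _, _, base, rfl⟩
  · exact ⟨_, _, _, base.swap, rfl⟩
  · exact ⟨_, _, _, base.flip.swap, rfl⟩
  · refine ⟨_, _, _, base.flip2, ?_⟩
    rw [show r.pos + r.v + r.u = r.pos + r.u + r.v by abel]

theorem vertex (h : Par r q c d) : q ∈ r.vertices := by rw [h.vertices_eq]; simp

theorem edge_mem (h : Par r q c d) : segment ℝ q (q + c) ∈ r.edges := by rw [h.edges_eq]; simp

end Par

theorem vertices_subset (r : Rhombus) : r.vertices ⊆ r.support := by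
  intro v hv
  obtain ⟨c, d, h⟩ := Par.of_vertex hv
  exact h.mem_support.2 ⟨0, 0, by simp, by simp, by simp⟩

theorem segment_eq {a b c d : Pt} (h : segment ℝ a b = segment ℝ c d) :
    (a = c ∧ b = d) ∨ (a = d ∧ b = c) := by
  have hmem : ∀ {a b x : Pt}, x ∈ segment ℝ a b → ∃ t ∈ Icc (0 : ℝ) 1, x = a + t • (b - a) := by
    intro a b x hx
    rw [segment_eq_image'] at hx
    obtain ⟨t, ht, rfl⟩ := hx
    exact ⟨t, ht, rfl⟩
  obtain ⟨s, hs, ea⟩ := hmem (h ▸ left_mem_segment ℝ a b)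
  obtain ⟨t, ht, eb⟩ := hmem (h ▸ right_mem_segment ℝ a b)
  obtain ⟨s', hs', ec⟩ := hmem (h.symm ▸ left_mem_segment ℝ c d : c ∈ segment ℝ a b)
  obtain ⟨t', ht', ed⟩ := hmem (h.symm ▸ right_mem_segment ℝ c d : d ∈ segment ℝ a b)
  by_cases hcd : d - c = 0
  · rw [hcd] at ea eb
    simp at ea eb
    left; exact ⟨ea, by rw [eb]; exact (sub_eq_zero.1 hcd).symm⟩
  · have e1 : (s + s' * (t - s)) • (d - c) = (0 : ℝ) • (d - c) := by
      have : c = c + (s + s' * (t - s)) • (d - c) := by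
        conv_lhs => rw [ec, ea, eb]
        module
      rw [zero_smul]
      exact left_eq_add.1 this
    have e2 : (s + t' * (t - s)) • (d - c) = (1 : ℝ) • (d - c) := by
      have : d = c + (s + t' * (t - s)) • (d - c) := by
        conv_lhs => rw [ed, ea, eb]
        module
      rw [one_smul]
      nth_rewrite 2 [this]
      abel
    have e1 := smul_left_injective ℝ hcd e1
    have e2 := smul_left_injective ℝ hcd e2
    have e3 : (t' - s') * (t - s) = 1 := by linarith
    obtain ⟨hs0, hs1⟩ := hs
    obtain ⟨ht0, ht1⟩ := ht
    obtain ⟨hs'0, hs'1⟩ := hs'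
    obtain ⟨ht'0, ht'1⟩ := ht'
    rcases le_total s t with hst | hst
    · have : t - s = 1 := by nlinarith
      left
      have h1 : s = 0 := by linarith
      have h2 : t = 1 := by linarith
      subst h1 h2
      exact ⟨by simpa using ea, by simpa using eb⟩
    · have : s - t = 1 := by nlinarith
      right
      have h1 : t = 0 := by linarith
      have h2 : s = 1 := by linarith
      subst h1 h2
      exact ⟨by simpa using ea, by simpa using eb⟩

theorem mem_edge {q c x : Pt} : x ∈ segment ℝ q (q + c) ↔ ∃ t ∈ Icc (0 : ℝ) 1, x = q + t • c := by
  rw [segment_eq_image']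
  simp only [add_sub_cancel_left, mem_image]
  constructor
  · rintro ⟨t, ht, rfl⟩; exact ⟨t, ht, rfl⟩
  · rintro ⟨t, ht, rfl⟩; exact ⟨t, ht, rfl⟩

/-- a common edge gives adapted frames -/
theorem common_edge {r s : Rhombus} {e : Set Pt} (hr : e ∈ r.edges) (hs : e ∈ s.edges) :
    ∃ q c d d', Par r q c d ∧ Par s q c d' ∧ e = segment ℝ q (q + c) := by
  obtain ⟨q, c, d, h1, rfl⟩ := Par.of_edge hr
  obtain ⟨q', c', d', h2, h3⟩ := Par.of_edge hs
  rcases segment_eq h3 with ⟨e1, e2⟩ | ⟨e1, e2⟩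
  · have : c = c' := by rw [e1] at e2; exact add_left_cancel e2
    subst e1 this
    exact ⟨_, _, _, _, h1, h2, rfl⟩
  · have := h2.flip
    rw [← e1] at this
    have hc : c = -c' := by
      have : q + c = q' := e2
      rw [e1] at this
      have h4 : c' + c = 0 := by
        have : q' + (c' + c) = q' + 0 := by rw [add_zero, ← add_assoc]; exact this
        exact add_left_cancel this
      exact eq_neg_of_add_eq_zero_right h4
    rw [← hc] at this
    exact ⟨_, _, _, _, h1, this, rfl⟩

def Inter (r : Rhombus) (x : Pt) : Prop :=
  ∃ s t : ℝ, s ∈ Ioo (0 : ℝ) 1 ∧ t ∈ Ioo (0 : ℝ) 1 ∧ x = r.pos + s • r.u + t • r.v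

theorem Inter.mem {r : Rhombus} {x : Pt} (h : Inter r x) : x ∈ r.support := by
  obtain ⟨s, t, hs, ht, rfl⟩ := h
  exact ⟨s, t, Ioo_subset_Icc_self hs, Ioo_subset_Icc_self ht, rfl⟩

theorem inter_not_edge {r : Rhombus} (hv : r.IsValid) {q c d x : Pt} (h : Par r q c d)
    (hx : x ∈ segment ℝ q (q + c)) : ¬ Inter r x := by
  intro hi
  obtain ⟨s, t, hs, ht, e⟩ := h.interior_iff.1 hi
  obtain ⟨t', ht', e'⟩ := mem_edge.1 hx
  have : q + s • c + t • d = q + t' • c + (0 : ℝ) • d := by rw [← e, e']; simp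
  have := (coord_unique (h.dt_ne hv) this).2
  linarith [ht.1]

/-- trichotomy for meeting tiles -/
theorem meet {x : Set Rhombus} (hx : IsTiling x) {r s : Rhombus} (hr : r ∈ x) (hs : s ∈ x)
    (hne : r ≠ s) {p : Pt} (hp : p ∈ r.support) (hp' : p ∈ s.support) :
    (p ∈ r.vertices ∧ p ∈ s.vertices ∧ r.support ∩ s.support = {p}) ∨
    ∃ q c d d', Par r q c d ∧ Par s q c d' ∧ r.support ∩ s.support = segment ℝ q (q + c) := by
  rcases hx.2.2 r hr s hs hne with h | ⟨v, h1, h2, h3⟩ | ⟨e, h1, h2, h3⟩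
  · have : p ∈ r.support ∩ s.support := ⟨hp, hp'⟩
    rw [h] at this; exact absurd this (notMem_empty _)
  · have : p ∈ r.support ∩ s.support := ⟨hp, hp'⟩
    rw [h3] at this
    rw [mem_singleton_iff] at this
    subst this
    exact Or.inl ⟨h1, h2, h3⟩
  · obtain ⟨q, c, d, d', ha, hb, rfl⟩ := common_edge h1 h2
    exact Or.inr ⟨q, c, d, d', ha, hb, h3⟩

theorem vertex_not_inter {r : Rhombus} (hv : r.IsValid) {x : Pt} (h : x ∈ r.vertices) : ¬ Inter r x := by
  obtain ⟨c, d, hp⟩ := Par.of_vertex h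
  exact inter_not_edge hv hp (left_mem_segment ℝ _ _)

theorem inter_unique {x : Set Rhombus} (hx : IsTiling x) {r s : Rhombus} (hr : r ∈ x) (hs : s ∈ x)
    {p : Pt} (hp : Inter r p) (hp' : p ∈ s.support) : r = s := by
  by_contra hne
  rcases meet hx hr hs hne hp.mem hp' with h | ⟨q, c, d, d', ha, hb, h⟩
  · exact vertex_not_inter (hx.1 r hr) h.1 hp
  · have : p ∈ r.support ∩ s.support := ⟨hp.mem, hp'⟩
    rw [h] at this
    exact inter_not_edge (hx.1 r hr) ha this hp

/-- for a point `p` of the tile `r` there is a vertex of `r` common to all tiles containing `p` -/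
theorem star_vertex {x : Set Rhombus} (hx : IsTiling x) {r : Rhombus} (hr : r ∈ x) {p : Pt}
    (hp : p ∈ r.support) : ∃ v ∈ r.vertices, ∀ s ∈ x, p ∈ s.support → v ∈ s.vertices := by
  by_cases hv : p ∈ r.vertices
  · refine ⟨p, hv, fun s hs hps => ?_⟩
    by_cases hne : r = s
    · rw [← hne]; exact hv
    rcases meet hx hr hs hne hp hps with h | ⟨q, c, d, d', ha, hb, h⟩
    · exact h.2.1
    · have hm : p ∈ r.support ∩ s.support := ⟨hp, hps⟩
      rw [h] at hm
      obtain ⟨t, ht, e⟩ := mem_edge.1 hm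
      rw [ha.vertices_eq] at hv
      rw [hb.vertices_eq]
      have hd := ha.dt_ne (hx.1 r hr)
      have key : ∀ s' t' : ℝ, p = q + s' • c + t' • d → t' = 0 ∧ t = s' := by
        intro s' t' e'
        have := coord_unique hd (q := q) (s := t) (t := 0) (s' := s') (t' := t') (by rw [← e', e]; simp)
        exact ⟨this.2.symm, this.1⟩
      rcases hv with h1 | h1 | h1 | h1
      · simp [h1]
      · simp [h1]
      · have := (key 0 1 (by rw [h1]; simp)).1
        norm_num at this
      · have := (key 1 1 (by rw [h1]; simp)).1
        norm_num at this
  by_cases hi : Inter r p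
  · exact ⟨r.pos, Par.base.vertex, fun s hs hps => by
      rw [← inter_unique hx hr hs hi hps]; exact Par.base.vertex⟩
  -- open edge
  have : ∃ q c d, Par r q c d ∧ ∃ t : ℝ, 0 < t ∧ t < 1 ∧ p = q + t • c := by
    obtain ⟨s, t, hs, ht, e⟩ := hp
    have ns : ¬ (s = 0 ∧ t = 0) := by
      rintro ⟨rfl, rfl⟩; apply hv; rw [e]; simp [Rhombus.vertices]
    have ns1 : ¬ (s = 1 ∧ t = 0) := by
      rintro ⟨rfl, rfl⟩; apply hv; rw [e]; simp [Rhombus.vertices]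
    have ns2 : ¬ (s = 0 ∧ t = 1) := by
      rintro ⟨rfl, rfl⟩; apply hv; rw [e]; simp [Rhombus.vertices]
    have ns3 : ¬ (s = 1 ∧ t = 1) := by
      rintro ⟨rfl, rfl⟩; apply hv; rw [e]; simp [Rhombus.vertices]
    by_cases t0 : t = 0
    · subst t0
      refine ⟨_, _, _, Par.base, s, lt_of_le_of_ne hs.1 (fun h => ns ⟨h.symm, rfl⟩),
        lt_of_le_of_ne hs.2 (fun h => ns1 ⟨h, rfl⟩), by rw [e]; simp⟩
    by_cases t1 : t = 1
    · subst t1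
      refine ⟨_, _, _, Par.base.flip2, s, lt_of_le_of_ne hs.1 (fun h => ns2 ⟨h.symm, rfl⟩),
        lt_of_le_of_ne hs.2 (fun h => ns3 ⟨h, rfl⟩), by rw [e]; module⟩
    have ht0 : 0 < t := lt_of_le_of_ne ht.1 (Ne.symm t0)
    have ht1 : t < 1 := lt_of_le_of_ne ht.2 t1
    by_cases s0 : s = 0
    · subst s0
      exact ⟨_, _, _, Par.base.swap, t, ht0, ht1, by rw [e]; simp⟩
    by_cases s1 : s = 1
    · subst s1
      exact ⟨_, _, _, Par.base.flip.swap, t, ht0, ht1, by rw [e]; simp⟩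
    exact absurd ⟨s, t, ⟨lt_of_le_of_ne hs.1 (Ne.symm s0), lt_of_le_of_ne hs.2 s1⟩, ⟨ht0, ht1⟩, e⟩ hi
  obtain ⟨q, c, d, hP, t, ht0, ht1, e⟩ := this
  refine ⟨q, hP.vertex, fun s hs hps => ?_⟩
  by_cases hne : r = s
  · rw [← hne]; exact hP.vertex
  rcases meet hx hr hs hne hp hps with h | ⟨q', c', d1, d', ha, hb, h⟩
  · exact absurd h.1 hv
  · have hm : p ∈ r.support ∩ s.support := ⟨hp, hps⟩
    rw [h] at hm
    have he := ha.edge_mem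
    have hd := hP.dt_ne (hx.1 r hr)
    have key : ∀ s' t' : ℝ, p = q + s' • c + t' • d → t = s' ∧ t' = 0 := by
      intro s' t' e'
      have := coord_unique hd (q := q) (s := t) (t := 0) (s' := s') (t' := t') (by rw [← e', e]; simp)
      exact ⟨this.1, this.2.symm⟩
    rw [hP.edges_eq] at he
    have hq : q ∈ segment ℝ q' (q' + c') := by
      rcases he with h1 | h1 | h1 | h1
      · rw [h1]; exact left_mem_segment ℝ _ _
      · rw [h1] at hm
        obtain ⟨t1, _, e1⟩ := mem_edge.1 hm
        have := (key 0 t1 (by rw [e1]; simp)).1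
        linarith
      · rw [h1] at hm
        obtain ⟨t1, _, e1⟩ := mem_edge.1 hm
        have := (key 1 t1 (by rw [e1]; simp)).1
        linarith
      · rw [show q + c + d = q + d + c by abel] at h1
        rw [h1] at hm
        obtain ⟨t1, _, e1⟩ := mem_edge.1 hm
        have := (key t1 1 (by rw [e1]; module)).2
        norm_num at this
    -- q is a vertex of r on the common edge
    have hqr : q ∈ r.vertices := hP.vertex
    rw [ha.vertices_eq] at hqr
    rw [hb.vertices_eq]
    obtain ⟨t2, _, e2⟩ := mem_edge.1 hq
    have hd' := ha.dt_ne (hx.1 r hr)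
    rcases hqr with h1 | h1 | h1 | h1
    · simp [h1]
    · simp [h1]
    · have := (coord_unique hd' (q := q') (s := t2) (t := 0) (s' := 0) (t' := 1)
        (by rw [zero_smul, add_zero, ← e2, h1]; simp)).2
      norm_num at this
    · have := (coord_unique hd' (q := q') (s := t2) (t := 0) (s' := 1) (t' := 1)
        (by rw [zero_smul, add_zero, ← e2, h1]; simp)).2
      norm_num at this

end Geo
end

open Set Metric
section

namespace Geo

/-- monodromy principle in the plane -/
theorem monodromy {Z : Type} (π : Z → Pt) (T : Z → Pt → Z) {ε : ℝ} (hε : 0 < ε)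
    (h1 : ∀ z q, dist (π z) q < ε → π (T z q) = q)
    (h2 : ∀ z, T z (π z) = z)
    (h3 : ∀ z q q', dist (π z) q < ε → dist (π z) q' < ε → dist q q' < ε →
      T (T z q) q' = T z q') (z0 : Z) :
    ∃ s : Pt → Z, (∀ p, π (s p) = p) ∧ s (π z0) = z0 ∧
      ∀ p q, dist p q < ε / 4 → T (s p) q = s q := by
  set η := ε / 4 with hη
  have hη0 : 0 < η := by positivity
  set p0 := π z0 with hp0
  let h : ℕ → Pt → Pt := fun k p => p0 + (((k : ℝ) + 1) / (k + 2)) • (p - p0)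
  let S : ℕ → Pt → Z := fun k => Nat.rec (fun p => T z0 p) (fun k s p => T (s (h k p)) p) k
  have hS0 : ∀ p, S 0 p = T z0 p := fun p => rfl
  have hSs : ∀ k p, S (k + 1) p = T (S k (h k p)) p := fun k p => rfl
  have hc1 : ∀ k : ℕ, 0 ≤ ((k : ℝ) + 1) / (k + 2) := fun k => by positivity
  have hc2 : ∀ k : ℕ, ((k : ℝ) + 1) / (k + 2) ≤ 1 := fun k => by
    rw [div_le_one (by positivity)]; linarith
  have hd1 : ∀ k p q, dist (h k p) (h k q) ≤ dist p q := by
    intro k p q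
    simp only [h, dist_add_left]
    rw [dist_smul₀, dist_sub_right, Real.norm_of_nonneg (hc1 k)]
    exact mul_le_of_le_one_left dist_nonneg (hc2 k)
  have hd0 : ∀ k p, dist (h k p) p0 = ((k : ℝ) + 1) / (k + 2) * dist p p0 := by
    intro k p
    simp only [h]
    rw [dist_eq_norm, add_sub_cancel_left, norm_smul, Real.norm_of_nonneg (hc1 k), dist_eq_norm]
  have hd2 : ∀ (k : ℕ) p, dist p p0 < ((k : ℝ) + 2) * η → dist (h k p) p0 < (k + 1) * η := by
    intro k p hp
    rw [hd0, div_mul_eq_mul_div, div_lt_iff₀ (by positivity)]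
    have : (0 : ℝ) < (k : ℝ) + 1 := by positivity
    nlinarith
  have hd3 : ∀ (k : ℕ) p, dist p p0 < ((k : ℝ) + 2) * η → dist (h k p) p < η := by
    intro k p hp
    have : h k p - p = (-(1 / ((k : ℝ) + 2))) • (p - p0) := by
      have e : ((k : ℝ) + 1) / (k + 2) = 1 + (-(1 / ((k : ℝ) + 2))) := by
        have : (k : ℝ) + 2 ≠ 0 := by positivity
        field_simp; ring
      simp only [h]
      rw [e]; module
    rw [dist_eq_norm, this, norm_smul, norm_neg, Real.norm_of_nonneg (by positivity), ← dist_eq_norm,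
      div_mul_eq_mul_div, div_lt_iff₀ (by positivity)]
    linarith
  have P : ∀ k : ℕ, (∀ p, dist p p0 < ((k : ℝ) + 1) * η → π (S k p) = p) ∧
      (∀ p q, dist p p0 < ((k : ℝ) + 1) * η → dist q p0 < ((k : ℝ) + 1) * η → dist p q < η →
        T (S k p) q = S k q) ∧ S k p0 = z0 := by
    intro k
    induction k with
    | zero =>
      refine ⟨fun p hp => ?_, fun p q hp hq hpq => ?_, h2 z0⟩
      · rw [hS0]; apply h1; rw [dist_comm]; push_cast at hp; linarith
      · rw [hS0, hS0]
        apply h3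
        · rw [dist_comm]; push_cast at hp; linarith
        · rw [dist_comm]; push_cast at hq; linarith
        · linarith
    | succ k ih =>
      obtain ⟨i1, i2, i3⟩ := ih
      have cast : ((k + 1 : ℕ) : ℝ) + 1 = (k : ℝ) + 2 := by push_cast; ring
      rw [cast]
      refine ⟨fun p hp => ?_, fun p q hp hq hpq => ?_, ?_⟩
      · rw [hSs]; apply h1
        rw [i1 _ (hd2 k p hp)]
        have := hd3 k p hp
        linarith
      · rw [hSs, hSs]
        have a1 := hd3 k p hp
        have a2 := hd3 k q hq
        have a3 := (hd1 k p q).trans_lt hpq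
        have a4 : dist (h k p) q < 2 * η := by
          have := dist_triangle (h k p) p q; linarith
        rw [← i2 (h k p) (h k q) (hd2 k p hp) (hd2 k q hq) a3]
        rw [h3, h3]
        · rw [i1 _ (hd2 k p hp)]; linarith
        · rw [i1 _ (hd2 k p hp)]; linarith
        · linarith
        · rw [i1 _ (hd2 k p hp)]; linarith
        · rw [i1 _ (hd2 k p hp)]; linarith
        · linarith
      · rw [hSs]
        have : h k p0 = p0 := by simp [h]
        rw [this, i3]
        exact h2 z0
  have step : ∀ (k : ℕ) p, dist p p0 < ((k : ℝ) + 1) * η → S (k + 1) p = S k p := by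
    intro k p hp
    rw [hSs]
    have b : dist p p0 < ((k : ℝ) + 2) * η := by nlinarith
    exact (P k).2.1 _ _ (hd2 k p b) hp (hd3 k p b)
  have steps : ∀ (k m : ℕ) p, dist p p0 < ((k : ℝ) + 1) * η → S (k + m) p = S k p := by
    intro k m p hp
    induction m with
    | zero => rfl
    | succ m ih =>
      rw [← add_assoc, step, ih]
      push_cast
      have : (0 : ℝ) ≤ m := by positivity
      nlinarith
  let N : Pt → ℕ := fun p => ⌈dist p p0 / η⌉₊
  have hN : ∀ p, dist p p0 < ((N p : ℝ) + 1) * η := by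
    intro p
    have := Nat.le_ceil (dist p p0 / η)
    rw [div_le_iff₀ hη0] at this
    simp only [N]
    linarith
  refine ⟨fun p => S (N p) p, fun p => (P _).1 p (hN p), (P _).2.2, fun p q hpq => ?_⟩
  have e1 := steps (N p) (N q) p (hN p)
  have e2 := steps (N q) (N p) q (hN q)
  show T (S (N p) p) q = S (N q) q
  rw [← e1, ← e2, add_comm (N q)]
  have m1 : (0 : ℝ) ≤ N p := by positivity
  have m2 : (0 : ℝ) ≤ N q := by positivity
  refine (P _).2.1 p q ?_ ?_ hpq
  · push_cast; have := hN p; nlinarith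
  · push_cast; have := hN q; nlinarith

theorem support_compact (r : Rhombus) : IsCompact r.support := by
  have : r.support = (fun st : ℝ × ℝ => r.pos + st.1 • r.u + st.2 • r.v) ''
      (Icc (0 : ℝ) 1 ×ˢ Icc (0 : ℝ) 1) := by
    ext x
    simp only [Rhombus.support, mem_ofPred_eq, mem_image, Prod.exists, mem_prod]
    constructor
    · rintro ⟨s, t, hs, ht, rfl⟩; exact ⟨s, t, ⟨hs, ht⟩, rfl⟩
    · rintro ⟨s, t, ⟨hs, ht⟩, rfl⟩; exact ⟨s, t, hs, ht, rfl⟩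
  rw [this]
  exact (isCompact_Icc.prod isCompact_Icc).image (by fun_prop)

theorem center_mem (r : Rhombus) : r.center ∈ r.support :=
  ⟨2⁻¹, 2⁻¹, by constructor <;> norm_num, by constructor <;> norm_num, rfl⟩

theorem dist_center {r : Rhombus} {p : Pt} (hp : p ∈ r.support) :
    dist p r.center ≤ ‖r.u‖ + ‖r.v‖ := by
  obtain ⟨s, t, hs, ht, rfl⟩ := hp
  rw [dist_eq_norm]
  have : r.pos + s • r.u + t • r.v - r.center = (s - 2⁻¹) • r.u + (t - 2⁻¹) • r.v := by
    simp only [Rhombus.center]; module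
  rw [this]
  refine (norm_add_le _ _).trans ?_
  rw [norm_smul, norm_smul]
  have a : ‖s - 2⁻¹‖ ≤ 1 := by rw [Real.norm_eq_abs, abs_le]; constructor <;> linarith [hs.1, hs.2]
  have b : ‖t - 2⁻¹‖ ≤ 1 := by rw [Real.norm_eq_abs, abs_le]; constructor <;> linarith [ht.1, ht.2]
  have := mul_le_of_le_one_left (norm_nonneg r.u) a
  have := mul_le_of_le_one_left (norm_nonneg r.v) b
  linarith

/-- a ball around the center lies in the interior -/
theorem inter_ball {r : Rhombus} (h : r.IsValid) : ∃ ρ > 0, ∀ z : Pt, ‖z‖ < ρ → Inter r (r.center + z) := by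
  have hd := dt_ne_of_valid h
  have c1 : Continuous (fun z : Pt => dt z r.v / dt r.u r.v) := by unfold dt; fun_prop
  have c2 : Continuous (fun z : Pt => dt r.u z / dt r.u r.v) := by unfold dt; fun_prop
  have z1 : dt 0 r.v / dt r.u r.v = 0 := by simp [dt]
  have z2 : dt r.u 0 / dt r.u r.v = 0 := by simp [dt]
  have o : IsOpen ((fun z : Pt => dt z r.v / dt r.u r.v) ⁻¹' Ioo (-2⁻¹) 2⁻¹ ∩
      (fun z : Pt => dt r.u z / dt r.u r.v) ⁻¹' Ioo (-2⁻¹) 2⁻¹) :=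
    (isOpen_Ioo.preimage c1).inter (isOpen_Ioo.preimage c2)
  obtain ⟨ρ, hρ, hb⟩ := Metric.isOpen_iff.1 o 0 (by
    constructor
    · simp only [mem_preimage, z1]; constructor <;> norm_num
    · simp only [mem_preimage, z2]; constructor <;> norm_num)
  refine ⟨ρ, hρ, fun z hz => ?_⟩
  obtain ⟨m1, m2⟩ := hb (show z ∈ ball 0 ρ by simpa using hz)
  simp only [mem_preimage, mem_Ioo] at m1 m2
  refine ⟨2⁻¹ + dt z r.v / dt r.u r.v, 2⁻¹ + dt r.u z / dt r.u r.v, ⟨by linarith, by linarith⟩,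
    ⟨by linarith, by linarith⟩, ?_⟩
  conv_lhs => rw [decomp hd z]
  simp only [Rhombus.center]
  module

/-- interior points are dense in the support -/
theorem inter_near {r : Rhombus} {p : Pt} (hp : p ∈ r.support) {δ : ℝ} (hδ : 0 < δ) :
    ∃ q, Inter r q ∧ dist q p < δ := by
  obtain ⟨s, t, hs, ht, rfl⟩ := hp
  let g : ℝ → Pt := fun τ => r.pos + ((1 - τ) * s + τ * 2⁻¹) • r.u + ((1 - τ) * t + τ * 2⁻¹) • r.v
  have hg : Continuous g := by fun_prop
  have h0 : g 0 = r.pos + s • r.u + t • r.v := by simp [g]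
  have : ∀ᶠ τ in nhdsWithin (0 : ℝ) (Ioi 0), dist (g τ) (g 0) < δ := by
    apply Filter.Eventually.filter_mono nhdsWithin_le_nhds
    exact Metric.tendsto_nhds.1 (hg.tendsto 0) δ hδ
  obtain ⟨τ, h1, h2⟩ := (this.and (Ioo_mem_nhdsGT (show (0 : ℝ) < 1 by norm_num))).exists
  refine ⟨g τ, ⟨_, _, ?_, ?_, rfl⟩, by rw [← h0]; exact h1⟩
  · constructor <;> nlinarith [hs.1, hs.2, h2.1, h2.2]
  · constructor <;> nlinarith [ht.1, ht.2, h2.1, h2.2]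

section fin
variable {k : ℕ} {shapes : Fin k → Rhombus}

theorem shape_of {x : Set Rhombus} (hx : IsTilingOn (range shapes) x) {r : Rhombus} (hr : r ∈ x) :
    ∃ i, r.u = (shapes i).u ∧ r.v = (shapes i).v := by
  obtain ⟨s, ⟨i, rfl⟩, h⟩ := hx.2 r hr
  exact ⟨i, h⟩

theorem inter_shift {r s : Rhombus} (hu : r.u = s.u) (hv : r.v = s.v) {z : Pt}
    (h : Inter s (s.center + z)) : Inter r (r.center + z) := by
  obtain ⟨a, b, ha, hb, e⟩ := h
  refine ⟨a, b, ha, hb, ?_⟩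
  simp only [Rhombus.center] at e ⊢
  have e' : z = (a - 2⁻¹) • s.u + (b - 2⁻¹) • s.v := by
    have : z = (s.pos + (2⁻¹ : ℝ) • s.u + (2⁻¹ : ℝ) • s.v + z) - (s.pos + (2⁻¹ : ℝ) • s.u + (2⁻¹ : ℝ) • s.v) := by abel
    rw [this, e]; module
  rw [e', hu, hv]; module

/-- separation of centers -/
theorem separated (hval : ∀ i, (shapes i).IsValid) : ∃ ρ > 0, ∀ x, IsTilingOn (range shapes) x →
    ∀ r ∈ x, ∀ s ∈ x, dist r.center s.center < ρ → r = s := by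
  have : ∀ᶠ ρ in nhdsWithin (0 : ℝ) (Ioi 0), ∀ i, ∀ z : Pt, ‖z‖ < ρ →
      Inter (shapes i) ((shapes i).center + z) := by
    rw [Filter.eventually_all]
    intro i
    obtain ⟨ρ, hρ, h⟩ := inter_ball (hval i)
    filter_upwards [Ioo_mem_nhdsGT hρ] with τ hτ z hz
    exact h z (hz.trans hτ.2)
  obtain ⟨ρ, h1, h2⟩ := (this.and self_mem_nhdsWithin).exists
  refine ⟨ρ, h2, fun x hx r hr s hs hd => ?_⟩
  obtain ⟨i, hu, hv⟩ := shape_of hx hr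
  have := inter_shift hu hv (h1 i (s.center - r.center) (by rw [← dist_eq_norm, dist_comm]; exact hd))
  rw [add_sub_cancel] at this
  exact inter_unique hx.1 hr hs this (center_mem s)

def diam (shapes : Fin k → Rhombus) : ℝ := ∑ i, (‖(shapes i).u‖ + ‖(shapes i).v‖)

theorem diam_nonneg (shapes : Fin k → Rhombus) : 0 ≤ diam shapes :=
  Finset.sum_nonneg fun i _ => by positivity

theorem dist_center' {x : Set Rhombus} (hx : IsTilingOn (range shapes) x) {r : Rhombus} (hr : r ∈ x)
    {p : Pt} (hp : p ∈ r.support) : dist p r.center ≤ diam shapes := by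
  obtain ⟨i, hu, hv⟩ := shape_of hx hr
  refine (dist_center hp).trans ?_
  rw [hu, hv]
  exact Finset.single_le_sum (f := fun i => ‖(shapes i).u‖ + ‖(shapes i).v‖)
    (fun i _ => by positivity) (Finset.mem_univ i)

theorem locally_finite (hval : ∀ i, (shapes i).IsValid) {x : Set Rhombus}
    (hx : IsTilingOn (range shapes) x) (p : Pt) (R : ℝ) :
    {r | r ∈ x ∧ ∃ q ∈ r.support, dist q p < R}.Finite := by
  obtain ⟨ρ, hρ, hs⟩ := separated hval
  obtain ⟨t, _, ht, hc⟩ := finite_cover_balls_of_compact (isCompact_closedBall p (R + diam shapes))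
    (half_pos hρ)
  have key : ∀ r ∈ {r | r ∈ x ∧ ∃ q ∈ r.support, dist q p < R}, ∃ y ∈ t, dist r.center y < ρ / 2 := by
    rintro r ⟨hr, q, hq, hd⟩
    have : r.center ∈ closedBall p (R + diam shapes) := by
      have := dist_center' hx hr hq
      rw [mem_closedBall]
      have := dist_triangle r.center q p
      rw [dist_comm r.center q] at this
      linarith
    obtain ⟨y, hy, hy'⟩ := mem_iUnion₂.1 (hc this)
    exact ⟨y, hy, hy'⟩
  classical
  choose! f hf hf' using key
  refine Set.Finite.of_injOn (f := f) (t := t) hf ?_ ht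
  intro r hr s hs' e
  apply hs x hx r hr.1 s hs'.1
  have := dist_triangle_right r.center s.center (f r)
  have h1 := hf' r hr
  have h2 := hf' s hs'
  rw [← e] at h2
  linarith

theorem local_star (hval : ∀ i, (shapes i).IsValid) {x : Set Rhombus}
    (hx : IsTilingOn (range shapes) x) (p : Pt) :
    ∃ δ > 0, ∀ r ∈ x, ∀ q ∈ r.support, dist q p < δ → p ∈ r.support := by
  set A := {r | r ∈ x ∧ ∃ q ∈ r.support, dist q p < 1} with hA
  have hf : A.Finite := locally_finite hval hx p 1
  have hB : (A ∩ {r | p ∉ r.support}).Finite := hf.inter_of_left _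
  have hcl : IsClosed (⋃ r ∈ A ∩ {r | p ∉ r.support}, r.support) :=
    hB.isClosed_biUnion fun r _ => (support_compact r).isClosed
  have hp : p ∈ (⋃ r ∈ A ∩ {r | p ∉ r.support}, r.support)ᶜ := by
    intro h
    obtain ⟨r, hr, h⟩ := mem_iUnion₂.1 h
    exact hr.2 h
  obtain ⟨δ, hδ, hb⟩ := Metric.isOpen_iff.1 hcl.isOpen_compl p hp
  refine ⟨min δ 1, by positivity, fun r hr q hq hd => ?_⟩
  by_contra hn
  refine hb (show q ∈ ball p δ from hd.trans_le (min_le_left _ _)) ?_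
  exact mem_iUnion₂.2 ⟨r, ⟨⟨hr, q, hq, hd.trans_le (min_le_right _ _)⟩, hn⟩, hq⟩

theorem covers {x : Set Rhombus} (hx : IsTiling x) (p : Pt) : ∃ r ∈ x, p ∈ r.support := by
  have : p ∈ ⋃ r ∈ x, r.support := by rw [hx.2.1]; trivial
  obtain ⟨r, hr, h⟩ := mem_iUnion₂.1 this
  exact ⟨r, hr, h⟩

def SV (r s : Rhombus) : Prop := ∃ v, v ∈ r.vertices ∧ v ∈ s.vertices

theorem SV.symm {r s : Rhombus} (h : SV r s) : SV s r := by obtain ⟨v, a, b⟩ := h; exact ⟨v, b, a⟩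

theorem SV.refl (r : Rhombus) : SV r r := ⟨_, Par.base.vertex, Par.base.vertex⟩

/-- tiles of `x` sharing a vertex with `r` -/
def corona (x : Set Rhombus) (r : Rhombus) : Set Rhombus := {s | s ∈ x ∧ SV r s}

theorem corona_delta (hval : ∀ i, (shapes i).IsValid) {x : Set Rhombus}
    (hx : IsTilingOn (range shapes) x) {r : Rhombus} (hr : r ∈ x) :
    ∃ δ > 0, ∀ p ∈ r.support, ∃ v ∈ r.vertices,
      ball p δ ⊆ (⋃ s ∈ corona x r, s.support) ∧
      ∀ s ∈ corona x r, ∀ q ∈ s.support, dist q p < δ → v ∈ s.vertices := by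
  choose δ hδ h using local_star hval hx
  obtain ⟨ε, hε, hl⟩ := lebesgue_number_lemma_of_metric (c := fun p : r.support => ball p.1 (δ p.1))
    (support_compact r) (fun _ => isOpen_ball)
    (fun p hp => mem_iUnion.2 ⟨⟨p, hp⟩, mem_ball_self (hδ p)⟩)
  refine ⟨ε, hε, fun p hp => ?_⟩
  obtain ⟨⟨p', hp'⟩, hb⟩ := hl p hp
  obtain ⟨v, hv, hs⟩ := star_vertex hx.1 hr hp'
  refine ⟨v, hv, fun q hq => ?_, fun s hs' q hq hd => ?_⟩
  · obtain ⟨s, hs', hqs⟩ := covers hx.1 q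
    refine mem_iUnion₂.2 ⟨s, ⟨hs', v, hv, hs s hs' ?_⟩, hqs⟩
    exact h p' s hs' q hqs (hb hq)
  · exact hs s hs'.1 (h p' s hs'.1 q hq (hb hd))

theorem translate_support (r : Rhombus) (w p : Pt) :
    p ∈ (r.translate w).support ↔ p - w ∈ r.support := by
  simp only [Rhombus.support, Rhombus.translate, mem_ofPred_eq]
  constructor
  · rintro ⟨s, t, hs, ht, rfl⟩; exact ⟨s, t, hs, ht, by abel⟩
  · rintro ⟨s, t, hs, ht, h⟩; exact ⟨s, t, hs, ht, by rw [← sub_add_cancel p w, h]; abel⟩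

theorem translate_par {r : Rhombus} {q c d : Pt} (h : Par r q c d) (w : Pt) :
    Par (r.translate w) (q + w) c d := by
  induction h with
  | base => exact Par.base
  | swap _ ih => exact ih.swap
  | @flip q c d _ ih => rw [add_right_comm]; exact ih.flip

theorem translate_vertices (r : Rhombus) (w p : Pt) :
    p ∈ (r.translate w).vertices ↔ p - w ∈ r.vertices := by
  rw [(translate_par (Par.base (r := r)) w).vertices_eq, Rhombus.vertices]
  simp only [mem_insert_iff, mem_singleton_iff, sub_eq_iff_eq_add]
  simp only [add_right_comm]

theorem translate_translate (r : Rhombus) (w w' : Pt) :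
    (r.translate w).translate w' = r.translate (w + w') := by
  simp [Rhombus.translate, add_assoc]

theorem translate_zero (r : Rhombus) : r.translate 0 = r := by simp [Rhombus.translate]

theorem translate_SV {r s : Rhombus} (w : Pt) : SV (r.translate w) (s.translate w) ↔ SV r s := by
  simp only [SV, translate_vertices]
  constructor
  · rintro ⟨v, h⟩; exact ⟨_, h⟩
  · rintro ⟨v, h⟩; exact ⟨v + w, by simpa using h⟩

theorem mem_translatePatch {x : Set Rhombus} {w : Pt} {r : Rhombus} :
    r ∈ translatePatch x w ↔ r.translate (-w) ∈ x := by
  simp only [translatePatch, mem_image]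
  constructor
  · rintro ⟨s, hs, rfl⟩; rw [translate_translate, add_neg_cancel, translate_zero]; exact hs
  · intro h; exact ⟨_, h, by rw [translate_translate, neg_add_cancel, translate_zero]⟩

theorem edge_pair_translate {r s : Rhombus} (w : Pt) (h : EdgeToEdgePair r s) :
    EdgeToEdgePair (r.translate w) (s.translate w) := by
  rcases h with h | ⟨p, h1, h2, h3⟩ | ⟨e, h1, h2, h3⟩
  · left
    ext p
    have := Set.ext_iff.1 h (p - w)
    simpa [translate_support] using this
  · right; left
    refine ⟨p + w, by rw [translate_vertices]; simpa using h1, by rw [translate_vertices]; simpa using h2, ?_⟩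
    ext q
    have := Set.ext_iff.1 h3 (q - w)
    simpa [translate_support, sub_eq_iff_eq_add] using this
  · right; right
    obtain ⟨q, c, d, d', ha, hb, rfl⟩ := common_edge h1 h2
    refine ⟨_, (translate_par ha w).edge_mem, (translate_par hb w).edge_mem, ?_⟩
    ext p
    have := Set.ext_iff.1 h3 (p - w)
    simp only [mem_inter_iff, translate_support, mem_edge] at this ⊢
    rw [this]
    constructor
    · rintro ⟨t, ht, e⟩; exact ⟨t, ht, by rw [← sub_add_cancel p w, e]; abel⟩
    · rintro ⟨t, ht, e⟩; exact ⟨t, ht, by rw [e]; abel⟩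

theorem tiling_translate {T : Set Rhombus} {x : Set Rhombus} (hx : IsTilingOn T x) (w : Pt) :
    IsTilingOn T (translatePatch x w) := by
  refine ⟨⟨?_, ?_, ?_⟩, ?_⟩
  · rintro _ ⟨r, hr, rfl⟩; exact hx.1.1 r hr
  · rw [eq_univ_iff_forall]
    intro p
    obtain ⟨r, hr, h⟩ := covers hx.1 (p - w)
    exact mem_iUnion₂.2 ⟨r.translate w, ⟨r, hr, rfl⟩, (translate_support r w p).2 h⟩
  · rintro _ ⟨r, hr, rfl⟩ _ ⟨s, hs, rfl⟩ hne
    exact edge_pair_translate w (hx.1.2.2 r hr s hs fun e => hne (by rw [e]))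
  · rintro _ ⟨r, hr, rfl⟩
    exact hx.2 r hr

/-- all rhombi on the shapes sharing a vertex with `r` -/
def Rel (shapes : Fin k → Rhombus) (r : Rhombus) : Set Rhombus :=
  {s | (∃ i, s.u = (shapes i).u ∧ s.v = (shapes i).v) ∧ SV r s}

theorem vertices_finite (r : Rhombus) : r.vertices.Finite := by
  unfold Rhombus.vertices; exact Set.toFinite _

theorem rel_finite (r : Rhombus) : (Rel shapes r).Finite := by
  have : (⋃ i : Fin k, ⋃ v ∈ r.vertices, (fun o : Pt => (⟨v - o, (shapes i).u, (shapes i).v⟩ : Rhombus)) ''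
      {0, (shapes i).u, (shapes i).v, (shapes i).u + (shapes i).v}).Finite := by
    refine Set.finite_iUnion fun i => ?_
    refine (vertices_finite r).biUnion fun v _ => ?_
    exact (Set.toFinite _).image _
  refine this.subset ?_
  rintro s ⟨⟨i, hu, hv⟩, v, h1, h2⟩
  refine mem_iUnion.2 ⟨i, mem_iUnion₂.2 ⟨v, h1, ?_⟩⟩
  obtain ⟨p, u, w⟩ := s
  simp only at hu hv
  subst hu hv
  simp only [Rhombus.vertices, mem_insert_iff, mem_singleton_iff] at h2
  rcases h2 with h | h | h | h
  · exact ⟨0, by simp, by simp [h]⟩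
  · exact ⟨(shapes i).u, by simp, by simp [h]⟩
  · exact ⟨(shapes i).v, by simp, by simp [h]⟩
  · refine ⟨(shapes i).u + (shapes i).v, by simp, ?_⟩
    simp [h, add_assoc]

theorem corona_sub {x : Set Rhombus} (hx : IsTilingOn (range shapes) x) (r : Rhombus) :
    corona x r ⊆ Rel shapes r := fun _ hs => ⟨shape_of hx hs.1, hs.2⟩

/-- uniform local structure -/
theorem uniform_star (hval : ∀ i, (shapes i).IsValid) : ∃ ε > 0, ∀ x, IsTilingOn (range shapes) x →
    ∀ p : Pt, ∃ v : Pt, ∀ r ∈ x, ∀ q ∈ r.support, dist q p < ε → v ∈ r.vertices := by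
  have key : ∀ᶠ ε in nhdsWithin (0 : ℝ) (Ioi 0), ∀ i : Fin k, ∀ C ∈ {C | C ⊆ Rel shapes (shapes i)},
      ∀ x, IsTilingOn (range shapes) x → shapes i ∈ x → corona x (shapes i) = C →
      ∀ p ∈ (shapes i).support, ∃ v : Pt, ∀ r ∈ x, ∀ q ∈ r.support, dist q p < ε → v ∈ r.vertices := by
    rw [Filter.eventually_all]
    intro i
    rw [Filter.eventually_all_finite (Set.Finite.finite_subsets (rel_finite _))]
    intro C hC
    by_cases hex : ∃ x, IsTilingOn (range shapes) x ∧ shapes i ∈ x ∧ corona x (shapes i) = C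
    · obtain ⟨x, hx, hr, rfl⟩ := hex
      obtain ⟨δ, hδ, h⟩ := corona_delta hval hx hr
      filter_upwards [Ioo_mem_nhdsGT hδ] with ε hε y hy hry hc p hp
      obtain ⟨v, hv, hb, hs⟩ := h p hp
      refine ⟨v, fun r hr' q hq hd => ?_⟩
      obtain ⟨z, hz, hzd⟩ := inter_near hq (sub_pos.2 hd)
      have hzb : z ∈ ball p δ := by
        rw [mem_ball]
        have := dist_triangle z q p
        have := hε.2
        linarith
      obtain ⟨t, ht, hzt⟩ := mem_iUnion₂.1 (hb hzb)
      have ht' := ht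
      rw [← hc] at ht
      have := inter_unique hy.1 hr' ht.1 hz hzt
      subst this
      exact hs r ht' q hq (hd.trans hε.2)
    · filter_upwards with ε y hy hry hc
      exact absurd ⟨y, hy, hry, hc⟩ hex
  obtain ⟨ε, h1, h2⟩ := (key.and self_mem_nhdsWithin).exists
  refine ⟨ε, h2, fun x hx p => ?_⟩
  obtain ⟨r, hr, hp⟩ := covers hx.1 p
  obtain ⟨i, hu, hv⟩ := shape_of hx hr
  set w := (shapes i).pos - r.pos with hw
  have e : shapes i = r.translate w := by
    cases hsi : shapes i with
    | mk a b c =>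
      rw [hsi] at hu hv hw
      simp only [Rhombus.translate, hu, hv, hw, add_sub_cancel]
  obtain ⟨v, hv⟩ := h1 i _ (corona_sub (tiling_translate hx w) _) _ (tiling_translate hx w)
    (by rw [e]; exact ⟨r, hr, rfl⟩) rfl (p + w) (by rw [e, translate_support]; simpa using hp)
  refine ⟨v - w, fun s hs q hq hd => ?_⟩
  have := hv (s.translate w) ⟨s, hs, rfl⟩ (q + w) (by rw [translate_support]; simpa using hq)
    (by simpa using hd)
  rwa [translate_vertices] at this

/-- propagation along vertex adjacency -/
theorem connected (hval : ∀ i, (shapes i).IsValid) {x : Set Rhombus}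
    (hx : IsTilingOn (range shapes) x) (Φ : Rhombus → Prop)
    (hstep : ∀ r ∈ x, ∀ s ∈ x, SV r s → Φ r → Φ s) {r0 : Rhombus} (h0 : r0 ∈ x) (hΦ : Φ r0) :
    ∀ r ∈ x, Φ r := by
  obtain ⟨ε, hε, hL⟩ := uniform_star hval
  let A : Set Pt := {p | ∃ r ∈ x, p ∈ r.support ∧ Φ r}
  have step : ∀ p q, dist p q < ε → p ∈ A → ∀ s ∈ x, q ∈ s.support → Φ s := by
    rintro p q hd ⟨r, hr, hp, hr'⟩ s hs hq
    obtain ⟨v, hv⟩ := hL x hx q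
    exact hstep r hr s hs ⟨v, hv r hr p hp hd, hv s hs q hq (by simpa using hε)⟩ hr'
  have step' : ∀ p q, dist p q < ε → p ∈ A → q ∈ A := by
    intro p q hd hp
    obtain ⟨s, hs, hq⟩ := covers hx.1 q
    exact ⟨s, hs, hq, step p q hd hp s hs hq⟩
  have hop : IsOpen A := by
    rw [Metric.isOpen_iff]
    exact fun p hp => ⟨ε, hε, fun q hq => step' p q (by rw [dist_comm]; exact hq) hp⟩
  have hcl : IsClosed A := by
    rw [← isOpen_compl_iff, Metric.isOpen_iff]
    exact fun p hp => ⟨ε, hε, fun q hq hqA => hp (step' q p hq hqA)⟩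
  have huniv : A = univ := IsClopen.eq_univ ⟨hcl, hop⟩ ⟨r0.center, r0, h0, center_mem r0, hΦ⟩
  intro r hr
  exact step r.center r.center (by simpa using hε) (by rw [huniv]; trivial) r hr (center_mem r)

end fin
end Geo
end

open Set Metric
section

namespace Geo

open Classical in
/-- signed multiplicity of the direction `w` in the edge vector `e` -/
def sg (w e : Pt) : ℤ := if e = w then 1 else if e = -w then -1 else 0

theorem sg_self (w : Pt) : sg w w = 1 := by simp [sg]

theorem ne_neg_of {w : Pt} (hw : w ≠ 0) : w ≠ -w := by
  intro h
  have : (2 : ℝ) • w = 0 := by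
    rw [two_smul]; nth_rewrite 1 [h]; simp
  exact hw ((smul_eq_zero.1 this).resolve_left (by norm_num))

theorem sg_neg {w : Pt} (hw : w ≠ 0) (e : Pt) : sg w (-e) = - sg w e := by
  unfold sg
  by_cases h1 : e = w
  · subst h1; simp [(ne_neg_of hw).symm]
  · by_cases h2 : e = -w
    · subst h2; simp [(ne_neg_of hw).symm]
    · have : -e ≠ w := fun h => h2 (by rw [← h, neg_neg])
      simp [h1, h2, this]

theorem sg_eq_zero {w e : Pt} (h : dt w e ≠ 0) : sg w e = 0 := by
  unfold sg
  rw [if_neg, if_neg]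
  · rintro rfl; apply h; rw [dt_neg_right, dt_self, neg_zero]
  · rintro rfl; exact h (dt_self _)

theorem sg_bound (w e : Pt) : |(sg w e : ℝ)| ≤ 1 := by
  unfold sg; split_ifs <;> simp

/-- the linear height increment on a tile -/
def lam (w : Pt) (r : Rhombus) (z : Pt) : ℝ :=
  sg w r.u * (dt z r.v / dt r.u r.v) + sg w r.v * (dt r.u z / dt r.u r.v)

theorem lam_add (w : Pt) (r : Rhombus) (y z : Pt) : lam w r (y + z) = lam w r y + lam w r z := by
  simp only [lam, dt_add_left, dt_add_right]; ring

theorem lam_smul (w : Pt) (r : Rhombus) (t : ℝ) (z : Pt) : lam w r (t • z) = t * lam w r z := by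
  simp only [lam, dt_smul_left, dt_smul_right]; ring

theorem lam_neg (w : Pt) (r : Rhombus) (z : Pt) : lam w r (-z) = - lam w r z := by
  simp only [lam, dt_neg_left, dt_neg_right]; ring

theorem lam_sub (w : Pt) (r : Rhombus) (y z : Pt) : lam w r (y - z) = lam w r y - lam w r z := by
  rw [sub_eq_add_neg, lam_add, lam_neg]; ring

theorem lam_zero (w : Pt) (r : Rhombus) : lam w r 0 = 0 := by
  have := lam_smul w r 0 0
  simpa using this

theorem lam_par {w : Pt} (hw : w ≠ 0) {r : Rhombus} (hv : r.IsValid) {q c d : Pt} (h : Par r q c d) :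
    lam w r c = sg w c ∧ lam w r d = sg w d := by
  induction h with
  | base =>
    have := dt_ne_of_valid hv
    constructor
    · simp only [lam, dt_self]; field_simp; ring
    · simp only [lam, dt_self]; field_simp; ring
  | swap _ ih => exact ⟨ih.2, ih.1⟩
  | flip _ ih =>
    refine ⟨?_, ih.2⟩
    rw [lam_neg, ih.1, sg_neg hw]; push_cast; ring

theorem lam_agree {w : Pt} (hw : w ≠ 0) {x : Set Rhombus} (hx : IsTiling x) {r s : Rhombus} (hr : r ∈ x)
    (hs : s ∈ x) {p p' : Pt} (h1 : p ∈ r.support) (h2 : p ∈ s.support) (h1' : p' ∈ r.support)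
    (h2' : p' ∈ s.support) : lam w r (p - p') = lam w s (p - p') := by
  by_cases hne : r = s
  · rw [hne]
  have m : p ∈ r.support ∩ s.support := ⟨h1, h2⟩
  have m' : p' ∈ r.support ∩ s.support := ⟨h1', h2'⟩
  rcases meet hx hr hs hne h1 h2 with ⟨-, -, h⟩ | ⟨q, c, d, d', ha, hb, h⟩
  · rw [h, mem_singleton_iff] at m'
    rw [m', sub_self, lam_zero, lam_zero]
  · rw [h] at m m'
    obtain ⟨t, _, e⟩ := mem_edge.1 m
    obtain ⟨t', _, e'⟩ := mem_edge.1 m'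
    have : p - p' = (t - t') • c := by rw [e, e']; module
    rw [this, lam_smul, lam_smul, (lam_par hw (hx.1 r hr) ha).1, (lam_par hw (hx.1 s hs) hb).1]

theorem lam_bound {w : Pt} (hw : w ≠ 0) {r : Rhombus} (hv : r.IsValid) {p v : Pt}
    (hp : p ∈ r.support) (hvv : v ∈ r.vertices) : |lam w r (p - v)| ≤ 2 := by
  obtain ⟨c, d, h⟩ := Par.of_vertex hvv
  obtain ⟨s, t, hs, ht, rfl⟩ := h.mem_support.1 hp
  have : v + s • c + t • d - v = s • c + t • d := by abel
  rw [this, lam_add, lam_smul, lam_smul, (lam_par hw hv h).1, (lam_par hw hv h).2]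
  refine (abs_add_le _ _).trans ?_
  rw [abs_mul, abs_mul, abs_of_nonneg hs.1, abs_of_nonneg ht.1]
  have := sg_bound w c
  have := sg_bound w d
  nlinarith [hs.1, hs.2, ht.1, ht.2, abs_nonneg (sg w c : ℝ), abs_nonneg (sg w d : ℝ)]

theorem support_convex (r : Rhombus) : Convex ℝ r.support := by
  rintro _ ⟨s, t, hs, ht, rfl⟩ _ ⟨s', t', hs', ht', rfl⟩ α β hα hβ hαβ
  refine ⟨α * s + β * s', α * t + β * t', ?_, ?_, ?_⟩
  · exact convex_Icc (0 : ℝ) 1 hs hs' hα hβ hαβ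
  · exact convex_Icc (0 : ℝ) 1 ht ht' hα hβ hαβ
  · obtain rfl : β = 1 - α := by linarith
    module

/-- subdivision of a segment -/
theorem subdivide {η : ℝ} (hη : 0 < η) (p q : Pt) :
    ∃ N : ℕ, 0 < N ∧ (N : ℝ) ≤ dist p q / η + 2 ∧ ∀ j : ℕ,
      dist (p + ((j : ℝ) / N) • (q - p)) (p + (((j + 1 : ℕ) : ℝ) / N) • (q - p)) < η := by
  refine ⟨⌊dist p q / η⌋₊ + 1, by omega, ?_, fun j => ?_⟩
  · push_cast
    have := Nat.floor_le (show 0 ≤ dist p q / η by positivity)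
    linarith
  · rw [dist_add_left]
    have h := Nat.lt_floor_add_one (dist p q / η)
    set M : ℝ := ((⌊dist p q / η⌋₊ + 1 : ℕ) : ℝ) with hM
    have hM' : dist p q / η < M := by rw [hM]; push_cast; exact h
    have hM0 : 0 < M := lt_of_le_of_lt (by positivity) hM'
    rw [dist_eq_norm, ← sub_smul, norm_smul]
    have : (j : ℝ) / M - ((j + 1 : ℕ) : ℝ) / M = -(1 / M) := by push_cast; field_simp; ring
    rw [this, norm_neg, Real.norm_of_nonneg (by positivity), ← dist_eq_norm, dist_comm q p]
    rw [div_lt_iff₀ hη] at hM'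
    rw [div_mul_eq_mul_div, div_lt_iff₀ hM0]
    linarith

/-- height functions -/
structure Height (x : Set Rhombus) (w : Pt) (H : Pt → ℝ) : Prop where
  tile : ∀ s ∈ x, ∀ p ∈ s.support, ∀ q ∈ s.support, H q - H p = lam w s (q - p)
  int : ∀ s ∈ x, ∀ v ∈ s.vertices, ∃ n : ℤ, H v = n
  bound : ∃ C : ℝ, 0 ≤ C ∧ ∀ p, |H p| ≤ C * (‖p‖ + 1)

variable {k : ℕ} {shapes : Fin k → Rhombus}

theorem exists_height (hval : ∀ i, (shapes i).IsValid) {x : Set Rhombus}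
    (hx : IsTilingOn (range shapes) x) {w : Pt} (hw : w ≠ 0) : ∃ H, Height x w H := by
  obtain ⟨ε, hε, hL⟩ := uniform_star hval
  let C : Pt → Pt → ℝ → Prop := fun p q y => ∃ r ∈ x, ∃ s ∈ x, p ∈ r.support ∧ q ∈ s.support ∧
    ∃ v, v ∈ r.vertices ∧ v ∈ s.vertices ∧ y = lam w s (q - v) - lam w r (p - v)
  have K : ∀ p0 v0, (∀ r ∈ x, ∀ q ∈ r.support, dist q p0 < ε → v0 ∈ r.vertices) →
      ∀ p q y, dist p p0 < ε → dist q p0 < ε → C p q y → ∀ r ∈ x, ∀ s ∈ x, p ∈ r.support →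
      q ∈ s.support → y = lam w s (q - v0) - lam w r (p - v0) := by
    rintro p0 v0 h p q y hp hq ⟨r', hr', s', hs', hpr', hqs', v, hvr, hvs, rfl⟩ r hr s hs hpr hqs
    have e1 : lam w s' (q - v) = lam w s' (q - v0) + lam w s' (v0 - v) := by
      rw [← lam_add]; congr 1; abel
    have e2 : lam w r' (p - v) = lam w r' (p - v0) + lam w r' (v0 - v) := by
      rw [← lam_add]; congr 1; abel
    have v0r' := h r' hr' p hpr' hp
    have v0s' := h s' hs' q hqs' hq
    have v0r := h r hr p hpr hp
    have v0s := h s hs q hqs hq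
    have e3 : lam w s' (v0 - v) = lam w r' (v0 - v) :=
      lam_agree hw hx.1 hs' hr' (vertices_subset _ v0s') (vertices_subset _ v0r')
        (vertices_subset _ hvs) (vertices_subset _ hvr)
    have e4 : lam w s' (q - v0) = lam w s (q - v0) :=
      lam_agree hw hx.1 hs' hs hqs' hqs (vertices_subset _ v0s') (vertices_subset _ v0s)
    have e5 : lam w r' (p - v0) = lam w r (p - v0) :=
      lam_agree hw hx.1 hr' hr hpr' hpr (vertices_subset _ v0r') (vertices_subset _ v0r)
    rw [e1, e2, e3, e4, e5]; ring
  have ex : ∀ p q, dist p q < ε → ∃ y, C p q y := by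
    intro p q h
    obtain ⟨r, hr, hp⟩ := covers hx.1 p
    obtain ⟨s, hs, hq⟩ := covers hx.1 q
    obtain ⟨v, hv⟩ := hL x hx q
    exact ⟨_, r, hr, s, hs, hp, hq, v, hv r hr p hp h, hv s hs q hq (by simpa using hε), rfl⟩
  classical
  let c : Pt → Pt → ℝ := fun p q => if h : ∃ y, C p q y then h.choose else 0
  have hc : ∀ p q, dist p q < ε → C p q (c p q) := by
    intro p q h
    have := ex p q h
    simp only [c, dif_pos this]
    exact this.choose_spec
  obtain ⟨S, hS1, -, hS2⟩ := monodromy (Z := Pt × ℝ) (fun z => z.1) (fun z q => (q, z.2 + c z.1 q)) hε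
    (fun z q _ => rfl)
    (by
      intro z
      obtain ⟨v, hv⟩ := hL x hx z.1
      obtain ⟨r, hr, hp⟩ := covers hx.1 z.1
      have := K z.1 v hv z.1 z.1 _ (by simpa using hε) (by simpa using hε) (hc z.1 z.1 (by simpa using hε))
        r hr r hr hp hp
      rw [sub_self] at this
      simp [this])
    (by
      intro z q q' h1 h2 h3
      simp only [Prod.mk.injEq, true_and]
      obtain ⟨v, hv⟩ := hL x hx z.1
      obtain ⟨r, hr, hp⟩ := covers hx.1 z.1
      obtain ⟨s, hs, hq⟩ := covers hx.1 q
      obtain ⟨t, ht, hq'⟩ := covers hx.1 q'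
      have z0 : dist z.1 z.1 < ε := by simpa using hε
      have h1' := h1; have h2' := h2
      rw [dist_comm] at h1' h2'
      rw [K z.1 v hv z.1 q _ z0 h1' (hc _ _ h1) r hr s hs hp hq,
        K z.1 v hv q q' _ h1' h2' (hc _ _ h3) s hs t ht hq hq',
        K z.1 v hv z.1 q' _ z0 h2' (hc _ _ h2) r hr t ht hp hq']
      ring) ((0 : Pt), (0 : ℝ))
  let H : Pt → ℝ := fun p => (S p).2
  have hH : ∀ p q, dist p q < ε / 4 → H q = H p + c p q := by
    intro p q h
    have := congrArg Prod.snd (hS2 p q h)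
    simp only [hS1 p] at this
    exact this.symm
  have hη : 0 < ε / 4 := by positivity
  have htile0 : ∀ s ∈ x, ∀ p ∈ s.support, ∀ q ∈ s.support, dist p q < ε / 4 →
      H q - H p = lam w s (q - p) := by
    intro s hs p hp q hq h
    rw [hH p q h]
    have h' : dist p q < ε := by linarith
    obtain ⟨v, hv⟩ := hL x hx p
    rw [K p v hv p q _ (by simpa using hε) (by rw [dist_comm]; exact h') (hc p q h') s hs s hs hp hq]
    rw [add_sub_cancel_left, ← lam_sub]
    congr 1; abel
  have htile : ∀ s ∈ x, ∀ p ∈ s.support, ∀ q ∈ s.support, H q - H p = lam w s (q - p) := by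
    intro s hs p hp q hq
    obtain ⟨N, hN, -, hd⟩ := subdivide hη p q
    have hN' : (0 : ℝ) < N := by exact_mod_cast hN
    have hmem : ∀ j : ℕ, j ≤ N → p + ((j : ℝ) / N) • (q - p) ∈ s.support := by
      intro j hj
      apply (support_convex s).add_smul_sub_mem hp hq
      constructor
      · positivity
      · rw [div_le_one hN']; exact_mod_cast hj
    have ind : ∀ j : ℕ, j ≤ N → H (p + ((j : ℝ) / N) • (q - p)) - H p = (j : ℝ) / N * lam w s (q - p) := by
      intro j
      induction j with
      | zero => simp
      | succ j ih =>
        intro hj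
        have e1 := ih (by omega)
        have e2 := htile0 s hs _ (hmem j (by omega)) _ (hmem (j + 1) hj) (hd j)
        have e3 : p + (((j + 1 : ℕ) : ℝ) / N) • (q - p) - (p + ((j : ℝ) / N) • (q - p))
            = (1 / (N : ℝ)) • (q - p) := by
          rw [add_sub_add_left_eq_sub, ← sub_smul]; congr 1; push_cast; ring
        rw [e3, lam_smul] at e2
        push_cast at e2 ⊢
        linear_combination e1 + e2
    have := ind N le_rfl
    rw [div_self hN'.ne', one_smul, add_sub_cancel] at this
    linarith
  have hcb : ∀ p q, dist p q < ε / 4 → |H q - H p| ≤ 4 := by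
    intro p q h
    rw [hH p q h]
    obtain ⟨r, hr, s, hs, hp, hq, v, hvr, hvs, e⟩ := hc p q (by linarith)
    rw [add_sub_cancel_left, e]
    have := lam_bound hw (hx.1.1 s hs) hq hvs
    have := lam_bound hw (hx.1.1 r hr) hp hvr
    have := abs_sub (lam w s (q - v)) (lam w r (p - v))
    linarith
  have hbound : ∀ p q, |H q - H p| ≤ 4 * (dist p q / (ε / 4) + 2) := by
    intro p q
    obtain ⟨N, hN, hNb, hd⟩ := subdivide hη p q
    have hN' : (0 : ℝ) < N := by exact_mod_cast hN
    have ind : ∀ j : ℕ, |H (p + ((j : ℝ) / N) • (q - p)) - H p| ≤ 4 * j := by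
      intro j
      induction j with
      | zero => simp
      | succ j ih =>
        have := hcb _ _ (hd j)
        have h2 := abs_sub_le (H (p + (((j + 1 : ℕ) : ℝ) / N) • (q - p))) (H (p + ((j : ℝ) / N) • (q - p))) (H p)
        push_cast at *
        linarith
    have := ind N
    rw [div_self hN'.ne', one_smul, add_sub_cancel] at this
    linarith
  obtain ⟨r0, hr0, -⟩ := covers hx.1 0
  refine ⟨fun p => H p - H r0.pos, ⟨fun s hs p hp q hq => ?_, ?_, ?_⟩⟩
  · rw [← htile s hs p hp q hq]; ring
  · have vstep : ∀ s ∈ x, ∀ v ∈ s.vertices, ∀ v' ∈ s.vertices, ∃ n : ℤ, H v' - H v = n := by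
      intro s hs v hv v' hv'
      have e := htile s hs v (vertices_subset _ hv) v' (vertices_subset _ hv')
      obtain ⟨c, d, h⟩ := Par.of_vertex hv
      rw [h.vertices_eq] at hv'
      have l := lam_par hw (hx.1.1 s hs) h
      rw [e]
      rcases hv' with rfl | rfl | rfl | rfl
      · exact ⟨0, by rw [sub_self, lam_zero]; simp⟩
      · exact ⟨sg w c, by rw [add_sub_cancel_left, l.1]⟩
      · exact ⟨sg w d, by rw [add_sub_cancel_left, l.2]⟩
      · exact ⟨sg w c + sg w d, by rw [add_assoc, add_sub_cancel_left, lam_add, l.1, l.2]; push_cast; ring⟩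
    refine connected hval hx (fun s => ∀ v ∈ s.vertices, ∃ n : ℤ, H v - H r0.pos = n) ?_ hr0 ?_
    · rintro r hr s hs ⟨v, hvr, hvs⟩ h v' hv'
      obtain ⟨n, hn⟩ := h v hvr
      obtain ⟨m, hm⟩ := vstep s hs v hvs v' hv'
      exact ⟨n + m, by push_cast; linarith⟩
    · intro v hv
      exact vstep r0 hr0 _ Par.base.vertex v hv
  · refine ⟨4 * (1 / (ε / 4) * (1 + ‖r0.pos‖) + 2), by positivity, fun p => ?_⟩
    refine (hbound r0.pos p).trans ?_
    have h1 : dist r0.pos p ≤ ‖r0.pos‖ + ‖p‖ := by rw [dist_eq_norm]; exact norm_sub_le _ _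
    have h2 : dist r0.pos p ≤ (1 + ‖r0.pos‖) * (‖p‖ + 1) := by
      nlinarith [norm_nonneg p, norm_nonneg r0.pos]
    have h3 : dist r0.pos p / (ε / 4) ≤ 1 / (ε / 4) * ((1 + ‖r0.pos‖) * (‖p‖ + 1)) := by
      rw [div_eq_inv_mul, one_div]
      gcongr
    nlinarith [norm_nonneg p]

end Geo
end

open Set Metric
section

namespace Geo

theorem local_mono {f : ℝ → ℝ} (h : ∀ t, ∃ δ > 0, ∀ t', |t' - t| < δ →
    (t ≤ t' → f t ≤ f t') ∧ (t' ≤ t → f t' ≤ f t)) : Monotone f := by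
  intro a b hab
  let S := {t | t ∈ Icc a b ∧ f a ≤ f t}
  have hS : S.Nonempty := ⟨a, ⟨le_rfl, hab⟩, le_rfl⟩
  have hb : BddAbove S := ⟨b, fun t ht => ht.1.2⟩
  set c := sSup S with hc
  obtain ⟨δ, hδ, hl⟩ := h c
  have hca : a ≤ c := le_csSup hb ⟨⟨le_rfl, hab⟩, le_rfl⟩
  have hcb : c ≤ b := csSup_le hS fun t ht => ht.1.2
  obtain ⟨t, ht, htc⟩ := exists_lt_of_lt_csSup hS (show c - δ < sSup S by rw [← hc]; linarith)
  have htc' : t ≤ c := le_csSup hb ht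
  have hfc : f a ≤ f c := ht.2.trans ((hl t (by rw [abs_lt]; constructor <;> linarith)).2 htc')
  rcases eq_or_lt_of_le hcb with e | hlt
  · rw [← e]; exact hfc
  · exfalso
    have h1 : c < min b (c + δ / 2) := lt_min hlt (by linarith)
    have h2 : min b (c + δ / 2) ≤ c + δ / 2 := min_le_right _ _
    have h3 := (hl (min b (c + δ / 2)) (by rw [abs_lt]; constructor <;> linarith)).1 h1.le
    have : min b (c + δ / 2) ∈ S := ⟨⟨by linarith, min_le_left _ _⟩, hfc.trans h3⟩
    have := le_csSup hb this
    linarith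

theorem lam_dir {w : Pt} (hw : w ≠ 0) {r : Rhombus} (hv : r.IsValid) : 0 ≤ lam w r w := by
  have l := lam_par hw hv (Par.base (r := r))
  by_cases h1 : r.u = w
  · rw [h1, sg_self] at l; rw [l.1]; norm_num
  by_cases h2 : r.u = -w
  · rw [h2, sg_neg hw, sg_self, lam_neg] at l
    have := l.1; push_cast at this; linarith
  by_cases h3 : r.v = w
  · rw [h3, sg_self] at l; rw [l.2]; norm_num
  by_cases h4 : r.v = -w
  · rw [h4, sg_neg hw, sg_self, lam_neg] at l
    have := l.2; push_cast at this; linarith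
  simp [lam, sg, h1, h2, h3, h4]

variable {k : ℕ} {shapes : Fin k → Rhombus}

theorem mono_line (hval : ∀ i, (shapes i).IsValid) {x : Set Rhombus}
    (hx : IsTilingOn (range shapes) x) {w : Pt} (hw : w ≠ 0) {H : Pt → ℝ} (hH : Height x w H) (p : Pt) :
    Monotone (fun t : ℝ => H (p + t • w)) := by
  apply local_mono
  intro t
  obtain ⟨δ, hδ, hs⟩ := local_star hval hx (p + t • w)
  have hwn : 0 < ‖w‖ := norm_pos_iff.2 hw
  refine ⟨δ / ‖w‖, by positivity, fun t' ht' => ?_⟩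
  obtain ⟨s, hsx, hq⟩ := covers hx.1 (p + t' • w)
  have hp := hs s hsx _ hq (by
    rw [dist_add_left, dist_eq_norm, ← sub_smul, norm_smul, Real.norm_eq_abs]
    rwa [lt_div_iff₀ hwn] at ht')
  have e := hH.tile s hsx _ hp _ hq
  rw [add_sub_add_left_eq_sub, ← sub_smul, lam_smul] at e
  have l := lam_dir hw (hx.1.1 s hsx)
  constructor
  · intro h; nlinarith
  · intro h; nlinarith

/-- `[q, q+a]` is an edge of the tiling -/
def AE (x : Set Rhombus) (a q : Pt) : Prop := ∃ r ∈ x, ∃ d, Par r q a d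

def Step (x : Set Rhombus) (a : Pt) (ω : ℝ) (q q' : Pt) : Prop :=
  ∃ r ∈ x, ∃ d, Par r q a d ∧ 0 < ω * dt a d ∧ q' = q + d

theorem par_vec {r : Rhombus} {q c d : Pt} (h : Par r q c d) :
    c ∈ ({r.u, -r.u, r.v, -r.v} : Set Pt) ∧ d ∈ ({r.u, -r.u, r.v, -r.v} : Set Pt) := by
  induction h with
  | base => simp
  | swap _ ih => exact ⟨ih.2, ih.1⟩
  | @flip q c d _ ih =>
    refine ⟨?_, ih.2⟩
    rcases ih.1 with h | h | h | h <;> rw [h] <;> simp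

theorem mid_mem {r : Rhombus} {q c d : Pt} (h : Par r q c d) {s t : ℝ} (hs : s ∈ Icc (0 : ℝ) 1)
    (ht : t ∈ Icc (0 : ℝ) 1) : q + s • c + t • d ∈ r.support := h.mem_support.2 ⟨s, t, hs, ht, rfl⟩

/-- an edge point (not a vertex) of two different tiles: the full edge is common -/
theorem edge_common {x : Set Rhombus} (hx : IsTiling x) {r s : Rhombus} (hr : r ∈ x) (hs : s ∈ x)
    (hne : r ≠ s) {q c d : Pt} (hP : Par r q c d) {t : ℝ} (ht0 : 0 < t) (ht1 : t < 1)
    (hps : q + t • c ∈ s.support) : ∃ d', Par s q c d' := by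
  have hp : q + t • c ∈ r.support := hP.mem_support.2 ⟨t, 0, ⟨ht0.le, ht1.le⟩, by simp, by simp⟩
  have hd := hP.dt_ne (hx.1 r hr)
  have key : ∀ s' t' : ℝ, q + t • c = q + s' • c + t' • d → t = s' ∧ t' = 0 := by
    intro s' t' e'
    have := coord_unique hd (q := q) (s := t) (t := 0) (s' := s') (t' := t') (by rw [← e']; simp)
    exact ⟨this.1, this.2.symm⟩
  rcases meet hx hr hs hne hp hps with h | ⟨q', c', d1, d', ha, hb, h⟩
  · exfalso
    have hv := h.1
    rw [hP.vertices_eq] at hv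
    rcases hv with h1 | h1 | h1 | h1
    · have := (key 0 0 (by rw [h1]; simp)).1; linarith
    · have := (key 1 0 (by rw [h1]; simp)).1; linarith
    · have := (key 0 1 (by rw [h1]; simp)).1; linarith
    · have := (key 1 1 (by rw [h1]; simp)).1; linarith
  · have hm : q + t • c ∈ r.support ∩ s.support := ⟨hp, hps⟩
    rw [h] at hm
    have he := ha.edge_mem
    rw [hP.edges_eq] at he
    rcases he with h1 | h1 | h1 | h1
    · rcases segment_eq h1 with ⟨e1, e2⟩ | ⟨e1, e2⟩
      · rw [e1] at e2
        have := add_left_cancel e2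
        subst e1 this
        exact ⟨_, hb⟩
      · have := hb.flip
        rw [e2] at this
        have hc : -c' = c := by
          rw [e1] at e2
          have h4 : c + c' = 0 := by
            have : q + (c + c') = q + 0 := by rw [add_zero, ← add_assoc]; exact e2
            exact add_left_cancel this
          exact (eq_neg_of_add_eq_zero_left h4).symm
        rw [hc] at this
        exact ⟨_, this⟩
    · rw [h1] at hm
      obtain ⟨t1, _, e1⟩ := mem_edge.1 hm
      have := (key 0 t1 (by rw [e1]; simp)).1
      linarith
    · rw [h1] at hm
      obtain ⟨t1, _, e1⟩ := mem_edge.1 hm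
      have := (key 1 t1 (by rw [e1]; simp)).1
      linarith
    · rw [show q + c + d = q + d + c by abel] at h1
      rw [h1] at hm
      obtain ⟨t1, _, e1⟩ := mem_edge.1 hm
      have := (key t1 1 (by rw [e1]; module)).2
      norm_num at this

theorem next_tile (hval : ∀ i, (shapes i).IsValid) {x : Set Rhombus}
    (hx : IsTilingOn (range shapes) x) {a q : Pt} (h : AE x a q) {ω : ℝ} (hω : ω ≠ 0) :
    ∃ q', Step x a ω q q' := by
  obtain ⟨r, hr, d, hP⟩ := h
  have hd := hP.dt_ne (hx.1.1 r hr)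
  rcases lt_or_gt_of_ne (mul_ne_zero hω hd) with hneg | hpos
  swap
  · exact ⟨_, r, hr, d, hP, hpos, rfl⟩
  set m := q + (2⁻¹ : ℝ) • a with hm
  obtain ⟨δ, hδ, hs⟩ := local_star hval hx m
  have : ∀ᶠ τ in nhdsWithin (0 : ℝ) (Ioi 0), dist (m + τ • (-d)) (m + (0 : ℝ) • (-d)) < δ := by
    apply Filter.Eventually.filter_mono nhdsWithin_le_nhds
    exact Metric.tendsto_nhds.1 ((show Continuous fun τ : ℝ => m + τ • (-d) by fun_prop).tendsto 0) δ hδ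
  obtain ⟨τ, h1, h2⟩ := (this.and self_mem_nhdsWithin).exists
  have h2 : 0 < τ := h2
  rw [zero_smul, add_zero] at h1
  obtain ⟨s, hsx, hq⟩ := covers hx.1 (m + τ • (-d))
  have hms := hs s hsx _ hq h1
  have hne : r ≠ s := by
    rintro rfl
    obtain ⟨s', t', hs', ht', e⟩ := hP.mem_support.1 hq
    have := coord_unique hd (q := q) (s := 2⁻¹) (t := -τ) (s' := s') (t' := t') (by
      rw [← e, hm]; module)
    linarith [ht'.1, this.2]
  obtain ⟨d', hP'⟩ := edge_common hx.1 hr hsx hne hP (t := 2⁻¹) (by norm_num) (by norm_num) hms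
  refine ⟨_, s, hsx, d', hP', ?_, rfl⟩
  obtain ⟨s', t', hs', ht', e⟩ := hP'.mem_support.1 hq
  have e2 : dt a (m + τ • (-d) - q) = t' * dt a d' := by
    rw [e]
    have : q + s' • a + t' • d' - q = s' • a + t' • d' := by abel
    rw [this, dt_add_right, dt_smul_right, dt_smul_right, dt_self]; ring
  have e3 : dt a (m + τ • (-d) - q) = - τ * dt a d := by
    have : m + τ • (-d) - q = (2⁻¹ : ℝ) • a + (-τ) • d := by rw [hm]; module
    rw [this, dt_add_right, dt_smul_right, dt_smul_right, dt_self]; ring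
  rw [e3] at e2
  have : 0 < t' * (ω * dt a d') := by
    have : t' * (ω * dt a d') = -(τ * (ω * dt a d)) := by linear_combination -ω * e2
    rw [this]; nlinarith
  exact pos_of_mul_pos_right this ht'.1

theorem step_lower {x : Set Rhombus}
    (hx : IsTilingOn (range shapes) x) (a : Pt) (ω : ℝ) : ∃ δ > 0, ∀ r ∈ x, ∀ q d, Par r q a d →
    0 < ω * dt a d → δ ≤ ω * dt a d := by
  have : ∀ᶠ δ in nhdsWithin (0 : ℝ) (Ioi 0), ∀ i : Fin k,
      ∀ d ∈ ({(shapes i).u, -(shapes i).u, (shapes i).v, -(shapes i).v} : Set Pt),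
      0 < ω * dt a d → δ ≤ ω * dt a d := by
    rw [Filter.eventually_all]
    intro i
    rw [Filter.eventually_all_finite (Set.toFinite _)]
    intro d _
    by_cases h : 0 < ω * dt a d
    · filter_upwards [Ioo_mem_nhdsGT h] with δ hδ _ using hδ.2.le
    · filter_upwards with δ h' using absurd h' h
  obtain ⟨δ, h1, h2⟩ := (this.and self_mem_nhdsWithin).exists
  refine ⟨δ, h2, fun r hr q d hP hpos => ?_⟩
  obtain ⟨i, hu, hv⟩ := shape_of hx hr
  exact h1 i d (by rw [← hu, ← hv]; exact (par_vec hP).2) hpos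

theorem step_AE {x : Set Rhombus} {a q q' : Pt} {ω : ℝ} (h : Step x a ω q q') : AE x a q' := by
  obtain ⟨r, hr, d, hP, _, rfl⟩ := h
  exact ⟨r, hr, _, hP.flip2⟩

theorem height_par {x : Set Rhombus} (hx : IsTiling x) {w : Pt} (hw : w ≠ 0) {H : Pt → ℝ}
    (hH : Height x w H) {r : Rhombus} (hr : r ∈ x) {q c d : Pt} (h : Par r q c d) :
    H (q + c) = H q + sg w c := by
  have := hH.tile r hr q (vertices_subset _ h.vertex) (q + c)
    (vertices_subset _ (by rw [h.vertices_eq]; simp))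
  rw [add_sub_cancel_left, (lam_par hw (hx.1 r hr) h).1] at this
  linarith

/-- two `a`-edges of the same height lie on a common chain -/
theorem same_level (hval : ∀ i, (shapes i).IsValid) {x : Set Rhombus}
    (hx : IsTilingOn (range shapes) x) {a : Pt} (ha : a ≠ 0) {H : Pt → ℝ} (hH : Height x a H)
    {ω : ℝ} (hω : ω ≠ 0) {q q' : Pt} (h : AE x a q) (h' : AE x a q') (e : H q = H q')
    (hle : ω * dt a q ≤ ω * dt a q') : Relation.ReflTransGen (Step x a ω) q q' := by
  obtain ⟨δ, hδ, hlow⟩ := step_lower hx a ω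
  have key : ∀ n : ℕ, ∀ q, AE x a q → H q = H q' → ω * dt a q ≤ ω * dt a q' →
      ω * dt a q' - ω * dt a q < n * δ → Relation.ReflTransGen (Step x a ω) q q' := by
    intro n
    induction n with
    | zero => intro q _ _ h1 h2; simp at h2; linarith
    | succ n ih =>
      intro q hq e hle hlt
      obtain ⟨q1, hst⟩ := next_tile hval hx hq hω
      have hst' := hst
      obtain ⟨r, hr, d, hP, hpos, rfl⟩ := hst
      have hl := hlow r hr q d hP hpos
      have hH1 : H (q + d) = H q := by
        rw [height_par hx.1 ha hH hr hP.swap, sg_eq_zero (hP.dt_ne (hx.1.1 r hr))]; simp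
      have hD : ω * dt a (q + d) = ω * dt a q + ω * dt a d := by rw [dt_add_right]; ring
      by_cases hc : ω * dt a (q + d) ≤ ω * dt a q'
      · refine Relation.ReflTransGen.head hst' (ih _ (step_AE hst') (by rw [hH1, e]) hc ?_)
        push_cast at hlt
        linarith
      · push Not at hc
        rw [hD] at hc
        set s : ℝ := (ω * dt a q' - ω * dt a q) / (ω * dt a d) with hs
        have hs0 : 0 ≤ s := div_nonneg (by linarith) hpos.le
        have hs1 : s < 1 := by rw [hs, div_lt_one hpos]; linarith
        set y := q + (2⁻¹ : ℝ) • a + s • d with hy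
        set m := q' + (2⁻¹ : ℝ) • a with hm
        have hyr : y ∈ r.support := mid_mem hP (by constructor <;> norm_num) ⟨hs0, hs1.le⟩
        have htl : ∀ t : ℝ, |t| ≤ 2⁻¹ → H (y + t • a) = H y + t := by
          intro t ht
          rw [abs_le] at ht
          have hz : y + t • a ∈ r.support := by
            have : y + t • a = q + (2⁻¹ + t) • a + s • d := by rw [hy]; module
            rw [this]
            exact mid_mem hP ⟨by linarith, by linarith⟩ ⟨hs0, hs1.le⟩
          have := hH.tile r hr y hyr _ hz
          rw [add_sub_cancel_left, lam_smul, (lam_par ha (hx.1.1 r hr) hP).1, sg_self] at this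
          push_cast at this; linarith
        have hHy : H y = H q + 2⁻¹ := by
          have := hH.tile r hr q (vertices_subset _ hP.vertex) y hyr
          have e2 : y - q = (2⁻¹ : ℝ) • a + s • d := by rw [hy]; abel
          rw [e2, lam_add, lam_smul, lam_smul, (lam_par ha (hx.1.1 r hr) hP).1,
            (lam_par ha (hx.1.1 r hr) hP).2, sg_self, sg_eq_zero (hP.dt_ne (hx.1.1 r hr))] at this
          push_cast at this; linarith
        obtain ⟨r', hr', d', hP'⟩ := h'
        have hmr' : m ∈ r'.support := hP'.mem_support.2 ⟨2⁻¹, 0, by constructor <;> norm_num, by simp, by simp [hm]⟩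
        have hHm : H m = H q' + 2⁻¹ := by
          have := hH.tile r' hr' q' (vertices_subset _ hP'.vertex) m hmr'
          rw [hm, add_sub_cancel_left, lam_smul, (lam_par ha (hx.1.1 r' hr') hP').1, sg_self, ← hm] at this
          push_cast at this; linarith
        -- m is on the line of y
        have hdy : dt a m = dt a y := by
          have : ω * dt a m = ω * dt a y := by
            rw [hm, hy]
            simp only [dt_add_right, dt_smul_right, dt_self, mul_zero, add_zero]
            have : s * (ω * dt a d) = ω * dt a q' - ω * dt a q := by
              rw [hs, div_mul_cancel₀ _ hpos.ne']
            linarith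
          exact mul_left_cancel₀ hω this
        obtain ⟨t, ht⟩ : ∃ t : ℝ, m = y + t • a := by
          have hdd := hP.dt_ne (hx.1.1 r hr)
          have := decomp hdd (m - y)
          rw [dt_sub_right a, hdy, sub_self, zero_div, zero_smul, add_zero] at this
          exact ⟨_, by rw [← this]; abel⟩
        have ht0 : t = 0 := by
          have mono := mono_line hval hx ha hH y
          have hv : H (y + t • a) = H y := by rw [← ht, hHm, hHy, e]
          by_contra hne
          rcases lt_or_gt_of_ne hne with hlt0 | hgt0
          · have h1 := htl (max t (-2⁻¹)) (by
              rw [abs_le]; exact ⟨le_max_right _ _, max_le (by linarith) (by norm_num)⟩)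
            have h2 := mono (le_max_left t (-2⁻¹))
            have h3 : max t (-2⁻¹) < 0 := max_lt hlt0 (by norm_num)
            simp only at h2
            linarith
          · have h1 := htl (min t 2⁻¹) (by
              rw [abs_le]; exact ⟨le_min (by linarith) (by norm_num), min_le_right _ _⟩)
            have h2 := mono (min_le_left t 2⁻¹)
            have h3 : 0 < min t 2⁻¹ := lt_min hgt0 (by norm_num)
            simp only at h2
            linarith
        rw [ht0, zero_smul, add_zero] at ht
        rcases eq_or_lt_of_le hs0 with hs00 | hs00
        · have : q = q' := by
            rw [hm, hy, ← hs00, zero_smul, add_zero] at ht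
            exact (add_right_cancel ht).symm
          rw [this]
        · exfalso
          have hi : Inter r m := by
            rw [ht]
            exact hP.interior_iff.2 ⟨2⁻¹, s, by constructor <;> norm_num, ⟨hs00, hs1⟩, rfl⟩
          have := inter_unique hx.1 hr hr' hi hmr'
          subst this
          exact inter_not_edge (hx.1.1 r hr) hP' (mem_edge.2 ⟨2⁻¹, by constructor <;> norm_num, hm⟩) hi
  obtain ⟨n, hn⟩ := exists_nat_gt ((ω * dt a q' - ω * dt a q) / δ)
  rw [div_lt_iff₀ hδ] at hn
  exact key n q h e hle hn

/-- along a chain, the `b`-height is monotone; unit increments are full tiles -/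
theorem chain_height {x : Set Rhombus} (hx : IsTilingOn (range shapes) x) {a b : Pt} (ha : a ≠ 0) (hb : b ≠ 0)
    (hab : dt a b ≠ 0) {Ha Hb : Pt → ℝ} (hHa : Height x a Ha) (hHb : Height x b Hb)
    {κ : Pt → ℕ}
    (hκ : ∀ r ∈ x, ∀ q d, Par r q a d → d ≠ b → d ≠ -b → κ (q + d) = κ q)
    {q q' : Pt} (h : Relation.ReflTransGen (Step x a (dt a b)) q q') :
    Ha q = Ha q' ∧ Hb q ≤ Hb q' ∧ (Hb q = Hb q' → κ q = κ q') ∧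
    ((∃ r ∈ x, Par r q a b) → Hb q = Hb q' → q = q') ∧
    (∀ m : ℤ, (∃ n : ℤ, Hb q = n) → Hb q ≤ m → m < Hb q' → ∃ r ∈ x, ∃ p, Par r p a b ∧ Ha p = Ha q ∧ Hb p = m) := by
  induction h using Relation.ReflTransGen.head_induction_on with
  | refl => exact ⟨rfl, le_rfl, fun _ => rfl, fun _ _ => rfl, fun m _ h1 h2 => by linarith⟩
  | @head q q1 hst _ ih =>
    obtain ⟨r, hr, d, hP, hpos, rfl⟩ := hst
    obtain ⟨i0, i1, i2, -, i4⟩ := ih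
    have hv := hx.1.1 r hr
    have hH1 : Ha (q + d) = Ha q := by
      rw [height_par hx.1 ha hHa hr hP.swap, sg_eq_zero (hP.dt_ne hv)]; simp
    have hH2 := height_par hx.1 hb hHb hr hP.swap
    have hnb : d ≠ -b := by
      rintro rfl
      rw [dt_neg_right] at hpos
      nlinarith [sq_nonneg (dt a b)]
    have hsb : (d = b ∧ sg b d = 1) ∨ (d ≠ b ∧ sg b d = 0) := by
      by_cases hdb : d = b
      · left; exact ⟨hdb, by rw [hdb, sg_self]⟩
      · right; exact ⟨hdb, by simp [sg, hdb, hnb]⟩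
    refine ⟨by rw [← hH1, i0], ?_, ?_, ?_, ?_⟩
    · rcases hsb with ⟨_, h1⟩ | ⟨_, h1⟩ <;> rw [h1] at hH2 <;> push_cast at hH2 <;> linarith
    · intro e
      rcases hsb with ⟨_, h1⟩ | ⟨h0, h1⟩
      · rw [h1] at hH2; push_cast at hH2; linarith
      · rw [h1] at hH2; push_cast at hH2
        rw [← i2 (by linarith), hκ r hr q d hP h0 hnb]
    · rintro ⟨s, hs, hPs⟩ e
      exfalso
      rcases hsb with ⟨_, h1⟩ | ⟨h0, h1⟩
      · rw [h1] at hH2; push_cast at hH2; linarith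
      · -- the tile on the positive side is unique
        -- a small point q + a/2 + τ b is inside both
        have hd := hP.dt_ne hv
        -- b = α a + β d with β > 0
        set α := dt b d / dt a d with hα
        set β := dt a b / dt a d with hβ
        have hbd : b = α • a + β • d := decomp hd b
        have hβ0 : 0 < β := by
          have : β = dt a b * dt a d / (dt a d) ^ 2 := by rw [hβ]; field_simp
          rw [this]; positivity
        have c1 : Continuous fun τ : ℝ => (2⁻¹ : ℝ) + τ * α := by fun_prop
        have c2 : Continuous fun τ : ℝ => τ * β := by fun_prop
        have ev1 : ∀ᶠ τ in nhdsWithin (0 : ℝ) (Ioi 0), (2⁻¹ : ℝ) + τ * α ∈ Ioo (0 : ℝ) 1 :=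
          Filter.Eventually.filter_mono nhdsWithin_le_nhds
            ((c1.tendsto 0).eventually (isOpen_Ioo.mem_nhds (by constructor <;> norm_num)))
        have ev2 : ∀ᶠ τ in nhdsWithin (0 : ℝ) (Ioi 0), τ * β ∈ Iio (1 : ℝ) :=
          Filter.Eventually.filter_mono nhdsWithin_le_nhds
            ((c2.tendsto 0).eventually (isOpen_Iio.mem_nhds (by simp)))
        obtain ⟨τ, ⟨t1, t2⟩, t3⟩ := ((ev1.and ev2).and (Ioo_mem_nhdsGT (show (0 : ℝ) < 1 by norm_num))).exists
        have heq : q + (2⁻¹ : ℝ) • a + τ • b = q + (2⁻¹ + τ * α) • a + (τ * β) • d := by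
          conv_lhs => rw [hbd]
          module
        have hi : Inter r (q + (2⁻¹ : ℝ) • a + τ • b) := hP.interior_iff.2
          ⟨2⁻¹ + τ * α, τ * β, t1, ⟨mul_pos t3.1 hβ0, t2⟩, heq⟩
        have hrs := inter_unique hx.1 hr hs hi
          (mid_mem hPs (by constructor <;> norm_num) ⟨t3.1.le, t3.2.le⟩)
        subst hrs
        -- q + b ∈ r and q + d is in the frame (a,b)
        apply h0
        have m1 : q + b ∈ r.vertices := by rw [hPs.vertices_eq]; simp
        rw [hP.vertices_eq] at m1
        have m2 : q + a + b ∈ r.vertices := by rw [hPs.vertices_eq]; simp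
        rw [hP.vertices_eq] at m2
        have hne : ∀ s t : ℝ, b = s • a + t • d → s = α ∧ t = β := by
          intro s t e
          exact coord_unique hd (q := 0) (by rw [zero_add, zero_add, ← e, hbd])
        rcases m1 with m1 | m1 | m1 | m1
        · exact absurd (add_eq_left.1 m1) hb
        · exfalso; apply hab; rw [add_left_cancel m1, dt_self]
        · exact (add_left_cancel m1).symm
        · exfalso
          have e1 : b = a + d := by
            have : q + b = q + (a + d) := by rw [m1]; abel
            exact add_left_cancel this
          have e2 := hne 1 1 (by rw [e1]; simp)
          have key2 : ∀ s t : ℝ, q + a + b = q + s • a + t • d → s = 2 := by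
            intro s t e
            have := (coord_unique hd (q := q) (s := 2) (t := 1) (s' := s) (t' := t)
              (by rw [← e, e1]; module)).1
            exact this.symm
          rcases m2 with m2 | m2 | m2 | m2
          · have := key2 0 0 (by rw [m2]; simp); norm_num at this
          · have := key2 1 0 (by rw [m2]; simp); norm_num at this
          · have := key2 0 1 (by rw [m2]; simp); norm_num at this
          · have := key2 1 1 (by rw [m2]; simp); norm_num at this
    · rintro m ⟨n, hn⟩ h1 h2
      rcases hsb with ⟨h0, h3⟩ | ⟨h0, h3⟩
      · rw [h3] at hH2; push_cast at hH2
        by_cases hm : Hb q = m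
        · subst h0; exact ⟨r, hr, q, hP, rfl, hm⟩
        · have hlt : Hb (q + d) ≤ m := by
            rw [hH2, hn]
            rw [hn] at h1 hm
            have a1 : n ≤ m := by exact_mod_cast h1
            have a2 : n ≠ m := by exact_mod_cast hm
            have : n + 1 ≤ m := by omega
            exact_mod_cast this
          obtain ⟨r1, hr1, p, g1, g2, g3⟩ := i4 m ⟨n + 1, by rw [hH2, hn]; push_cast; ring⟩ hlt h2
          exact ⟨r1, hr1, p, g1, by rw [g2, hH1], g3⟩
      · rw [h3] at hH2; push_cast at hH2
        obtain ⟨r1, hr1, p, g1, g2, g3⟩ := i4 m ⟨n, by rw [hH2, hn]; push_cast; ring⟩ (by linarith) h2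
        exact ⟨r1, hr1, p, g1, by rw [g2, hH1], g3⟩

end Geo
end

open Set Metric
section

namespace Geo

/-- in a row- and column-convex set, few points are not the corner of a full `q × q` block -/
theorem bad_count (O : Set (ℤ × ℤ)) (hrow : ∀ n m₁ m m₂ : ℤ, (n, m₁) ∈ O → (n, m₂) ∈ O → m₁ ≤ m → m ≤ m₂ → (n, m) ∈ O)
    (hcol : ∀ m n₁ n n₂ : ℤ, (n₁, m) ∈ O → (n₂, m) ∈ O → n₁ ≤ n → n ≤ n₂ → (n, m) ∈ O)
    (M q : ℕ) (S : Finset (ℤ × ℤ)) (hSO : ∀ p ∈ S, p ∈ O)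
    (hSB : ∀ p ∈ S, |p.1| ≤ M ∧ |p.2| ≤ M)
    (hbad : ∀ p ∈ S, ∃ i j : ℕ, i < q ∧ j < q ∧ (p.1 + i, p.2 + j) ∉ O) :
    S.card ≤ 2 * (2 * M + q + 1) * (q * q) := by
  classical
  let I : Finset ℤ := Finset.Icc (-(M : ℤ)) (M + q)
  have hI : I.card = 2 * M + q + 1 := by
    simp only [I, Int.card_Icc]; omega
  let L : Finset (ℤ × ℤ) := (I ×ˢ I).filter (fun e => e ∈ O ∧ (e.1 + 1, e.2) ∉ O)
  let V : Finset (ℤ × ℤ) := (I ×ˢ I).filter (fun e => e ∈ O ∧ (e.1, e.2 + 1) ∉ O)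
  have hL : L.card ≤ 2 * M + q + 1 := by
    rw [← hI]
    apply Finset.card_le_card_of_injOn Prod.snd
    · intro e he
      simp only [L, Finset.coe_filter, Finset.mem_product, mem_ofPred_eq] at he
      exact he.1.2
    · rintro ⟨n, m⟩ he ⟨n', m'⟩ he' h
      simp only [L, Finset.coe_filter, Finset.mem_product, mem_ofPred_eq] at he he' h
      subst h
      have h1 : ¬ n < n' := fun h => he.2.2 (hcol _ n _ n' he.2.1 he'.2.1 (by omega) (by omega))
      have h2 : ¬ n' < n := fun h => he'.2.2 (hcol _ n' _ n he'.2.1 he.2.1 (by omega) (by omega))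
      have : n = n' := by omega
      rw [this]
  have hV : V.card ≤ 2 * M + q + 1 := by
    rw [← hI]
    apply Finset.card_le_card_of_injOn Prod.fst
    · intro e he
      simp only [V, Finset.coe_filter, Finset.mem_product, mem_ofPred_eq] at he
      exact he.1.1
    · rintro ⟨n, m⟩ he ⟨n', m'⟩ he' h
      simp only [V, Finset.coe_filter, Finset.mem_product, mem_ofPred_eq] at he he' h
      subst h
      have h1 : ¬ m < m' := fun h => he.2.2 (hrow _ m _ m' he.2.1 he'.2.1 (by omega) (by omega))
      have h2 : ¬ m' < m := fun h => he'.2.2 (hrow _ m' _ m he'.2.1 he.2.1 (by omega) (by omega))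
      have : m = m' := by omega
      rw [this]
  let E := L ∪ V
  have hE : E.card ≤ 2 * (2 * M + q + 1) := by
    have := Finset.card_union_le L V
    simp only [E]; omega
  have walk : ∀ (P : ℕ → Prop), P 0 → ∀ i, ¬ P i → ∃ i0 < i, P i0 ∧ ¬ P (i0 + 1) := by
    intro P h0 i
    induction i with
    | zero => intro h; exact absurd h0 h
    | succ i ih =>
      intro h
      by_cases hi : P i
      · exact ⟨i, by omega, hi, h⟩
      · obtain ⟨i0, a, b⟩ := ih hi
        exact ⟨i0, by omega, b⟩
  have hsub : S ⊆ (E ×ˢ (Finset.range q ×ˢ Finset.range q)).image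
      (fun z => (z.1.1 - (z.2.1 : ℤ), z.1.2 - (z.2.2 : ℤ))) := by
    rintro ⟨n, m⟩ hp
    obtain ⟨i, j, hi, hj, hij⟩ := hbad _ hp
    have hB := hSB _ hp
    simp only [abs_le] at hB hij
    rw [Finset.mem_image]
    by_cases hrow' : (n + i, m) ∈ O
    · obtain ⟨j0, hj0, h1, h2⟩ := walk (fun j => (n + i, m + (j : ℤ)) ∈ O) (by simpa using hrow') j hij
      refine ⟨((n + i, m + j0), i, j0), ?_, by simp⟩
      simp only [E, L, V, I, Finset.mem_product, Finset.mem_union, Finset.mem_filter, Finset.mem_Icc,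
        Finset.mem_range]
      refine ⟨Or.inr ⟨by omega, h1, ?_⟩, by omega⟩
      rw [add_assoc]; exact_mod_cast h2
    · obtain ⟨i0, hi0, h1, h2⟩ := walk (fun i => (n + (i : ℤ), m) ∈ O) (by simpa using hSO _ hp) i hrow'
      refine ⟨((n + i0, m), i0, 0), ?_, by simp⟩
      simp only [E, L, V, I, Finset.mem_product, Finset.mem_union, Finset.mem_filter, Finset.mem_Icc,
        Finset.mem_range]
      refine ⟨Or.inl ⟨by omega, h1, ?_⟩, by omega⟩
      rw [add_assoc]; exact_mod_cast h2
  calc S.card ≤ _ := Finset.card_le_card hsub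
    _ ≤ _ := Finset.card_image_le
    _ = E.card * (q * q) := by simp [Finset.card_product]
    _ ≤ _ := Nat.mul_le_mul_right _ hE

variable {k : ℕ} {shapes : Fin k → Rhombus}

/-- the set of grid positions occupied by full tiles -/
def Occ (x : Set Rhombus) (a b : Pt) (Ha Hb : Pt → ℝ) : Set (ℤ × ℤ) :=
  {p | ∃ r ∈ x, ∃ q, Par r q a b ∧ Ha q = p.1 ∧ Hb q = p.2}

theorem tile_of_par {x : Set Rhombus} (hx : IsTiling x) {r s : Rhombus} (hr : r ∈ x) (hs : s ∈ x)
    {q a b : Pt} (h : Par r q a b) (h' : Par s q a b) : r = s := by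
  refine inter_unique hx hr hs (p := q + (2⁻¹ : ℝ) • a + (2⁻¹ : ℝ) • b)
    (h.interior_iff.2 ⟨2⁻¹, 2⁻¹, by constructor <;> norm_num, by constructor <;> norm_num, rfl⟩)
    (mid_mem h' (by constructor <;> norm_num) (by constructor <;> norm_num))

section layer
theorem lvl (hval : ∀ i, (shapes i).IsValid) {x : Set Rhombus}
    (hx : IsTilingOn (range shapes) x) {a b : Pt} (ha : a ≠ 0) (hb : b ≠ 0)
    (hab : dt a b ≠ 0) {Ha Hb : Pt → ℝ} (hHa : Height x a Ha) (hHb : Height x b Hb)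
    {κ : Pt → ℕ}
    (hκ : ∀ r ∈ x, ∀ q d, Par r q a d → d ≠ b → d ≠ -b → κ (q + d) = κ q) {q q' : Pt}
    (h : AE x a q) (h' : AE x a q') (e1 : Ha q = Ha q') (e2 : Hb q = Hb q') : κ q = κ q' := by
  rcases le_total (dt a b * dt a q) (dt a b * dt a q') with hle | hle
  · exact (chain_height hx ha hb hab hHa hHb hκ (same_level hval hx ha hHa hab h h' e1 hle)).2.2.1 e2
  · exact ((chain_height hx ha hb hab hHa hHb hκ
      (same_level hval hx ha hHa hab h' h e1.symm hle)).2.2.1 e2.symm).symm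

theorem corner_unique (hval : ∀ i, (shapes i).IsValid) {x : Set Rhombus}
    (hx : IsTilingOn (range shapes) x) {a b : Pt} (ha : a ≠ 0) (hb : b ≠ 0)
    (hab : dt a b ≠ 0) {Ha Hb : Pt → ℝ} (hHa : Height x a Ha) (hHb : Height x b Hb)
    {r r' : Rhombus} (hr : r ∈ x) (hr' : r' ∈ x) {q q' : Pt} (h : Par r q a b)
    (h' : Par r' q' a b) (e1 : Ha q = Ha q') (e2 : Hb q = Hb q') : r = r' := by
  have : q = q' := by
    rcases le_total (dt a b * dt a q) (dt a b * dt a q') with hle | hle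
    · exact (chain_height hx ha hb hab hHa hHb (κ := fun _ => 0) (fun _ _ _ _ _ _ _ => rfl)
        (same_level hval hx ha hHa hab ⟨r, hr, b, h⟩ ⟨r', hr', b, h'⟩ e1 hle)).2.2.2.1 ⟨r, hr, h⟩ e2
    · exact ((chain_height hx ha hb hab hHa hHb (κ := fun _ => 0) (fun _ _ _ _ _ _ _ => rfl)
        (same_level hval hx ha hHa hab ⟨r', hr', b, h'⟩ ⟨r, hr, b, h⟩ e1.symm hle)).2.2.2.1
        ⟨r', hr', h'⟩ e2.symm).symm
  subst this
  exact tile_of_par hx.1 hr hr' h h'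

theorem occ_row (hval : ∀ i, (shapes i).IsValid) {x : Set Rhombus}
    (hx : IsTilingOn (range shapes) x) {a b : Pt} (ha : a ≠ 0) (hb : b ≠ 0)
    (hab : dt a b ≠ 0) {Ha Hb : Pt → ℝ} (hHa : Height x a Ha) (hHb : Height x b Hb)
    (n m₁ m m₂ : ℤ) (h1 : (n, m₁) ∈ Occ x a b Ha Hb) (h2 : (n, m₂) ∈ Occ x a b Ha Hb)
    (l1 : m₁ ≤ m) (l2 : m ≤ m₂) : (n, m) ∈ Occ x a b Ha Hb := by
  have h2' := h2
  obtain ⟨r, hr, q, hq, e1, e2⟩ := h1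
  obtain ⟨r', hr', q', hq', e1', e2'⟩ := h2
  simp only at e1 e2 e1' e2'
  rcases l2.eq_or_lt with rfl | l2
  · exact h2'
  rcases le_total (dt a b * dt a q) (dt a b * dt a q') with hle | hle
  · obtain ⟨s, hs, p, hp, f1, f2⟩ := (chain_height hx ha hb hab hHa hHb (κ := fun _ => 0)
      (fun _ _ _ _ _ _ _ => rfl) (same_level hval hx ha hHa hab ⟨r, hr, b, hq⟩ ⟨r', hr', b, hq'⟩
        (by rw [e1, e1']) hle)).2.2.2.2 m ⟨m₁, e2⟩ (by rw [e2]; exact_mod_cast l1)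
        (by rw [e2']; exact_mod_cast l2)
    exact ⟨s, hs, p, hp, by rw [f1, e1], f2⟩
  · have := (chain_height hx ha hb hab hHa hHb (κ := fun _ => 0)
      (fun _ _ _ _ _ _ _ => rfl) (same_level hval hx ha hHa hab ⟨r', hr', b, hq'⟩ ⟨r, hr, b, hq⟩
        (by rw [e1, e1']) hle)).2.1
    rw [e2, e2'] at this
    have : m₂ ≤ m₁ := by exact_mod_cast this
    omega

theorem occ_col (hval : ∀ i, (shapes i).IsValid) {x : Set Rhombus}
    (hx : IsTilingOn (range shapes) x) {a b : Pt} (ha : a ≠ 0) (hb : b ≠ 0)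
    (hab : dt a b ≠ 0) {Ha Hb : Pt → ℝ} (hHa : Height x a Ha) (hHb : Height x b Hb)
    (m n₁ n n₂ : ℤ) (h1 : (n₁, m) ∈ Occ x a b Ha Hb) (h2 : (n₂, m) ∈ Occ x a b Ha Hb)
    (l1 : n₁ ≤ n) (l2 : n ≤ n₂) : (n, m) ∈ Occ x a b Ha Hb := by
  have sw : ∀ n m : ℤ, (n, m) ∈ Occ x a b Ha Hb ↔ (m, n) ∈ Occ x b a Hb Ha := by
    intro n m
    constructor
    · rintro ⟨r, hr, q, hq, e1, e2⟩; exact ⟨r, hr, q, hq.swap, e2, e1⟩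
    · rintro ⟨r, hr, q, hq, e1, e2⟩; exact ⟨r, hr, q, hq.swap, e2, e1⟩
  rw [sw] at *
  exact occ_row hval hx hb ha (by rw [dt_swap]; simpa using hab) hHb hHa m n₁ n n₂ h1 h2 l1 l2

end layer

theorem exists_block (hval : ∀ i, (shapes i).IsValid) {x : Set Rhombus}
    (hx : IsTilingOn (range shapes) x) (Ha Hb : Fin k → Pt → ℝ)
    (hHa : ∀ ℓ, Height x (shapes ℓ).u (Ha ℓ)) (hHb : ∀ ℓ, Height x (shapes ℓ).v (Hb ℓ)) (q : ℕ) :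
    ∃ ℓ : Fin k, ∃ n m : ℤ, ∀ i j : ℕ, i < q → j < q →
      (n + i, m + j) ∈ Occ x (shapes ℓ).u (shapes ℓ).v (Ha ℓ) (Hb ℓ) := by
  classical
  have hab : ∀ ℓ, dt (shapes ℓ).u (shapes ℓ).v ≠ 0 := fun ℓ => dt_ne_of_valid (hval ℓ)
  have ha : ∀ ℓ, (shapes ℓ).u ≠ 0 := by
    intro ℓ h; apply hab ℓ; rw [h]; simp [dt]
  have hb : ∀ ℓ, (shapes ℓ).v ≠ 0 := by
    intro ℓ h; apply hab ℓ; rw [h]; simp [dt]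
  by_contra hcon
  push Not at hcon
  set R : ℝ := 2 * diam shapes + 1 with hR
  have hd := diam_nonneg shapes
  choose Ca hCa0 hCa using fun ℓ => (hHa ℓ).bound
  choose Cb hCb0 hCb using fun ℓ => (hHb ℓ).bound
  obtain ⟨K, hK⟩ := exists_nat_ge ((∑ ℓ, (Ca ℓ + Cb ℓ)) * (2 * R))
  have hCs : ∀ ℓ, Ca ℓ * (2 * R) ≤ K ∧ Cb ℓ * (2 * R) ≤ K := by
    intro ℓ
    have := Finset.single_le_sum (f := fun ℓ => Ca ℓ + Cb ℓ)
      (fun i _ => add_nonneg (hCa0 i) (hCb0 i)) (Finset.mem_univ ℓ)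
    have h1 := hCa0 ℓ
    have h2 := hCb0 ℓ
    constructor
    · refine le_trans (mul_le_mul_of_nonneg_right ?_ ?_) hK <;> linarith
    · refine le_trans (mul_le_mul_of_nonneg_right ?_ ?_) hK <;> linarith
  set A : ℕ := k * 2 * (q * q) with hA
  set N : ℕ := A * (4 * K + q + 1) + 1 with hN
  set M : ℕ := K * (N + 1) with hM
  let g : ℕ × ℕ → Pt := fun z => WithLp.toLp 2 ![R * z.1, R * z.2]
  have hg0 : ∀ z, g z 0 = R * z.1 := fun z => by simp [g]
  have hg1 : ∀ z, g z 1 = R * z.2 := fun z => by simp [g]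
  have hcoord : ∀ (y : Pt) (i : Fin 2), |y i| ≤ ‖y‖ := fun y i => by
    have := PiLp.norm_apply_le y i
    simpa using this
  have hnorm : ∀ z ∈ Finset.range N ×ˢ Finset.range N, ‖g z‖ ≤ 2 * R * N := by
    rintro ⟨α, β⟩ hz
    simp only [Finset.mem_product, Finset.mem_range] at hz
    have h1 : (α : ℝ) ≤ N := by exact_mod_cast hz.1.le
    have h2 : (β : ℝ) ≤ N := by exact_mod_cast hz.2.le
    have hR0 : 0 ≤ R := by linarith
    rw [EuclideanSpace.norm_eq, Fin.sum_univ_two, hg0, hg1]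
    apply Real.sqrt_le_iff.2
    refine ⟨by positivity, ?_⟩
    simp only [Real.norm_eq_abs, sq_abs]
    have e1 : R * α ≤ R * N := mul_le_mul_of_nonneg_left h1 hR0
    have e2 : R * β ≤ R * N := mul_le_mul_of_nonneg_left h2 hR0
    have e3 : 0 ≤ R * α := by positivity
    have e4 : 0 ≤ R * β := by positivity
    nlinarith
  choose tile htx htm using covers hx.1
  have hdiam : ∀ r ∈ x, ∀ p ∈ r.support, ∀ p' ∈ r.support, dist p p' ≤ 2 * diam shapes := by
    intro r hr p hp p' hp'
    have h1 := dist_center' hx hr hp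
    have h2 := dist_center' hx hr hp'
    have := dist_triangle_right p p' r.center
    linarith
  have hinj : ∀ z z', tile (g z) = tile (g z') → z = z' := by
    rintro ⟨α, β⟩ ⟨α', β'⟩ h
    have hdist := hdiam _ (htx _) _ (htm (g (α, β))) _ (by rw [h]; exact htm (g (α', β')))
    rw [dist_eq_norm] at hdist
    have key : ∀ s t : ℕ, |R * s - R * t| ≤ 2 * diam shapes → s = t := by
      intro s t hst
      by_contra hne
      have : (1 : ℝ) ≤ |(s : ℝ) - t| := by
        have : (1 : ℤ) ≤ |(s : ℤ) - t| := Int.one_le_abs (by omega)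
        exact_mod_cast this
      rw [← mul_sub, abs_mul, abs_of_nonneg (show 0 ≤ R by linarith)] at hst
      nlinarith
    have c0 := (hcoord _ 0).trans hdist
    have c1 := (hcoord _ 1).trans hdist
    rw [PiLp.sub_apply, hg0, hg0] at c0
    rw [PiLp.sub_apply, hg1, hg1] at c1
    exact Prod.ext (key _ _ c0) (key _ _ c1)
  have : Nonempty (Fin k) := ⟨(shape_of hx (htx 0)).choose⟩
  choose! sh hshu hshv using fun r (hr : r ∈ x) => shape_of hx hr
  have hpar : ∀ r ∈ x, Par r r.pos (shapes (sh r)).u (shapes (sh r)).v := by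
    intro r hr
    rw [← hshu r hr, ← hshv r hr]; exact Par.base
  have hia : ∀ ℓ, ∀ r ∈ x, ∃ n : ℤ, Ha ℓ r.pos = n := fun ℓ r hr => (hHa ℓ).int r hr _ Par.base.vertex
  have hib : ∀ ℓ, ∀ r ∈ x, ∃ n : ℤ, Hb ℓ r.pos = n := fun ℓ r hr => (hHb ℓ).int r hr _ Par.base.vertex
  choose! na hna using hia
  choose! nb hnb using hib
  let Φ : ℕ × ℕ → Fin k × (ℤ × ℤ) := fun z =>
    (sh (tile (g z)), (na (sh (tile (g z))) (tile (g z)), nb (sh (tile (g z))) (tile (g z))))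
  let B : Finset (ℤ × ℤ) := Finset.Icc (-(M : ℤ)) M ×ˢ Finset.Icc (-(M : ℤ)) M
  let S : Fin k → Finset (ℤ × ℤ) := fun ℓ =>
    B.filter (fun p => p ∈ Occ x (shapes ℓ).u (shapes ℓ).v (Ha ℓ) (Hb ℓ))
  have hS : ∀ ℓ, (S ℓ).card ≤ 2 * (2 * M + q + 1) * (q * q) := by
    intro ℓ
    apply bad_count (Occ x (shapes ℓ).u (shapes ℓ).v (Ha ℓ) (Hb ℓ))
      (occ_row hval hx (ha ℓ) (hb ℓ) (hab ℓ) (hHa ℓ) (hHb ℓ))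
      (occ_col hval hx (ha ℓ) (hb ℓ) (hab ℓ) (hHa ℓ) (hHb ℓ))
    · intro p hp; exact (Finset.mem_filter.1 hp).2
    · intro p hp
      have := (Finset.mem_filter.1 hp).1
      simp only [B, Finset.mem_product, Finset.mem_Icc] at this
      simp only [abs_le]; omega
    · intro p hp
      obtain ⟨i, j, h1, h2, h3⟩ := hcon ℓ p.1 p.2
      exact ⟨i, j, h1, h2, h3⟩
  have hΦ : N * N ≤ ((Finset.univ : Finset (Fin k)).sigma S).card := by
    have : N * N = (Finset.range N ×ˢ Finset.range N).card := by simp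
    rw [this]
    apply Finset.card_le_card_of_injOn (fun z => (⟨(Φ z).1, (Φ z).2⟩ : Σ _ : Fin k, ℤ × ℤ))
    · intro z hz
      have hz' := hnorm z hz
      simp only [Finset.coe_sigma, Finset.coe_univ, mem_sigma_iff, mem_univ, true_and, Finset.mem_coe, S,
        Finset.mem_filter, Φ]
      have hr := htx (g z)
      set r := tile (g z) with hrdef
      have hp : ‖r.pos‖ ≤ 2 * R * N + 2 * diam shapes := by
        have h1 := hdiam r hr _ (vertices_subset _ Par.base.vertex) _ (htm (g z))
        rw [dist_eq_norm] at h1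
        have h2 := norm_le_norm_add_norm_sub' r.pos (g z)
        linarith
      have hp' : ‖r.pos‖ + 1 ≤ 2 * R * (N + 1) := by
        rw [mul_add]; linarith
      refine ⟨?_, r, hr, r.pos, hpar r hr, hna _ r hr, hnb _ r hr⟩
      have hMR : (M : ℝ) = K * (N + 1) := by rw [hM]; push_cast; ring
      have b1 : |((na (sh r) r : ℤ) : ℝ)| ≤ M := by
        rw [← hna _ r hr, hMR]
        refine (hCa _ _).trans ?_
        have := mul_le_mul_of_nonneg_left hp' (hCa0 (sh r))
        have := mul_le_mul_of_nonneg_right (hCs (sh r)).1 (show (0 : ℝ) ≤ N + 1 by positivity)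
        linarith
      have b2 : |((nb (sh r) r : ℤ) : ℝ)| ≤ M := by
        rw [← hnb _ r hr, hMR]
        refine (hCb _ _).trans ?_
        have := mul_le_mul_of_nonneg_left hp' (hCb0 (sh r))
        have := mul_le_mul_of_nonneg_right (hCs (sh r)).2 (show (0 : ℝ) ≤ N + 1 by positivity)
        linarith
      have b1' : |na (sh r) r| ≤ (M : ℤ) := by exact_mod_cast b1
      have b2' : |nb (sh r) r| ≤ (M : ℤ) := by exact_mod_cast b2
      rw [abs_le] at b1' b2'
      simp only [B, Finset.mem_product, Finset.mem_Icc]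
      exact ⟨b1', b2'⟩
    · intro z _ z' _ h
      simp only [Φ, Sigma.mk.injEq, heq_eq_eq, Prod.mk.injEq] at h
      obtain ⟨h1, h2, h3⟩ := h
      apply hinj
      have hr := htx (g z)
      have hr' := htx (g z')
      have p' := hpar _ hr'
      rw [← h1] at p' h2 h3
      refine corner_unique hval hx (ha _) (hb _) (hab _) (hHa _) (hHb _) hr hr' (hpar _ hr) p' ?_ ?_
      · rw [hna _ _ hr, hna _ _ hr', h2]
      · rw [hnb _ _ hr, hnb _ _ hr', h3]
  rw [Finset.card_sigma] at hΦ
  have h2 := hΦ.trans (Finset.sum_le_sum (fun ℓ _ => hS ℓ))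
  simp only [Finset.sum_const, Finset.card_univ, Fintype.card_fin, smul_eq_mul] at h2
  have h3 : N * N ≤ A * (2 * M + q + 1) := by
    refine h2.trans (le_of_eq ?_)
    rw [hA]; ring
  have hN1 : 1 ≤ N := by omega
  have h4 : 2 * M + q + 1 ≤ (4 * K + q + 1) * N := by
    rw [hM]; nlinarith [Nat.zero_le K, Nat.zero_le q]
  have h5 : A * (2 * M + q + 1) ≤ (A * (4 * K + q + 1)) * N := by
    calc A * (2 * M + q + 1) ≤ A * ((4 * K + q + 1) * N) := Nat.mul_le_mul_left _ h4
      _ = _ := by ring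
  have h6 : N * N ≤ (N - 1) * N := by
    refine h3.trans (h5.trans (le_of_eq ?_))
    congr 1
  have : N ≤ N - 1 := Nat.le_of_mul_le_mul_right h6 hN1
  omega

theorem density (hval : ∀ i, (shapes i).IsValid) {x : Set Rhombus}
    (hx : IsTilingOn (range shapes) x) (W : List WangTile) (κ κ' : Fin k → Pt → ℕ)
    (tl : Fin k → Rhombus → WangTile) (htl : ∀ ℓ, ∀ r ∈ x, tl ℓ r ∈ W)
    (K1 : ∀ ℓ, ∀ r ∈ x, ∀ q d, Par r q (shapes ℓ).u d → d ≠ (shapes ℓ).v → d ≠ -(shapes ℓ).v →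
      κ ℓ (q + d) = κ ℓ q)
    (K1' : ∀ ℓ, ∀ r ∈ x, ∀ q d, Par r q (shapes ℓ).v d → d ≠ (shapes ℓ).u → d ≠ -(shapes ℓ).u →
      κ' ℓ (q + d) = κ' ℓ q)
    (K2 : ∀ ℓ, ∀ r ∈ x, ∀ q, Par r q (shapes ℓ).u (shapes ℓ).v →
      κ ℓ q = (tl ℓ r).1 ∧ κ ℓ (q + (shapes ℓ).v) = (tl ℓ r).2.2.1 ∧
      κ' ℓ q = (tl ℓ r).2.2.2 ∧ κ' ℓ (q + (shapes ℓ).u) = (tl ℓ r).2.1) : WangDomino W := by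
  have hab : ∀ ℓ, dt (shapes ℓ).u (shapes ℓ).v ≠ 0 := fun ℓ => dt_ne_of_valid (hval ℓ)
  have hba : ∀ ℓ, dt (shapes ℓ).v (shapes ℓ).u ≠ 0 := fun ℓ => by
    rw [dt_swap]; simpa using hab ℓ
  have ha : ∀ ℓ, (shapes ℓ).u ≠ 0 := by
    intro ℓ h; apply hab ℓ; rw [h]; simp [dt]
  have hb : ∀ ℓ, (shapes ℓ).v ≠ 0 := by
    intro ℓ h; apply hab ℓ; rw [h]; simp [dt]
  choose Ha hHa using fun ℓ => exists_height hval hx (ha ℓ)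
  choose Hb hHb using fun ℓ => exists_height hval hx (hb ℓ)
  apply wang_compact
  intro Q
  obtain ⟨ℓ, n, m, hblk⟩ := exists_block hval hx Ha Hb hHa hHb Q
  have hblk' : ∀ p : ℤ × ℤ, 0 ≤ p.1 ∧ p.1 < Q ∧ 0 ≤ p.2 ∧ p.2 < Q → ∃ r, r ∈ x ∧ ∃ q,
      Par r q (shapes ℓ).u (shapes ℓ).v ∧ Ha ℓ q = (n + p.1 : ℤ) ∧ Hb ℓ q = (m + p.2 : ℤ) := by
    rintro ⟨i, j⟩ ⟨h1, h2, h3, h4⟩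
    obtain ⟨r, hr, q, h⟩ := hblk i.toNat j.toNat (by omega) (by omega)
    refine ⟨r, hr, q, ?_⟩
    simp only [Int.toNat_of_nonneg h1, Int.toNat_of_nonneg h3] at h
    exact h
  have : Nonempty Rhombus := ⟨⟨0, 0, 0⟩⟩
  choose! r hr q hq hqa hqb using hblk'
  refine ⟨fun p => tl ℓ (r p), ?_, ?_, ?_⟩
  · intro i j h1 h2 h3 h4
    exact htl _ _ (hr (i, j) ⟨h1, h2, h3, h4⟩)
  · intro i j h1 h2 h3 h4
    have c1 : 0 ≤ (i, j).1 ∧ (i, j).1 < (Q : ℤ) ∧ 0 ≤ (i, j).2 ∧ (i, j).2 < (Q : ℤ) :=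
      ⟨h1, by simp only; omega, h3, h4⟩
    have c2 : 0 ≤ (i + 1, j).1 ∧ (i + 1, j).1 < (Q : ℤ) ∧ 0 ≤ (i + 1, j).2 ∧ (i + 1, j).2 < (Q : ℤ) :=
      ⟨by simp only; omega, h2, h3, h4⟩
    have p1 := hq _ c1
    have p2 := hq _ c2
    rw [← (K2 ℓ _ (hr _ c1) _ p1).2.2.2, ← (K2 ℓ _ (hr _ c2) _ p2).2.2.1]
    apply lvl hval hx (hb ℓ) (ha ℓ) (hba ℓ) (hHb ℓ) (hHa ℓ) (K1' ℓ)
    · exact ⟨_, hr _ c1, _, p1.cross⟩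
    · exact ⟨_, hr _ c2, _, p2.swap⟩
    · rw [height_par hx.1 (hb ℓ) (hHb ℓ) (hr _ c1) p1, sg_eq_zero (hba ℓ), hqb _ c1, hqb _ c2]; simp
    · rw [height_par hx.1 (ha ℓ) (hHa ℓ) (hr _ c1) p1, sg_self, hqa _ c1, hqa _ c2]; push_cast; ring
  · intro i j h1 h2 h3 h4
    have c1 : 0 ≤ (i, j).1 ∧ (i, j).1 < (Q : ℤ) ∧ 0 ≤ (i, j).2 ∧ (i, j).2 < (Q : ℤ) :=
      ⟨h1, h2, h3, by simp only; omega⟩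
    have c2 : 0 ≤ (i, j + 1).1 ∧ (i, j + 1).1 < (Q : ℤ) ∧ 0 ≤ (i, j + 1).2 ∧ (i, j + 1).2 < (Q : ℤ) :=
      ⟨h1, h2, by simp only; omega, h4⟩
    have p1 := hq _ c1
    have p2 := hq _ c2
    rw [← (K2 ℓ _ (hr _ c1) _ p1).2.1, ← (K2 ℓ _ (hr _ c2) _ p2).1]
    apply lvl hval hx (ha ℓ) (hb ℓ) (hab ℓ) (hHa ℓ) (hHb ℓ) (K1 ℓ)
    · exact ⟨_, hr _ c1, _, p1.flip2⟩
    · exact ⟨_, hr _ c2, _, p2⟩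
    · rw [height_par hx.1 (ha ℓ) (hHa ℓ) (hr _ c1) p1.swap, sg_eq_zero (hab ℓ), hqa _ c1, hqa _ c2]; simp
    · rw [height_par hx.1 (hb ℓ) (hHb ℓ) (hr _ c1) p1.swap, sg_self, hqb _ c1, hqb _ c2]; push_cast; ring

end Geo
end

open Set Metric
section

namespace Red
open Geo

/-- the direction of edge `j` and the inward direction -/
def cd (r : Rhombus) : Fin 4 → Pt × Pt := ![(r.u, r.v), (r.v, -r.u), (-r.u, -r.v), (-r.v, r.u)]

open Classical in
/-- colour of an edge of direction `c`, with inward direction `d`, in the layer `(a, b)` -/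
def col (a b c d : Pt) (t : WangTile) : ℕ :=
  if c = a ∨ c = -a then (if d = -b then t.2.2.1 else t.1)
  else if c = b ∨ c = -b then (if d = -a then t.2.1 else t.2.2.2) else 0

theorem col_neg (a b c d : Pt) (t : WangTile) : col a b (-c) d t = col a b c d t := by
  have e1 : ∀ a : Pt, (-c = a ∨ -c = -a) ↔ (c = a ∨ c = -a) := by
    intro a
    rw [neg_eq_iff_eq_neg, neg_inj]; tauto
  simp only [col, e1]

theorem par_frame {r : Rhombus} {q c d : Pt} (h : Par r q c d) :
    ∃ j, r.edge j = segment ℝ q (q + c) ∧ (cd r j = (c, d) ∨ cd r j = (-c, d)) := by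
  have key : (∃ j, r.edge j = segment ℝ q (q + c) ∧ (cd r j = (c, d) ∨ cd r j = (-c, d))) ∧
    (∃ j, r.edge j = segment ℝ q (q + d) ∧ (cd r j = (d, c) ∨ cd r j = (-d, c))) ∧
    (∃ j, r.edge j = segment ℝ (q + c) (q + c + d) ∧ (cd r j = (d, -c) ∨ cd r j = (-d, -c))) ∧
    (∃ j, r.edge j = segment ℝ (q + d) (q + d + c) ∧ (cd r j = (c, -d) ∨ cd r j = (-c, -d))) := by
    induction h with
    | base =>
      refine ⟨⟨0, rfl, Or.inl rfl⟩, ⟨3, ?_, Or.inr rfl⟩, ⟨1, rfl, Or.inl rfl⟩, ⟨2, ?_, Or.inr rfl⟩⟩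
      · rw [segment_symm]; rfl
      · rw [segment_symm]
        change segment ℝ (r.pos + r.u + r.v) (r.pos + r.v) = _
        rw [add_right_comm]
    | swap _ ih => obtain ⟨h1, h2, h3, h4⟩ := ih; exact ⟨h2, h1, h4, h3⟩
    | @flip q c d _ ih =>
      obtain ⟨⟨j1, e1, f1⟩, ⟨j2, e2, f2⟩, ⟨j3, e3, f3⟩, ⟨j4, e4, f4⟩⟩ := ih
      refine ⟨⟨j1, ?_, ?_⟩, ⟨j3, e3, f3⟩, ⟨j2, ?_, ?_⟩, ⟨j4, ?_, ?_⟩⟩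
      · rw [e1, segment_symm]; simp
      · simpa using f1.symm
      · rw [e2]; simp
      · simpa using f2
      · rw [e4, segment_symm]; congr 1 <;> abel
      · simpa using f4.symm
  exact key.1

theorem frame_par (r : Rhombus) (j : Fin 4) :
    ∃ q, Par r q (cd r j).1 (cd r j).2 ∧ r.edge j = segment ℝ q (q + (cd r j).1) := by
  have h : Par r r.pos r.u r.v := Par.base
  fin_cases j
  · exact ⟨_, h, rfl⟩
  · exact ⟨_, h.cross, rfl⟩
  · refine ⟨_, h.cross.cross, ?_⟩
    change segment ℝ (r.pos + r.u + r.v) (r.pos + r.v) = segment ℝ _ (r.pos + r.u + r.v + -r.u)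
    congr 1; abel
  · have h4 := h.cross.cross.cross
    have e : r.pos + r.u + r.v + -r.u = r.pos + r.v := by abel
    rw [e, neg_neg] at h4
    refine ⟨_, h4, ?_⟩
    change segment ℝ (r.pos + r.v) r.pos = segment ℝ _ (r.pos + r.v + -r.v)
    congr 1; abel

theorem par_center {r : Rhombus} {q c d : Pt} (h : Par r q c d) :
    r.center = q + (2⁻¹ : ℝ) • c + (2⁻¹ : ℝ) • d := by
  induction h with
  | base => rfl
  | swap _ ih => rw [ih]; abel
  | flip _ ih => rw [ih]; module

theorem par_unique {r : Rhombus} {q c d d' : Pt} (h : Par r q c d) (h' : Par r q c d') : d = d' := by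
  have := (par_center h).symm.trans (par_center h')
  have := add_left_cancel this
  exact smul_right_injective _ (show (2⁻¹ : ℝ) ≠ 0 by norm_num) this

/-- tuples -/
def tup : ℕ → List WangTile → List (List WangTile)
  | 0, _ => [[]]
  | n + 1, W => W.flatMap fun w => (tup n W).map fun L => w :: L

theorem mem_tup {n : ℕ} {W : List WangTile} {L : List WangTile} :
    L ∈ tup n W ↔ L.length = n ∧ ∀ t ∈ L, t ∈ W := by
  induction n generalizing L with
  | zero =>
    simp only [tup, List.mem_singleton]
    constructor
    · rintro rfl; simp
    · rintro ⟨h, _⟩; exact List.length_eq_zero_iff.1 h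
  | succ n ih =>
    simp only [tup, List.mem_flatMap, List.mem_map]
    constructor
    · rintro ⟨w, hw, L', hL', rfl⟩
      rw [ih] at hL'
      refine ⟨by simp [hL'.1], fun t ht => ?_⟩
      rcases List.mem_cons.1 ht with rfl | ht
      · exact hw
      · exact hL'.2 t ht
    · rintro ⟨h1, h2⟩
      cases L with
      | nil => simp at h1
      | cons w L =>
        refine ⟨w, h2 w (by simp), L, ih.2 ⟨by simpa using h1, fun t ht => h2 t (by simp [ht])⟩, rfl⟩

theorem tup_primrec (n : ℕ) : Primrec (tup n) := by
  induction n with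
  | zero => exact Primrec.const [[]]
  | succ n ih =>
    refine Primrec.list_flatMap Primrec.id ?_
    refine Primrec.list_map (ih.comp Primrec.fst) ?_
    exact Primrec.list_cons.comp (Primrec.snd.comp Primrec.fst) Primrec.snd

variable {k : ℕ} (shapes : Fin k → Rhombus)

/-- the product colour -/
def pcol (r : Rhombus) (j : Fin 4) (L : List WangTile) : ℕ :=
  Encodable.encode ((List.finRange k).map fun ℓ =>
    col (shapes ℓ).u (shapes ℓ).v (cd r j).1 (cd r j).2 (L.getD ℓ (0, 0, 0, 0)))

def symb (i : Fin k) (L : List WangTile) : SymbTile k :=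
  (i, pcol shapes (shapes i) 0 L, pcol shapes (shapes i) 1 L, pcol shapes (shapes i) 2 L,
    pcol shapes (shapes i) 3 L)

theorem symb_colors (i : Fin k) (L : List WangTile) (j : Fin 4) :
    SymbTile.colors (symb shapes i L) j = pcol shapes (shapes i) j L := by
  fin_cases j <;> rfl

def red (W : List WangTile) : List (SymbTile k) :=
  (List.finRange k).flatMap fun i => (tup k W).map fun L => symb shapes i L

theorem col_primrec (a b c d : Pt) : Primrec (col a b c d) := by
  have p1 : Primrec (fun t : WangTile => t.1) := Primrec.fst
  have p2 : Primrec (fun t : WangTile => t.2.1) := Primrec.fst.comp Primrec.snd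
  have p3 : Primrec (fun t : WangTile => t.2.2.1) := Primrec.fst.comp (Primrec.snd.comp Primrec.snd)
  have p4 : Primrec (fun t : WangTile => t.2.2.2) := Primrec.snd.comp (Primrec.snd.comp Primrec.snd)
  unfold col
  split_ifs
  · exact p3
  · exact p1
  · exact p2
  · exact p4
  · exact Primrec.const 0

theorem pcol_primrec (r : Rhombus) (j : Fin 4) : Primrec (pcol shapes r j) := by
  refine Primrec.encode.comp (PR.map_fixed _ ?_)
  intro ℓ _
  exact (col_primrec _ _ _ _).comp ((Primrec.list_getD (0, 0, 0, 0)).comp Primrec.id (Primrec.const _))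

theorem red_primrec : Primrec (red shapes) := by
  refine PR.flatMap_fixed _ ?_
  intro i _
  refine Primrec.list_map (tup_primrec k) ?_
  have hp := fun j => (pcol_primrec shapes (shapes i) j).comp (Primrec.snd (α := List WangTile))
  exact Primrec.pair (Primrec.const i) (Primrec.pair (hp 0) (Primrec.pair (hp 1)
    (Primrec.pair (hp 2) (hp 3))))

variable {shapes}

theorem cd_same {r s : Rhombus} (hu : r.u = s.u) (hv : r.v = s.v) (j : Fin 4) : cd r j = cd s j := by
  simp only [cd, hu, hv]

section facts
theorem hab (hval : ∀ i, (shapes i).IsValid) (ℓ : Fin k) : dt (shapes ℓ).u (shapes ℓ).v ≠ 0 := dt_ne_of_valid (hval ℓ)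
theorem hba (hval : ∀ i, (shapes i).IsValid) (ℓ : Fin k) : dt (shapes ℓ).v (shapes ℓ).u ≠ 0 := by rw [dt_swap]; simpa using hab hval ℓ
theorem ha (hval : ∀ i, (shapes i).IsValid) (ℓ : Fin k) : (shapes ℓ).u ≠ 0 := by intro h; apply hab hval ℓ; rw [h]; simp [dt]
theorem hb (hval : ∀ i, (shapes i).IsValid) (ℓ : Fin k) : (shapes ℓ).v ≠ 0 := by intro h; apply hab hval ℓ; rw [h]; simp [dt]
theorem vne (hval : ∀ i, (shapes i).IsValid) (ℓ : Fin k) : ¬ ((shapes ℓ).v = (shapes ℓ).u ∨ (shapes ℓ).v = -(shapes ℓ).u) := by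
  have := hab hval ℓ
  rintro (h | h) <;> rw [h] at this
  · exact this (dt_self _)
  · rw [dt_neg_right, dt_self] at this; simp at this

theorem col_south (hval : ∀ i, (shapes i).IsValid) (ℓ : Fin k) {d : Pt} (h : d ≠ -(shapes ℓ).v) (t : WangTile) :
    col (shapes ℓ).u (shapes ℓ).v (shapes ℓ).u d t = t.1 := by simp [col, h]
theorem col_north (hval : ∀ i, (shapes i).IsValid) (ℓ : Fin k) (t : WangTile) :
    col (shapes ℓ).u (shapes ℓ).v (shapes ℓ).u (-(shapes ℓ).v) t = t.2.2.1 := by simp [col]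
theorem col_west (hval : ∀ i, (shapes i).IsValid) (ℓ : Fin k) {d : Pt} (h : d ≠ -(shapes ℓ).u) (t : WangTile) :
    col (shapes ℓ).u (shapes ℓ).v (shapes ℓ).v d t = t.2.2.2 := by
  rw [col, if_neg (vne hval ℓ)]; simp [h]
theorem col_east (hval : ∀ i, (shapes i).IsValid) (ℓ : Fin k) (t : WangTile) :
    col (shapes ℓ).u (shapes ℓ).v (shapes ℓ).v (-(shapes ℓ).u) t = t.2.1 := by
  rw [col, if_neg (vne hval ℓ)]; simp
end facts

theorem sound (hval : ∀ i, (shapes i).IsValid) {X : Set (Set Rhombus)}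
    (hX : ∀ x ∈ X, IsTilingOn (range shapes) x) (W : List WangTile)
    (h : DominoPred shapes X (red shapes W)) : WangDomino W := by
  classical
  obtain ⟨y, ⟨hy1, hy2, hy3⟩, hyT, hyX⟩ := h
  have hx := hX _ hyX
  set x := eraseColors y with hxdef
  have hdata : ∀ r ∈ x, ∃ L : List WangTile, (L.length = k ∧ ∀ t ∈ L, t ∈ W) ∧
      ∃ t ∈ y, t.shape = r ∧ ∀ j, t.color j = pcol shapes r j L := by
    rintro r ⟨t, ht, rfl⟩
    obtain ⟨p, hp, hR1, hR2⟩ := hyT t ht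
    simp only [red, List.mem_flatMap, List.mem_map] at hp
    obtain ⟨i, _, L, hL, rfl⟩ := hp
    refine ⟨L, mem_tup.1 hL, t, ht, rfl, fun j => ?_⟩
    rw [hR2, symb_colors]
    simp only [pcol, cd_same hR1.1 hR1.2]
    rfl
  have : Nonempty ColoredRhombus := ⟨⟨⟨0, 0, 0⟩, fun _ => 0⟩⟩
  choose! L hL t ht hts htc using hdata
  let tl : Fin k → Rhombus → WangTile := fun ℓ r => (L r).getD ℓ (0, 0, 0, 0)
  have htl : ∀ ℓ, ∀ r ∈ x, tl ℓ r ∈ W := by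
    intro ℓ r hr
    apply (hL r hr).2
    simp only [tl]
    have hlt : (ℓ : ℕ) < (L r).length := by rw [(hL r hr).1]; exact ℓ.2
    rw [List.getD_eq_getElem _ _ hlt]
    exact List.getElem_mem hlt
  have match0 : ∀ r ∈ x, ∀ s ∈ x, r ≠ s → ∀ i j, r.edge i = s.edge j → ∀ ℓ : Fin k,
      col (shapes ℓ).u (shapes ℓ).v (cd r i).1 (cd r i).2 (tl ℓ r) =
      col (shapes ℓ).u (shapes ℓ).v (cd s j).1 (cd s j).2 (tl ℓ s) := by
    intro r hr s hs hne i j hij ℓ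
    have := hy3 (t r) (ht r hr) (t s) (ht s hs) (by rwa [hts r hr, hts s hs]) i j
      (by rwa [hts r hr, hts s hs])
    rw [htc r hr, htc s hs] at this
    have := Encodable.encode_injective this
    exact List.map_inj_left.1 this ℓ (List.mem_finRange ℓ)
  have mtch : ∀ r ∈ x, ∀ s ∈ x, ∀ q c d d', Par r q c d → Par s q c d' → ∀ ℓ : Fin k,
      col (shapes ℓ).u (shapes ℓ).v c d (tl ℓ r) = col (shapes ℓ).u (shapes ℓ).v c d' (tl ℓ s) := by
    intro r hr s hs q c d d' h h' ℓ
    by_cases hrs : r = s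
    · subst hrs; rw [par_unique h h']
    obtain ⟨i, hi, hi'⟩ := par_frame h
    obtain ⟨j, hj, hj'⟩ := par_frame h'
    have := match0 r hr s hs hrs i j (by rw [hi, hj]) ℓ
    rcases hi' with e | e <;> rcases hj' with e' | e' <;> rw [e, e'] at this <;>
      simpa only [col_neg] using this
  let κ : Fin k → Pt → Pt → ℕ := fun ℓ a q =>
    if h : ∃ z : Rhombus × Pt, z.1 ∈ x ∧ Par z.1 q a z.2 then
      col (shapes ℓ).u (shapes ℓ).v a h.choose.2 (tl ℓ h.choose.1) else 0
  have hκ : ∀ ℓ a q, ∀ r ∈ x, ∀ d, Par r q a d →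
      κ ℓ a q = col (shapes ℓ).u (shapes ℓ).v a d (tl ℓ r) := by
    intro ℓ a q r hr d h
    have hex : ∃ z : Rhombus × Pt, z.1 ∈ x ∧ Par z.1 q a z.2 := ⟨(r, d), hr, h⟩
    simp only [κ, dif_pos hex]
    exact mtch _ hex.choose_spec.1 _ hr _ _ _ _ hex.choose_spec.2 h ℓ
  refine density hval hx W (fun ℓ => κ ℓ (shapes ℓ).u) (fun ℓ => κ ℓ (shapes ℓ).v) tl htl ?_ ?_ ?_
  · intro ℓ r hr q d h h1 h2
    rw [hκ _ _ _ r hr _ h, hκ _ _ _ r hr _ h.flip2, col_south hval ℓ h2, col_south hval ℓ]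
    simpa using h1
  · intro ℓ r hr q d h h1 h2
    rw [hκ _ _ _ r hr _ h, hκ _ _ _ r hr _ h.flip2, col_west hval ℓ h2, col_west hval ℓ]
    simpa using h1
  · intro ℓ r hr q h
    rw [hκ _ _ _ r hr _ h, hκ _ _ _ r hr _ h.flip2, hκ _ _ _ r hr _ h.swap, hκ _ _ _ r hr _ h.cross,
      col_south hval ℓ (ne_neg_of (hb hval ℓ)), col_north hval ℓ,
      col_west hval ℓ (ne_neg_of (ha hval ℓ)), col_east hval ℓ]
    simp

/-- integer height of the lowest corner of a tile -/
def low (w : Pt) (H : Pt → ℝ) (r : Rhombus) : ℤ := ⌊H r.pos⌋ + min 0 (sg w r.u) + min 0 (sg w r.v)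

theorem low_par {x : Set Rhombus} (hx : IsTiling x) {w : Pt} (hw : w ≠ 0) {H : Pt → ℝ}
    (hH : Height x w H) {r : Rhombus} (hr : r ∈ x) {q c d : Pt} (h : Par r q c d) :
    low w H r = ⌊H q⌋ + min 0 (sg w c) + min 0 (sg w d) := by
  induction h with
  | base => rfl
  | swap _ ih => rw [ih]; ring
  | flip h ih =>
    rw [ih, height_par hx hw hH hr h, Int.floor_add_intCast, sg_neg hw]
    omega

theorem complete (hval : ∀ i, (shapes i).IsValid) {X : Set (Set Rhombus)} {x : Set Rhombus} (hxX : x ∈ X)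
    (hx : IsTilingOn (range shapes) x) (W : List WangTile)
    (h : WangDomino W) : DominoPred shapes X (red shapes W) := by
  classical
  obtain ⟨f, hf, hf1, hf2⟩ := h
  choose Ha hHa using fun ℓ => exists_height hval hx (ha hval ℓ)
  choose Hb hHb using fun ℓ => exists_height hval hx (hb hval ℓ)
  let tl : Fin k → Rhombus → WangTile := fun ℓ r =>
    f (low (shapes ℓ).u (Ha ℓ) r, low (shapes ℓ).v (Hb ℓ) r)
  have eA : ∀ ℓ, ∀ r ∈ x, ∀ q d, Par r q (shapes ℓ).u d →
      col (shapes ℓ).u (shapes ℓ).v (shapes ℓ).u d (tl ℓ r) = (f (⌊Ha ℓ q⌋, ⌊Hb ℓ q⌋)).1 := by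
    intro ℓ r hr q d h
    have l1 := low_par hx.1 (ha hval ℓ) (hHa ℓ) hr h
    have l2 := low_par hx.1 (hb hval ℓ) (hHb ℓ) hr h
    rw [sg_self, sg_eq_zero (h.dt_ne (hx.1.1 r hr))] at l1
    rw [sg_eq_zero (hba hval ℓ)] at l2
    simp only [tl, l1, l2]
    by_cases hd : d = -(shapes ℓ).v
    · subst hd
      rw [col_north hval, sg_neg (hb hval ℓ), sg_self]
      have := hf2 ⌊Ha ℓ q⌋ (⌊Hb ℓ q⌋ - 1)
      rw [sub_add_cancel] at this
      rw [← this]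
      congr <;> simp
    · rw [col_south hval ℓ hd]
      have : min 0 (sg (shapes ℓ).v d) = 0 := by
        unfold sg; split_ifs <;> simp
      rw [this]; simp
  have eB : ∀ ℓ, ∀ r ∈ x, ∀ q d, Par r q (shapes ℓ).v d →
      col (shapes ℓ).u (shapes ℓ).v (shapes ℓ).v d (tl ℓ r) = (f (⌊Ha ℓ q⌋, ⌊Hb ℓ q⌋)).2.2.2 := by
    intro ℓ r hr q d h
    have l1 := low_par hx.1 (hb hval ℓ) (hHb ℓ) hr h
    have l2 := low_par hx.1 (ha hval ℓ) (hHa ℓ) hr h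
    rw [sg_self, sg_eq_zero (h.dt_ne (hx.1.1 r hr))] at l1
    rw [sg_eq_zero (hab hval ℓ)] at l2
    simp only [tl, l1, l2]
    by_cases hd : d = -(shapes ℓ).u
    · subst hd
      rw [col_east hval, sg_neg (ha hval ℓ), sg_self]
      have := hf1 (⌊Ha ℓ q⌋ - 1) ⌊Hb ℓ q⌋
      rw [sub_add_cancel] at this
      rw [← this]
      congr <;> simp
    · rw [col_west hval ℓ hd]
      have : min 0 (sg (shapes ℓ).u d) = 0 := by
        unfold sg; split_ifs <;> simp
      rw [this]; simp
  have mtch : ∀ r ∈ x, ∀ s ∈ x, ∀ q c d d', Par r q c d → Par s q c d' → ∀ ℓ : Fin k,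
      col (shapes ℓ).u (shapes ℓ).v c d (tl ℓ r) = col (shapes ℓ).u (shapes ℓ).v c d' (tl ℓ s) := by
    intro r hr s hs q c d d' h h' ℓ
    by_cases c1 : c = (shapes ℓ).u
    · subst c1; rw [eA ℓ r hr q d h, eA ℓ s hs q d' h']
    by_cases c2 : c = -(shapes ℓ).u
    · have g := h.flip
      have g' := h'.flip
      rw [← col_neg, ← col_neg (c := c) (t := tl ℓ s)]
      rw [c2, neg_neg] at *
      rw [eA ℓ r hr _ d g, eA ℓ s hs _ d' g']
    by_cases c3 : c = (shapes ℓ).v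
    · subst c3; rw [eB ℓ r hr q d h, eB ℓ s hs q d' h']
    by_cases c4 : c = -(shapes ℓ).v
    · have g := h.flip
      have g' := h'.flip
      rw [← col_neg, ← col_neg (c := c) (t := tl ℓ s)]
      rw [c4, neg_neg] at *
      rw [eB ℓ r hr _ d g, eB ℓ s hs _ d' g']
    simp [col, c1, c2, c3, c4]
  have match0 : ∀ r ∈ x, ∀ s ∈ x, ∀ i j, r.edge i = s.edge j → ∀ ℓ : Fin k,
      col (shapes ℓ).u (shapes ℓ).v (cd r i).1 (cd r i).2 (tl ℓ r) =
      col (shapes ℓ).u (shapes ℓ).v (cd s j).1 (cd s j).2 (tl ℓ s) := by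
    intro r hr s hs i j hij ℓ
    obtain ⟨q, hq, e⟩ := frame_par r i
    obtain ⟨q', hq', e'⟩ := frame_par s j
    rw [e, e'] at hij
    rcases segment_eq hij with ⟨e1, e2⟩ | ⟨e1, e2⟩
    · subst e1
      have e3 := add_left_cancel e2
      rw [← e3] at hq'
      rw [mtch r hr s hs _ _ _ _ hq hq' ℓ, e3]
    · have g := hq'.flip
      have e3 : (cd r i).1 = -(cd s j).1 := by
        have : q' + (cd s j).1 + (cd r i).1 = q' := by rw [← e1, e2]
        rw [add_assoc, add_eq_left] at this
        rw [eq_neg_iff_add_eq_zero, add_comm]; exact this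
      rw [← e1, ← e3] at g
      rw [mtch r hr s hs _ _ _ _ hq g ℓ, e3, col_neg]
  have hk : Nonempty (Fin k) := by
    obtain ⟨r, hr, _⟩ := covers hx.1 0
    exact ⟨(shape_of hx hr).choose⟩
  choose! sh hshu hshv using fun r (hr : r ∈ x) => shape_of hx hr
  let Lr : Rhombus → List WangTile := fun r => List.ofFn fun ℓ => tl ℓ r
  have hLr : ∀ r (ℓ : Fin k), (Lr r).getD ℓ (0, 0, 0, 0) = tl ℓ r := by
    intro r ℓ
    simp [Lr, List.getD_eq_getElem?_getD]
  let C : Rhombus → ColoredRhombus := fun r => ⟨r, fun j => pcol shapes r j (Lr r)⟩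
  have herase : eraseColors (C '' x) = x := by
    ext r
    simp [eraseColors, C]
  refine ⟨C '' x, ⟨by rw [herase]; exact hx.1, ?_, ?_⟩, ?_, by rw [herase]; exact hxX⟩
  · rintro _ ⟨r, hr, rfl⟩ _ ⟨s, hs, rfl⟩ e
    simp only [C] at e
    rw [e]
  · rintro _ ⟨r, hr, rfl⟩ _ ⟨s, hs, rfl⟩ hne i j e
    simp only [C] at e ⊢
    simp only [pcol, hLr]
    congr 1
    exact List.map_congr_left fun ℓ _ => match0 r hr s hs i j e ℓ
  · rintro _ ⟨r, hr, rfl⟩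
    refine ⟨symb shapes (sh r) (Lr r), ?_, ⟨hshu r hr, hshv r hr⟩, ?_⟩
    · simp only [red, List.mem_flatMap, List.mem_map]
      refine ⟨sh r, List.mem_finRange _, Lr r, mem_tup.2 ⟨by simp [Lr], ?_⟩, rfl⟩
      intro t ht
      simp only [Lr, List.mem_ofFn] at ht
      obtain ⟨ℓ, rfl⟩ := ht
      exact hf _
    · funext j
      rw [symb_colors]
      simp only [C, pcol, cd_same (hshu r hr) (hshv r hr)]

theorem wang_reduces (hval : ∀ i, (shapes i).IsValid) {X : Set (Set Rhombus)}
    (hX : ∀ x ∈ X, IsTilingOn (range shapes) x) (hne : X.Nonempty) :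
    ManyOneReducible WangDomino (DominoPred shapes X) := by
  obtain ⟨x, hx⟩ := hne
  exact ⟨red shapes, (red_primrec shapes).to_comp, fun W =>
    ⟨complete hval hx (hX x hx) W, sound hval hX W⟩⟩

end Red
end

open Set Metric
section

namespace Geo
variable {k : ℕ} {shapes : Fin k → Rhombus}

/-- a set of tiles whose coronas are all genuine contains a tiling -/
theorem gen_tiling (hval : ∀ i, (shapes i).IsValid) {Y : Set Rhombus} (hne : Y.Nonempty)
    (gen : ∀ r ∈ Y, ∃ x, IsTilingOn (range shapes) x ∧ r ∈ x ∧ {s | s ∈ Y ∧ SV r s} = corona x r) :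
    ∃ Y', Y' ⊆ Y ∧ IsTilingOn (range shapes) Y' := by
  classical
  choose! X hX hXr hXc using gen
  obtain ⟨ε, hε, hstar⟩ := uniform_star hval
  have mem_c : ∀ r ∈ Y, ∀ s, (s ∈ Y ∧ SV r s) ↔ (s ∈ X r ∧ SV r s) := by
    intro r hr s
    have := Set.ext_iff.1 (hXc r hr) s
    exact this
  let F : Rhombus → Pt → Set Rhombus := fun r q => {t | t ∈ Y ∧ SV t r ∧ q ∈ t.support}
  have key : ∀ r ∈ Y, ∀ s ∈ Y, SV r s → ∀ q, (∃ p ∈ r.support, dist p q < ε) →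
      (∃ p ∈ s.support, dist p q < ε) → F r q ⊆ F s q := by
    rintro r hr s hs hrs q ⟨p, hp, hpq⟩ ⟨p', hp', hpq'⟩ t ⟨ht, htr, htq⟩
    obtain ⟨v, hv⟩ := hstar _ (hX r hr) q
    have hsX := ((mem_c r hr s).1 ⟨hs, hrs⟩).1
    have htX := ((mem_c r hr t).1 ⟨ht, htr.symm⟩).1
    exact ⟨ht, ⟨v, hv t htX q htq (by simpa using hε), hv s hsX p' hp' hpq'⟩, htq⟩
  have key2 : ∀ r ∈ Y, ∀ s ∈ Y, SV r s → ∀ q, (∃ p ∈ r.support, dist p q < ε) →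
      (∃ p ∈ s.support, dist p q < ε) → F r q = F s q := fun r hr s hs h q h1 h2 =>
    (key r hr s hs h q h1 h2).antisymm (key s hs r hr h.symm q h2 h1)
  have selfF : ∀ r ∈ Y, ∀ q ∈ r.support, r ∈ F r q := fun r hr q hq => ⟨hr, SV.refl r, hq⟩
  have neF : ∀ r ∈ Y, ∀ q, (∃ p ∈ r.support, dist p q < ε) → ∃ t, t ∈ F r q := by
    rintro r hr q ⟨p, hp, hpq⟩
    obtain ⟨v, hv⟩ := hstar _ (hX r hr) q
    obtain ⟨t, ht, htq⟩ := covers (hX r hr).1 q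
    have sv : SV r t := ⟨v, hv r (hXr r hr) p hp hpq, hv t ht q htq (by simpa using hε)⟩
    exact ⟨t, ((mem_c r hr t).2 ⟨ht, sv⟩).1, sv.symm, htq⟩
  -- the covering space
  let Z : Type := {z : Pt × Set Rhombus // ∃ r ∈ Y, z.1 ∈ r.support ∧ z.2 = F r z.1}
  have inF : ∀ r ∈ Y, ∀ p, p ∈ r.support → ∀ t ∈ F r p, F t p = F r p := by
    intro r hr p hp t ht
    exact key2 t ht.1 r hr ht.2.1 p ⟨p, ht.2.2, by simpa using hε⟩ ⟨p, hp, by simpa using hε⟩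
  let rep : Z → Rhombus := fun z => z.2.choose
  have hrep : ∀ z : Z, rep z ∈ Y ∧ z.1.1 ∈ (rep z).support ∧ z.1.2 = F (rep z) z.1.1 :=
    fun z => z.2.choose_spec
  have hZ : ∀ (z : Z) (q : Pt), dist z.1.1 q < ε → ∃ r ∈ Y, q ∈ r.support ∧ F (rep z) q = F r q := by
    intro z q hq
    obtain ⟨h1, h2, h3⟩ := hrep z
    obtain ⟨t, ht⟩ := neF _ h1 q ⟨_, h2, hq⟩
    exact ⟨t, ht.1, ht.2.2, key2 _ h1 _ ht.1 ht.2.1.symm q ⟨_, h2, hq⟩ ⟨q, ht.2.2, by simpa using hε⟩⟩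
  let T : Z → Pt → Z := fun z q => if h : dist z.1.1 q < ε then ⟨(q, F (rep z) q), hZ z q h⟩ else z
  have hT : ∀ z q, dist z.1.1 q < ε → (T z q).1 = (q, F (rep z) q) := by
    intro z q h; simp only [T, dif_pos h]
  have hT' : ∀ z : Z, ∀ r ∈ z.1.2, r ∈ Y ∧ z.1.1 ∈ r.support ∧ z.1.2 = F r z.1.1 ∧
      ∀ q, dist z.1.1 q < ε → (T z q).1 = (q, F r q) := by
    intro z r hr
    obtain ⟨h1, h2, h3⟩ := hrep z
    have hr' := hr
    rw [h3] at hr'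
    refine ⟨hr'.1, hr'.2.2, by rw [inF _ h1 _ h2 r hr', h3], fun q hq => ?_⟩
    rw [hT z q hq, key2 _ h1 r hr'.1 hr'.2.1.symm q ⟨_, h2, hq⟩ ⟨_, hr'.2.2, hq⟩]
  have neZ : ∀ z : Z, ∃ r, r ∈ z.1.2 := by
    intro z
    obtain ⟨h1, h2, h3⟩ := hrep z
    exact ⟨rep z, by rw [h3]; exact selfF _ h1 _ h2⟩
  obtain ⟨r0, hr0⟩ := hne
  let z0 : Z := ⟨(r0.pos, F r0 r0.pos), r0, hr0, vertices_subset _ Par.base.vertex, rfl⟩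
  obtain ⟨s, hs1, -, hs3⟩ := monodromy (fun z : Z => z.1.1) T hε
    (by intro z q h; simp only [hT z q h])
    (by
      intro z
      apply Subtype.ext
      obtain ⟨h1, h2, h3⟩ := hrep z
      rw [hT z _ (by simpa using hε), ← h3])
    (by
      intro z q q' h1 h2 h3
      apply Subtype.ext
      obtain ⟨r, hr⟩ := neZ z
      obtain ⟨a1, a2, a3, a4⟩ := hT' z r hr
      obtain ⟨t, ht⟩ := neZ (T z q)
      obtain ⟨b1, b2, b3, b4⟩ := hT' (T z q) t ht
      have e1 : (T z q).1.1 = q := by rw [a4 q (by assumption)]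
      rw [e1] at b2 b4
      rw [b4 q' (by assumption), a4 q' (by assumption)]
      congr 1
      rw [a4 q (by assumption)] at ht
      exact key2 t b1 r a1 ht.2.1 q' ⟨q, b2, by assumption⟩ ⟨_, a2, by assumption⟩)
    z0
  have hs1' : ∀ p, (s p).1.1 = p := hs1
  have near : ∀ p, ∀ r ∈ (s p).1.2, ∀ q, dist p q < ε / 4 → (s q).1.2 = F r q := by
    intro p r hr q hq
    have := (hT' (s p) r hr).2.2.2 q (by rw [hs1']; linarith)
    rw [hs3 p q hq] at this
    rw [this]
  have props : ∀ p, ∀ r ∈ (s p).1.2, r ∈ Y ∧ p ∈ r.support ∧ (s p).1.2 = F r p := by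
    intro p r hr
    have := hT' (s p) r hr
    rw [hs1'] at this
    exact ⟨this.1, this.2.1, this.2.2.1⟩
  have spread : ∀ p, ∀ r ∈ (s p).1.2, ∀ q ∈ r.support, r ∈ (s q).1.2 := by
    intro p r hr q hq
    obtain ⟨hrY, hp, -⟩ := props p r hr
    obtain ⟨N, hN, -, hst⟩ := subdivide (η := ε / 4) (by linarith) p q
    have hN' : (0 : ℝ) < N := by exact_mod_cast hN
    have main : ∀ j : ℕ, j ≤ N → r ∈ (s (p + ((j : ℝ) / N) • (q - p))).1.2 := by
      intro j
      induction j with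
      | zero => intro _; simpa using hr
      | succ j ih =>
        intro hj
        rw [near _ r (ih (by omega)) _ (hst j)]
        refine selfF r hrY _ ?_
        refine (support_convex r).add_smul_sub_mem hp hq ⟨by positivity, ?_⟩
        rw [div_le_one hN']
        exact_mod_cast hj
    have := main N le_rfl
    rw [div_self hN'.ne'] at this
    simpa using this
  refine ⟨{r | ∃ p, r ∈ (s p).1.2}, ?_, ⟨?_, ?_, ?_⟩, ?_⟩
  · rintro r ⟨p, hr⟩; exact (props p r hr).1
  · rintro r ⟨p, hr⟩
    have := (props p r hr).1
    exact (hX r this).1.1 r (hXr r this)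
  · rw [eq_univ_iff_forall]
    intro p
    obtain ⟨r, hr⟩ := neZ (s p)
    simp only [mem_iUnion]
    exact ⟨r, ⟨p, hr⟩, (props p r hr).2.1⟩
  · rintro r ⟨p, hr⟩ t ⟨p', ht⟩ hne
    by_cases hemp : r.support ∩ t.support = ∅
    · exact Or.inl hemp
    obtain ⟨q, hq1, hq2⟩ := nonempty_iff_ne_empty.2 hemp
    have m1 := spread p r hr q hq1
    have m2 := spread p' t ht q hq2
    obtain ⟨hrY, -, e⟩ := props q r m1
    rw [e] at m2
    have := ((mem_c r hrY t).1 ⟨m2.1, m2.2.1.symm⟩).1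
    exact (hX r hrY).1.2.2 r (hXr r hrY) t this hne
  · rintro r ⟨p, hr⟩
    have := (props p r hr).1
    exact (hX r this).2 r (hXr r this)

end Geo
end

open Set Metric
section

namespace IntP
variable {α : Type} [Primcodable α]

theorem enc_nonneg (n : ℕ) : Encodable.encode (n : ℤ) = 2 * n := rfl
theorem enc_neg (n : ℕ) : Encodable.encode (Int.negSucc n) = 2 * n + 1 := rfl

theorem toNat_primrec : Primrec (fun z : ℤ => z.toNat) := by
  have : Primrec (fun z : ℤ => if Encodable.encode z % 2 = 0 then Encodable.encode z / 2 else 0) := by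
    refine Primrec.ite ?_ ?_ (Primrec.const 0)
    · exact Primrec.eq.comp (Primrec.nat_mod.comp Primrec.encode (Primrec.const 2)) (Primrec.const 0)
    · exact Primrec.nat_div.comp Primrec.encode (Primrec.const 2)
  refine this.of_eq fun z => ?_
  cases z with
  | ofNat n => rw [show Int.ofNat n = (n : ℤ) from rfl, enc_nonneg]; simp
  | negSucc n => rw [enc_neg, if_neg (by omega)]; simp

theorem negNat_primrec : Primrec (fun z : ℤ => (-z).toNat) := by
  have : Primrec (fun z : ℤ => if Encodable.encode z % 2 = 0 then 0 else Encodable.encode z / 2 + 1) := by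
    refine Primrec.ite ?_ (Primrec.const 0) ?_
    · exact Primrec.eq.comp (Primrec.nat_mod.comp Primrec.encode (Primrec.const 2)) (Primrec.const 0)
    · exact Primrec.succ.comp (Primrec.nat_div.comp Primrec.encode (Primrec.const 2))
  refine this.of_eq fun z => ?_
  cases z with
  | ofNat n => rw [show Int.ofNat n = (n : ℤ) from rfl, enc_nonneg]; simp
  | negSucc n =>
    rw [enc_neg, if_neg (by omega)]
    have : (-Int.negSucc n).toNat = n + 1 := by simp
    omega

theorem sub_primrec : Primrec₂ (fun a b : ℕ => (a : ℤ) - b) := by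
  have : Primrec₂ (fun a b : ℕ => if b ≤ a then Denumerable.ofNat ℤ (2 * (a - b))
      else Denumerable.ofNat ℤ (2 * (b - a - 1) + 1)) := by
    refine Primrec.ite ?_ ?_ ?_
    · exact Primrec.nat_le.comp Primrec.snd Primrec.fst
    · exact (Primrec.ofNat ℤ).comp (Primrec.nat_mul.comp (Primrec.const 2)
        (Primrec.nat_sub.comp Primrec.fst Primrec.snd))
    · exact (Primrec.ofNat ℤ).comp (Primrec.succ.comp (Primrec.nat_mul.comp (Primrec.const 2)
        (Primrec.nat_sub.comp (Primrec.nat_sub.comp Primrec.snd Primrec.fst) (Primrec.const 1))))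
  refine Primrec.of_eq this fun x => ?_
  obtain ⟨a, b⟩ := x
  dsimp only
  split_ifs with h
  · rw [← enc_nonneg, Denumerable.ofNat_encode]; omega
  · rw [← enc_neg, Denumerable.ofNat_encode]; omega

theorem add_primrec : Primrec₂ (fun a b : ℤ => a + b) := by
  have := sub_primrec.comp
    (Primrec.nat_add.comp (toNat_primrec.comp (Primrec.fst (α := ℤ) (β := ℤ))) (toNat_primrec.comp Primrec.snd))
    (Primrec.nat_add.comp (negNat_primrec.comp (Primrec.fst (α := ℤ) (β := ℤ))) (negNat_primrec.comp Primrec.snd))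
  refine Primrec.of_eq this fun x => ?_
  obtain ⟨a, b⟩ := x
  dsimp only
  push_cast
  omega

theorem mul_primrec : Primrec₂ (fun a b : ℤ => a * b) := by
  have f1 := toNat_primrec.comp (Primrec.fst (α := ℤ) (β := ℤ))
  have f2 := negNat_primrec.comp (Primrec.fst (α := ℤ) (β := ℤ))
  have g1 := toNat_primrec.comp (Primrec.snd (α := ℤ) (β := ℤ))
  have g2 := negNat_primrec.comp (Primrec.snd (α := ℤ) (β := ℤ))
  have := sub_primrec.comp
    (Primrec.nat_add.comp (Primrec.nat_mul.comp f1 g1) (Primrec.nat_mul.comp f2 g2))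
    (Primrec.nat_add.comp (Primrec.nat_mul.comp f1 g2) (Primrec.nat_mul.comp f2 g1))
  refine Primrec.of_eq this fun x => ?_
  obtain ⟨a, b⟩ := x
  dsimp only
  have ha : a = (a.toNat : ℤ) - ((-a).toNat : ℤ) := by omega
  have hb : b = (b.toNat : ℤ) - ((-b).toNat : ℤ) := by omega
  conv_rhs => rw [ha, hb]
  push_cast
  ring

theorem gadd_primrec {m : ℕ} : Primrec₂ (fun a b : Fin m → ℤ => a + b) := by
  refine Primrec.fin_curry.2 ?_
  exact add_primrec.comp (Primrec.fin_app.comp (Primrec.fst.comp Primrec.fst) Primrec.snd)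
    (Primrec.fin_app.comp (Primrec.snd.comp Primrec.fst) Primrec.snd)

theorem gsmul_primrec {m : ℕ} : Primrec₂ (fun (n : ℤ) (b : Fin m → ℤ) => n • b) := by
  refine Primrec.fin_curry.2 ?_
  refine (mul_primrec.comp (Primrec.fst.comp Primrec.fst)
    (Primrec.fin_app.comp (Primrec.snd.comp Primrec.fst) Primrec.snd)).of_eq fun x => ?_
  simp

/-- integer coordinates for finitely many vectors -/
theorem coords {E ι : Type} [AddCommGroup E] [Module ℝ E] [Finite ι] (g : ι → E) :
    ∃ (m : ℕ) (vec : (Fin m → ℤ) →+ E), Function.Injective vec ∧ ∀ i, ∃ z, vec z = g i := by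
  let A : Submodule ℤ E := Submodule.span ℤ (range g)
  have : Module.Finite ℤ A := Module.Finite.span_of_finite ℤ (finite_range g)
  have : IsAddTorsionFree E := by
    refine ⟨fun n hn a b hab => ?_⟩
    have h : (n : ℝ) • a = (n : ℝ) • b := by
      rw [Nat.cast_smul_eq_nsmul, Nat.cast_smul_eq_nsmul]; exact hab
    exact smul_right_injective E (Nat.cast_ne_zero.2 hn) h
  have : Module.IsTorsionFree ℤ A := inferInstance
  have : Module.Free ℤ A := inferInstance
  let b := Module.finBasis ℤ A
  refine ⟨_, A.subtype.toAddMonoidHom.comp b.equivFun.symm.toLinearMap.toAddMonoidHom, ?_, ?_⟩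
  · exact Subtype.val_injective.comp b.equivFun.symm.injective
  · intro i
    refine ⟨b.equivFun ⟨g i, Submodule.subset_span ⟨i, rfl⟩⟩, ?_⟩
    simp

end IntP
end

open Set Metric
section

namespace Cpt
variable {α σ τ : Type} [Primcodable α] [Primcodable σ] [Primcodable τ]

/-- all sublists -/
def subl : List τ → List (List τ) := fun l =>
  List.rec [[]] (fun t _ r => r ++ r.map (fun c => t :: c)) l

theorem subl_primrec : Primrec (subl (τ := τ)) := by
  refine Primrec.list_rec (f := fun l : List τ => l) (g := fun _ => [[]])
    (h := fun _ x => x.2.2 ++ x.2.2.map (fun c => x.1 :: c)) Primrec.id (Primrec.const _) ?_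
  have h1 : Primrec fun y : List τ × τ × List τ × List (List τ) => y.2.2.2 :=
    Primrec.snd.comp (Primrec.snd.comp Primrec.snd)
  refine Primrec.list_append.comp h1 (Primrec.list_map h1 ?_)
  exact Primrec.list_cons.comp (Primrec.fst.comp (Primrec.snd.comp Primrec.fst)) Primrec.snd

theorem subl_spec (S : Set τ) (l : List τ) : ∃ c ∈ subl l, (∀ t ∈ c, t ∈ S) ∧ ∀ t ∈ l, t ∈ S → t ∈ c := by
  induction l with
  | nil => exact ⟨[], by simp [subl], by simp, by simp⟩
  | cons t l ih =>
    obtain ⟨c, hc, h1, h2⟩ := ih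
    by_cases ht : t ∈ S
    · refine ⟨t :: c, List.mem_append_right _ (List.mem_map.2 ⟨c, hc, rfl⟩), ?_, ?_⟩
      · intro t' h'
        rcases List.mem_cons.1 h' with rfl | h'
        · exact ht
        · exact h1 _ h'
      · intro t' h' hS
        rcases List.mem_cons.1 h' with rfl | h'
        · simp
        · exact List.mem_cons_of_mem _ (h2 _ h' hS)
    · refine ⟨c, List.mem_append_left _ hc, h1, ?_⟩
      intro t' h' hS
      rcases List.mem_cons.1 h' with rfl | h'
      · exact absurd hS ht
      · exact h2 _ h' hS

/-- the first values of a sequence -/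
def firsts (D : ℕ → σ) : ℕ → List σ := fun n => Nat.rec [] (fun n l => D n :: l) n

theorem mem_firsts {D : ℕ → σ} {n : ℕ} {s : σ} : s ∈ firsts D n ↔ ∃ i < n, s = D i := by
  induction n with
  | zero => simp [firsts]
  | succ n ih =>
    have : firsts D (n + 1) = D n :: firsts D n := rfl
    rw [this, List.mem_cons, ih]
    constructor
    · rintro (h | ⟨i, hi, h⟩)
      · exact ⟨n, by omega, h⟩
      · exact ⟨i, by omega, h⟩
    · rintro ⟨i, hi, h⟩
      rcases Nat.lt_succ_iff_lt_or_eq.1 hi with h' | rfl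
      · exact Or.inr ⟨i, h', h⟩
      · exact Or.inl h

theorem firsts_computable {D : ℕ → σ} (hD : Computable D) : Computable (firsts D) := by
  refine Computable.nat_rec (f := fun n : ℕ => n) (g := fun _ => []) (h := fun _ x => D x.1 :: x.2)
    Computable.id (Computable.const _) ?_
  exact Computable.list_cons.comp (hD.comp (Computable.fst.comp Computable.snd))
    (Computable.snd.comp Computable.snd)

/-- existence of a set subject to computably many local constraints is co-c.e. -/
theorem pi01_compact {D : ℕ → σ} (hD : Computable D) (K : α → σ → Set τ → Prop)
    (U : α → σ → List τ) (hU : Primrec₂ U)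
    (hloc : ∀ a s S S', (∀ t ∈ U a s, t ∈ S ↔ t ∈ S') → (K a s S → K a s S'))
    (hK : PrimrecPred fun x : (α × List τ) × σ => K x.1.1 x.2 {t | t ∈ x.1.2}) :
    Pi01 fun a => ∃ S, ∀ i, K a (D i) S := by
  classical
  let P : α × List σ → Prop := fun x =>
    ∃ c ∈ subl (x.2.flatMap (U x.1)), ∀ s ∈ x.2, K x.1 s {t | t ∈ c}
  have hP : PrimrecPred P := by
    refine PR.ex_mem ?_ ?_
    · refine subl_primrec.comp (Primrec.list_flatMap Primrec.snd ?_)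
      exact hU.comp (Primrec.fst.comp Primrec.fst) Primrec.snd
    · refine PR.all_mem (f := fun x : (α × List σ) × List τ => x.1.2)
        (p := fun x s => K x.1.1 s {t | t ∈ x.2}) (Primrec.snd.comp Primrec.fst) ?_
      exact hK.comp (Primrec.pair (Primrec.pair (Primrec.fst.comp (Primrec.fst.comp Primrec.fst))
        (Primrec.snd.comp Primrec.fst)) Primrec.snd)
  refine ⟨fun a n => decide (P (a, firsts D n)), ?_, fun a => ?_⟩
  · exact hP.decide.to_comp.comp (Computable.pair Computable.fst ((firsts_computable hD).comp Computable.snd))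
  simp only [decide_eq_true_eq]
  constructor
  · rintro ⟨S, hS⟩ n
    obtain ⟨c, hc, h1, h2⟩ := subl_spec S ((firsts D n).flatMap (U a))
    refine ⟨c, hc, fun s hs => ?_⟩
    obtain ⟨i, hi, rfl⟩ := mem_firsts.1 hs
    refine hloc a _ S _ (fun t ht => ⟨fun h => ?_, fun h => h1 t h⟩) (hS i)
    exact h2 t (List.mem_flatMap.2 ⟨_, hs, ht⟩) h
  · intro h
    choose c _ hc using h
    let S : Set τ := {v | ∀ᶠ n in (Filter.hyperfilter ℕ : Filter ℕ), v ∈ c n}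
    refine ⟨S, fun i => ?_⟩
    have h1 : ∀ t, ∀ᶠ n in (Filter.hyperfilter ℕ : Filter ℕ), (t ∈ c n ↔ t ∈ S) := by
      intro t
      by_cases ht : t ∈ S
      · have ht' : ∀ᶠ n in (Filter.hyperfilter ℕ : Filter ℕ), t ∈ c n := ht
        exact ht'.mono fun n hn => iff_of_true hn ht
      · have ht' : ¬ ∀ᶠ n in (Filter.hyperfilter ℕ : Filter ℕ), t ∈ c n := ht
        exact (Ultrafilter.eventually_not.2 ht').mono fun n hn => iff_of_false hn ht
    have h2 : ∀ l : List τ, ∀ᶠ n in (Filter.hyperfilter ℕ : Filter ℕ), ∀ t ∈ l, (t ∈ c n ↔ t ∈ S) := by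
      intro l
      induction l with
      | nil => simp
      | cons t l ih =>
        filter_upwards [h1 t, ih] with n a1 a2
        intro t' ht'
        rcases List.mem_cons.1 ht' with rfl | ht'
        · exact a1
        · exact a2 _ ht'
    have h3 : ∀ᶠ n in (Filter.hyperfilter ℕ : Filter ℕ), i < n :=
      Nat.hyperfilter_le_atTop (Filter.eventually_gt_atTop i)
    obtain ⟨n, hn1, hn2⟩ := ((h2 (U a (D i))).and h3).exists
    exact hloc a _ {t | t ∈ c n} S hn1 (hc n _ (mem_firsts.2 ⟨i, hn2, rfl⟩))

end Cpt
end

open Set Metric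
section

namespace Con

/-- finite data for the local constraints -/
structure Dat (k m : ℕ) where
  sm : Fin k → Fin k → Prop
  rel : Fin k → List (Fin k × (Fin m → ℤ))
  tab : Fin k → List (Set (Fin k × (Fin m → ℤ)))
  ed : List (Fin k × Fin k × (Fin m → ℤ) × Fin 4 × Fin 4)
  pt : Fin k × Disp k → (Fin m → ℤ)

variable {k m : ℕ} (d : Dat k m)

/-- a tile of shape `i` is present at `z` -/
def Occ (T : List (SymbTile k)) (S : Set (SymbTile k × (Fin m → ℤ))) (i : Fin k) (z : Fin m → ℤ) : Prop :=
  ∃ p ∈ T, d.sm p.1 i ∧ (p, z) ∈ S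

/-- the local constraints around `z` -/
structure K (T : List (SymbTile k)) (s : (Fin m → ℤ) × PatternCode k)
    (S : Set (SymbTile k × (Fin m → ℤ))) : Prop where
  a : s.1 = 0 → ∃ p ∈ T, (p, s.1) ∈ S
  b : ∀ p ∈ T, ∀ q ∈ T, d.sm p.1 q.1 → (p, s.1) ∈ S → (q, s.1) ∈ S → p.2 = q.2
  c : ∀ e ∈ d.ed, ∀ p ∈ T, ∀ q ∈ T, p.1 = e.1 → q.1 = e.2.1 → (p, s.1) ∈ S →
    (q, s.1 + e.2.2.1) ∈ S → SymbTile.colors p e.2.2.2.1 = SymbTile.colors q e.2.2.2.2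
  g : ∀ i ∈ List.finRange k, ∀ p ∈ T, p.1 = i → (p, s.1) ∈ S → ∃ κ ∈ d.tab i,
    ∀ e ∈ d.rel i, (Occ d T S e.1 (s.1 + e.2) ↔ e ∈ κ)
  e : ¬ ∀ e ∈ s.2, Occ d T S e.1 (s.1 + d.pt e)

/-- the positions the constraints depend on -/
def pos (s : (Fin m → ℤ) × PatternCode k) : List (Fin m → ℤ) :=
  s.1 :: (d.ed.map (fun e => s.1 + e.2.2.1) ++
    ((List.finRange k).flatMap fun i => (d.rel i).map fun e => s.1 + e.2) ++
    s.2.map fun e => s.1 + d.pt e)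

theorem K_local (T : List (SymbTile k)) (s : (Fin m → ℤ) × PatternCode k)
    (S S' : Set (SymbTile k × (Fin m → ℤ))) (h : ∀ t ∈ T ×ˢ pos d s, t ∈ S ↔ t ∈ S')
    (hK : K d T s S) : K d T s S' := by
  have h' : ∀ p ∈ T, ∀ z ∈ pos d s, ((p, z) ∈ S ↔ (p, z) ∈ S') := fun p hp z hz =>
    h _ (List.mem_product.2 ⟨hp, hz⟩)
  have h0 : s.1 ∈ pos d s := by simp [pos]
  have hO : ∀ i, ∀ z ∈ pos d s, (Occ d T S i z ↔ Occ d T S' i z) := by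
    intro i z hz
    constructor
    · rintro ⟨p, hp, h1, h2⟩; exact ⟨p, hp, h1, (h' p hp z hz).1 h2⟩
    · rintro ⟨p, hp, h1, h2⟩; exact ⟨p, hp, h1, (h' p hp z hz).2 h2⟩
  refine ⟨?_, ?_, ?_, ?_, ?_⟩
  · intro hz
    obtain ⟨p, hp, h1⟩ := hK.a hz
    exact ⟨p, hp, (h' p hp _ h0).1 h1⟩
  · intro p hp q hq h1 h2 h3
    exact hK.b p hp q hq h1 ((h' p hp _ h0).2 h2) ((h' q hq _ h0).2 h3)
  · intro e he p hp q hq h1 h2 h3 h4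
    refine hK.c e he p hp q hq h1 h2 ((h' p hp _ h0).2 h3) ((h' q hq _ ?_).2 h4)
    refine List.mem_cons_of_mem _ (List.mem_append_left _ (List.mem_append_left _ ?_))
    exact List.mem_map.2 ⟨e, he, rfl⟩
  · intro i hi p hp h1 h2
    obtain ⟨κ, hκ, h3⟩ := hK.g i hi p hp h1 ((h' p hp _ h0).2 h2)
    refine ⟨κ, hκ, fun e he => ?_⟩
    rw [← h3 e he]
    refine (hO _ _ ?_).symm
    refine List.mem_cons_of_mem _ (List.mem_append_left _ (List.mem_append_right _ ?_))
    exact List.mem_flatMap.2 ⟨i, hi, List.mem_map.2 ⟨e, he, rfl⟩⟩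
  · intro hall
    refine hK.e fun e he => (hO _ _ ?_).2 (hall e he)
    refine List.mem_cons_of_mem _ (List.mem_append_right _ ?_)
    exact List.mem_map.2 ⟨e, he, rfl⟩

variable {β : Type} [Primcodable β]

theorem colors_primrec (j : Fin 4) : Primrec fun p : SymbTile k => SymbTile.colors p j := by
  fin_cases j
  · exact Primrec.fst.comp Primrec.snd
  · exact Primrec.fst.comp (Primrec.snd.comp Primrec.snd)
  · exact Primrec.fst.comp (Primrec.snd.comp (Primrec.snd.comp Primrec.snd))
  · exact Primrec.snd.comp (Primrec.snd.comp (Primrec.snd.comp Primrec.snd))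

theorem fin_rel (R : Fin k → Fin k → Prop) : PrimrecRel R := by
  classical
  exact Primrec.primrecPred (Primrec.dom_finite (fun x : Fin k × Fin k => decide (R x.1 x.2)))

theorem occ_primrec {fT : β → List (SymbTile k)} {fc : β → List (SymbTile k × (Fin m → ℤ))}
    {fi : β → Fin k} {fz : β → Fin m → ℤ} (hT : Primrec fT) (hc : Primrec fc) (hi : Primrec fi)
    (hz : Primrec fz) : PrimrecPred fun x => Occ d (fT x) {t | t ∈ fc x} (fi x) (fz x) := by
  refine PR.ex_mem (f := fT) (p := fun x p => d.sm p.1 (fi x) ∧ (p, fz x) ∈ fc x) hT ?_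
  refine PrimrecPred.and ?_ ?_
  · exact (fin_rel d.sm).comp (Primrec.fst.comp Primrec.snd) (hi.comp Primrec.fst)
  · exact PR.mem (hc.comp Primrec.fst) (Primrec.pair Primrec.snd (hz.comp Primrec.fst))

theorem iffP {p q : β → Prop} (hp : PrimrecPred p) (hq : PrimrecPred q) :
    PrimrecPred fun a => p a ↔ q a := by
  refine ((PR.imp hp hq).and (PR.imp hq hp)).of_eq fun a => ?_
  tauto

theorem pos_primrec (hpt : Primrec d.pt) : Primrec (pos d) := by
  refine Primrec.list_cons.comp Primrec.fst (Primrec.list_append.comp (Primrec.list_append.comp ?_ ?_) ?_)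
  · refine PR.map_fixed _ fun e _ => ?_
    exact IntP.gadd_primrec.comp Primrec.fst (Primrec.const _)
  · refine PR.flatMap_fixed _ fun i _ => PR.map_fixed _ fun e _ => ?_
    exact IntP.gadd_primrec.comp Primrec.fst (Primrec.const _)
  · refine Primrec.list_map Primrec.snd ?_
    exact IntP.gadd_primrec.comp (Primrec.fst.comp Primrec.fst) (hpt.comp Primrec.snd)

theorem K_primrec (hpt : Primrec d.pt) :
    PrimrecPred fun x : (List (SymbTile k) × List (SymbTile k × (Fin m → ℤ))) ×
      ((Fin m → ℤ) × PatternCode k) => K d x.1.1 x.2 {t | t ∈ x.1.2} := by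
  let B := (List (SymbTile k) × List (SymbTile k × (Fin m → ℤ))) × ((Fin m → ℤ) × PatternCode k)
  have fT : Primrec fun x : B => x.1.1 := Primrec.fst.comp Primrec.fst
  have fc : Primrec fun x : B => x.1.2 := Primrec.snd.comp Primrec.fst
  have fz : Primrec fun x : B => x.2.1 := Primrec.fst.comp Primrec.snd
  have ff : Primrec fun x : B => x.2.2 := Primrec.snd.comp Primrec.snd
  have ha : PrimrecPred fun x : B => x.2.1 = 0 → ∃ p ∈ x.1.1, (p, x.2.1) ∈ x.1.2 := by
    refine PR.imp (Primrec.eq.comp fz (Primrec.const _)) (PR.ex_mem fT ?_)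
    exact PR.mem (fc.comp Primrec.fst) (Primrec.pair Primrec.snd (fz.comp Primrec.fst))
  have hb : PrimrecPred fun x : B => ∀ p ∈ x.1.1, ∀ q ∈ x.1.1, d.sm p.1 q.1 → (p, x.2.1) ∈ x.1.2 →
      (q, x.2.1) ∈ x.1.2 → p.2 = q.2 := by
    refine PR.all_mem fT (PR.all_mem (f := fun y : B × SymbTile k => y.1.1.1)
      (p := fun y q => d.sm y.2.1 q.1 → (y.2, y.1.2.1) ∈ y.1.1.2 →
      (q, y.1.2.1) ∈ y.1.1.2 → y.2.2 = q.2) (fT.comp Primrec.fst) ?_)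
    have f1 := Primrec.fst (α := B × SymbTile k) (β := SymbTile k)
    have fp := Primrec.snd.comp f1
    have fq := Primrec.snd (α := B × SymbTile k) (β := SymbTile k)
    have f11 := Primrec.fst.comp f1
    refine PR.imp ((fin_rel d.sm).comp (Primrec.fst.comp fp) (Primrec.fst.comp fq)) ?_
    refine PR.imp (PR.mem (fc.comp f11) (Primrec.pair fp (fz.comp f11))) ?_
    refine PR.imp (PR.mem (fc.comp f11) (Primrec.pair fq (fz.comp f11))) ?_
    exact Primrec.eq.comp (Primrec.snd.comp fp) (Primrec.snd.comp fq)
  have hc : PrimrecPred fun x : B => ∀ e ∈ d.ed, ∀ p ∈ x.1.1, ∀ q ∈ x.1.1, p.1 = e.1 → q.1 = e.2.1 →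
      (p, x.2.1) ∈ x.1.2 → (q, x.2.1 + e.2.2.1) ∈ x.1.2 →
      SymbTile.colors p e.2.2.2.1 = SymbTile.colors q e.2.2.2.2 := by
    refine PR.all_fixed _ fun e _ => ?_
    refine PR.all_mem fT (PR.all_mem (f := fun y : B × SymbTile k => y.1.1.1)
      (p := fun y q => y.2.1 = e.1 → q.1 = e.2.1 → (y.2, y.1.2.1) ∈ y.1.1.2 →
      (q, y.1.2.1 + e.2.2.1) ∈ y.1.1.2 →
      SymbTile.colors y.2 e.2.2.2.1 = SymbTile.colors q e.2.2.2.2) (fT.comp Primrec.fst) ?_)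
    have f1 := Primrec.fst (α := B × SymbTile k) (β := SymbTile k)
    have fp := Primrec.snd.comp f1
    have fq := Primrec.snd (α := B × SymbTile k) (β := SymbTile k)
    have f11 := Primrec.fst.comp f1
    refine PR.imp (Primrec.eq.comp (Primrec.fst.comp fp) (Primrec.const _)) ?_
    refine PR.imp (Primrec.eq.comp (Primrec.fst.comp fq) (Primrec.const _)) ?_
    refine PR.imp (PR.mem (fc.comp f11) (Primrec.pair fp (fz.comp f11))) ?_
    refine PR.imp (PR.mem (fc.comp f11) (Primrec.pair fq
      (IntP.gadd_primrec.comp (fz.comp f11) (Primrec.const _)))) ?_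
    exact Primrec.eq.comp ((colors_primrec _).comp fp) ((colors_primrec _).comp fq)
  have hd : PrimrecPred fun x : B => ∀ i ∈ List.finRange k, ∀ p ∈ x.1.1, p.1 = i → (p, x.2.1) ∈ x.1.2 →
      ∃ κ ∈ d.tab i, ∀ e ∈ d.rel i, (Occ d x.1.1 {t | t ∈ x.1.2} e.1 (x.2.1 + e.2) ↔ e ∈ κ) := by
    refine PR.all_fixed _ fun i _ => ?_
    refine PR.all_mem fT ?_
    refine PR.imp (Primrec.eq.comp (Primrec.fst.comp Primrec.snd) (Primrec.const _)) ?_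
    refine PR.imp (PR.mem (fc.comp Primrec.fst) (Primrec.pair Primrec.snd (fz.comp Primrec.fst))) ?_
    refine PR.ex_fixed _ fun κ _ => PR.all_fixed _ fun e _ => ?_
    refine iffP ?_ (PR.constP _)
    exact occ_primrec d (fT.comp Primrec.fst) (fc.comp Primrec.fst) (Primrec.const _)
      (IntP.gadd_primrec.comp (fz.comp Primrec.fst) (Primrec.const _))
  have he : PrimrecPred fun x : B => ¬ ∀ e ∈ x.2.2, Occ d x.1.1 {t | t ∈ x.1.2} e.1 (x.2.1 + d.pt e) := by
    refine PrimrecPred.not (PR.all_mem ff ?_)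
    exact occ_primrec d (fT.comp Primrec.fst) (fc.comp Primrec.fst) (Primrec.fst.comp Primrec.snd)
      (IntP.gadd_primrec.comp (fz.comp Primrec.fst) (hpt.comp Primrec.snd))
  refine (ha.and (hb.and (hc.and (hd.and he)))).of_eq fun x => ?_
  exact ⟨fun h => ⟨h.1, h.2.1, h.2.2.1, h.2.2.2.1, h.2.2.2.2⟩, fun h => ⟨h.1, h.2, h.3, h.4, h.5⟩⟩

theorem pi01 (hpt : Primrec d.pt) {F : ℕ → PatternCode k} (hF : Computable F) :
    Pi01 fun T : List (SymbTile k) => ∃ S, ∀ z n, K d T (z, F n) S := by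
  let D : ℕ → (Fin m → ℤ) × PatternCode k := fun i =>
    ((@Encodable.decode (Fin m → ℤ) Primcodable.finArrow.toEncodable i.unpair.1).getD 0, F i.unpair.2)
  have hD : Computable D := by
    refine Computable.pair ?_ (hF.comp (Computable.snd.comp Computable.unpair))
    exact (Primrec.option_getD.comp ((Primrec.decode (α := Fin m → ℤ)).comp (Primrec.fst.comp Primrec.unpair))
      (Primrec.const 0)).to_comp
  obtain ⟨f, hf, hf'⟩ := Cpt.pi01_compact hD (K d) (fun T s => T ×ˢ pos d s)
    (PR.product Primrec.fst ((pos_primrec d hpt).comp Primrec.snd)) (K_local d) (K_primrec d hpt)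
  refine ⟨f, hf, fun T => ?_⟩
  rw [← hf' T]
  refine exists_congr fun S => ⟨fun h i => h _ _, fun h z n => ?_⟩
  have := h (Nat.pair (@Encodable.encode (Fin m → ℤ) Primcodable.finArrow.toEncodable z) n)
  simpa [D] using this

end Con
end

open Set Metric
section

namespace Con
open Geo

theorem edge_translate (r : Rhombus) (w : Pt) (j : Fin 4) :
    (r.translate w).edge j = (fun p => w + p) '' r.edge j := by
  fin_cases j <;>
  simp only [Rhombus.edge, Rhombus.translate, Fin.isValue, Fin.zero_eta, Fin.mk_one, Fin.reduceFinMk,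
    Matrix.cons_val, Matrix.cons_val_zero, Matrix.cons_val_one, segment_translate_image] <;>
  congr 1 <;> abel

theorem edge_translate_iff (r s : Rhombus) (w : Pt) (i j : Fin 4) :
    (r.translate w).edge i = (s.translate w).edge j ↔ r.edge i = s.edge j := by
  rw [edge_translate, edge_translate]
  exact (Set.image_injective.2 (add_right_injective w)).eq_iff

theorem translate_inj {r s : Rhombus} {w : Pt} (h : r.translate w = s.translate w) : r = s := by
  have := congrArg (fun r => Rhombus.translate r (-w)) h
  simpa [translate_translate, translate_zero] using this

theorem colors_inj {k : ℕ} {p q : SymbTile k} : SymbTile.colors p = SymbTile.colors q ↔ p.2 = q.2 := by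
  obtain ⟨i, a, b, c, e⟩ := p
  obtain ⟨i', a', b', c', e'⟩ := q
  constructor
  · intro h
    have h0 := congrFun h 0
    have h1 := congrFun h 1
    have h2 := congrFun h 2
    have h3 := congrFun h 3
    simp only [SymbTile.colors, Matrix.cons_val] at h0 h1 h2 h3
    subst h0 h1 h2 h3
    rfl
  · intro h
    cases h
    rfl

/-- integer coordinates adapted to the shapes -/
structure Frame {k : ℕ} (shapes : Fin k → Rhombus) where
  m : ℕ
  vec : (Fin m → ℤ) →+ Pt
  inj : Function.Injective vec
  U : Fin k → (Fin m → ℤ)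
  V : Fin k → (Fin m → ℤ)
  P : Fin k → (Fin m → ℤ)
  hU : ∀ i, vec (U i) = (shapes i).u
  hV : ∀ i, vec (V i) = (shapes i).v
  hP : ∀ i, vec (P i) = (shapes i).pos

theorem exists_frame {k : ℕ} (shapes : Fin k → Rhombus) : Nonempty (Frame shapes) := by
  obtain ⟨m, vec, inj, h⟩ := IntP.coords (E := Pt) (ι := Fin k ⊕ Fin k ⊕ Fin k)
    (Sum.elim (fun i => (shapes i).u) (Sum.elim (fun i => (shapes i).v) (fun i => (shapes i).pos)))
  choose g hg using h
  exact ⟨⟨m, vec, inj, fun i => g (.inl i), fun i => g (.inr (.inl i)), fun i => g (.inr (.inr i)),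
    fun i => hg _, fun i => hg _, fun i => hg _⟩⟩

namespace Frame
variable {k : ℕ} {shapes : Fin k → Rhombus} (f : Frame shapes)

/-- tile of shape `i` at `z` -/
def R (i : Fin k) (z : Fin f.m → ℤ) : Rhombus := ⟨f.vec z, (shapes i).u, (shapes i).v⟩

/-- neighbours -/
def rs (i : Fin k) : Set (Fin k × (Fin f.m → ℤ)) := {e | SV (f.R i 0) (f.R e.1 e.2)}

theorem R_inj {i j : Fin k} {z z' : Fin f.m → ℤ} (h : f.R i z = f.R j z') :
    z = z' ∧ (shapes i).SameShape (shapes j) := by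
  simp only [R, Rhombus.mk.injEq] at h
  exact ⟨f.inj h.1, h.2⟩

theorem R_translate (i : Fin k) (z z' : Fin f.m → ℤ) : (f.R i z).translate (f.vec z') = f.R i (z' + z) := by
  simp [R, Rhombus.translate, add_comm]

theorem R_congr {i j : Fin k} (h : (shapes i).SameShape (shapes j)) (z) : f.R i z = f.R j z := by
  simp [R, h.1, h.2]

theorem rs_finite (i : Fin k) : (f.rs i).Finite := by
  have : (⋃ j : Fin k, (fun z => (j, z)) '' ((f.R j) ⁻¹' (Rel shapes (f.R i 0)))).Finite := by
    refine Set.finite_iUnion fun j => Set.Finite.image _ ?_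
    exact (rel_finite (shapes := shapes) (f.R i 0)).preimage fun z _ z' _ h => (f.R_inj h).1
  refine this.subset ?_
  rintro ⟨j, z⟩ h
  exact mem_iUnion.2 ⟨j, z, ⟨⟨j, rfl, rfl⟩, h⟩, rfl⟩

/-- genuine neighbourhoods -/
def ts (i : Fin k) : Set (Set (Fin k × (Fin f.m → ℤ))) :=
  {κ | ∃ x w, IsTilingOn (range shapes) x ∧ (⟨w, (shapes i).u, (shapes i).v⟩ : Rhombus) ∈ x ∧
    κ = {e | e ∈ f.rs i ∧ (⟨w + f.vec e.2, (shapes e.1).u, (shapes e.1).v⟩ : Rhombus) ∈ x}}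

theorem ts_finite (i : Fin k) : (f.ts i).Finite := by
  refine (f.rs_finite i).finite_subsets.subset ?_
  rintro κ ⟨x, w, -, -, rfl⟩
  exact fun e he => he.1

/-- edge coincidences -/
def es : Set (Fin k × Fin k × (Fin f.m → ℤ) × Fin 4 × Fin 4) :=
  {e | (e.2.1, e.2.2.1) ∈ f.rs e.1 ∧ f.R e.1 0 ≠ f.R e.2.1 e.2.2.1 ∧
    (f.R e.1 0).edge e.2.2.2.1 = (f.R e.2.1 e.2.2.1).edge e.2.2.2.2}

theorem es_finite : f.es.Finite := by
  have : (⋃ i : Fin k, (fun y : (Fin k × (Fin f.m → ℤ)) × Fin 4 × Fin 4 => (i, y.1.1, y.1.2, y.2)) ''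
      (f.rs i ×ˢ univ)).Finite :=
    Set.finite_iUnion fun i => ((f.rs_finite i).prod finite_univ).image _
  refine this.subset ?_
  rintro ⟨i, j, z, a, b⟩ h
  exact mem_iUnion.2 ⟨i, ((j, z), a, b), ⟨h.1, mem_univ _⟩, rfl⟩

/-- coordinates of a pattern entry -/
def pt (e : Fin k × Disp k) : Fin f.m → ℤ :=
  e.2.foldr (fun c acc => c.2.1 • f.U c.1 + c.2.2 • f.V c.1 + acc) (f.P e.1)

theorem pt_primrec : Primrec f.pt := by
  refine Primrec.list_foldr (f := fun e : Fin k × Disp k => e.2) (g := fun e => f.P e.1)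
    (h := fun _ y => y.1.2.1 • f.U y.1.1 + y.1.2.2 • f.V y.1.1 + y.2) Primrec.snd
    ((Primrec.dom_finite f.P).comp Primrec.fst) ?_
  have h1 : Primrec fun x : (Fin k × Disp k) × (Fin k × ℤ × ℤ) × (Fin f.m → ℤ) => x.2.1 :=
    Primrec.fst.comp Primrec.snd
  refine IntP.gadd_primrec.comp (IntP.gadd_primrec.comp ?_ ?_) (Primrec.snd.comp Primrec.snd)
  · exact IntP.gsmul_primrec.comp (Primrec.fst.comp (Primrec.snd.comp h1))
      ((Primrec.dom_finite f.U).comp (Primrec.fst.comp h1))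
  · exact IntP.gsmul_primrec.comp (Primrec.snd.comp (Primrec.snd.comp h1))
      ((Primrec.dom_finite f.V).comp (Primrec.fst.comp h1))

theorem vec_pt (e : Fin k × Disp k) : f.vec (f.pt e) = (shapes e.1).pos + dispVec shapes e.2 := by
  obtain ⟨i, l⟩ := e
  simp only [pt, dispVec]
  induction l with
  | nil => simp [f.hP]
  | cons c l ih =>
    simp only [List.foldr_cons, List.map_cons, List.sum_cons, map_add, map_zsmul, f.hU, f.hV, ih,
      Int.cast_smul_eq_zsmul]
    abel

/-- all finite data -/
def dat : Dat k f.m where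
  sm i j := (shapes i).SameShape (shapes j)
  rel i := (f.rs_finite i).toFinset.toList
  tab i := (f.ts_finite i).toFinset.toList
  ed := f.es_finite.toFinset.toList
  pt := f.pt

theorem mem_rel {i e} : e ∈ f.dat.rel i ↔ e ∈ f.rs i := by simp [dat]
theorem mem_tab {i κ} : κ ∈ f.dat.tab i ↔ κ ∈ f.ts i := by simp [dat]
theorem mem_ed {e} : e ∈ f.dat.ed ↔ e ∈ f.es := by simp [dat]

theorem forward (T : List (SymbTile k)) (F : ℕ → PatternCode k)
    (h : DominoPred shapes (SubshiftOfForbidden (range shapes) (fun n => decodePattern shapes (F n))) T) :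
    ∃ S, ∀ z n, K f.dat T (z, F n) S := by
  obtain ⟨y, ⟨-, hinj, hcol⟩, hT, hx, hF⟩ := h
  obtain ⟨_, ⟨t0, ht0, rfl⟩, -⟩ := covers hx.1 0
  set w0 := t0.shape.pos with hw0
  let S : Set (SymbTile k × (Fin f.m → ℤ)) :=
    {q | ∃ t ∈ y, Realizes shapes t q.1 ∧ t.shape.pos = w0 + f.vec q.2}
  have hmem : ∀ p z, (p, z) ∈ S → ∃ t ∈ y, t.shape = (f.R p.1 z).translate w0 ∧
      t.color = SymbTile.colors p := by
    rintro p z ⟨t, ht, ⟨⟨hu, hv⟩, hc⟩, hp⟩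
    refine ⟨t, ht, ?_, hc⟩
    obtain ⟨⟨a, b, c⟩, col⟩ := t
    simp only at hu hv hp
    simp only [R, Rhombus.translate, hu, hv, hp, add_comm]
  have hOcc : ∀ i z, Occ f.dat T S i z ↔ (f.R i z).translate w0 ∈ eraseColors y := by
    intro i z
    constructor
    · rintro ⟨p, hp, hs, hS⟩
      obtain ⟨t, ht, h1, -⟩ := hmem p z hS
      exact ⟨t, ht, by rw [h1, f.R_congr hs]⟩
    · rintro ⟨t, ht, hs⟩
      obtain ⟨p, hp, hr⟩ := hT t ht
      refine ⟨p, hp, ⟨?_, ?_⟩, t, ht, hr, ?_⟩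
      · rw [← hr.1.1, hs]; rfl
      · rw [← hr.1.2, hs]; rfl
      · rw [hs]; simp [R, Rhombus.translate, add_comm]
  refine ⟨S, fun z n => ⟨?_, ?_, ?_, ?_, ?_⟩⟩
  · intro hz
    obtain ⟨p, hp, hr⟩ := hT t0 ht0
    refine ⟨p, hp, t0, ht0, hr, ?_⟩
    have hz' : z = 0 := hz
    simp [hz', hw0]
  · intro p hp q hq hs h1 h2
    obtain ⟨t, ht, e1, e2⟩ := hmem _ _ h1
    obtain ⟨t', ht', e1', e2'⟩ := hmem _ _ h2
    have : t = t' := hinj t ht t' ht' (by rw [e1, e1', f.R_congr hs])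
    exact colors_inj.1 (by rw [← e2, ← e2', this])
  · intro e he p hp q hq hp1 hq1 h1 h2
    rw [mem_ed] at he
    obtain ⟨-, hne, hed⟩ := he
    obtain ⟨t, ht, e1, e2⟩ := hmem _ _ h1
    obtain ⟨t', ht', e1', e2'⟩ := hmem _ _ h2
    rw [hp1] at e1
    rw [hq1] at e1'
    have r1 : t.shape = (f.R e.1 0).translate (f.vec z + w0) := by
      rw [e1, ← translate_translate, R_translate, add_zero]
    have r2 : t'.shape = (f.R e.2.1 e.2.2.1).translate (f.vec z + w0) := by
      rw [e1', ← translate_translate, R_translate]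
    rw [← e2, ← e2']
    refine hcol t ht t' ht' ?_ _ _ ?_
    · rw [r1, r2]; exact fun h => hne (translate_inj h)
    · rw [r1, r2, edge_translate_iff]; exact hed
  · intro i _ p hp hi hS
    refine ⟨{e | e ∈ f.rs i ∧ (⟨w0 + f.vec z + f.vec e.2, (shapes e.1).u, (shapes e.1).v⟩ : Rhombus) ∈
      eraseColors y}, f.mem_tab.2 ⟨eraseColors y, w0 + f.vec z, hx, ?_, rfl⟩, fun e he => ?_⟩
    · obtain ⟨t, ht, e1, -⟩ := hmem _ _ hS
      refine ⟨t, ht, ?_⟩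
      rw [e1, hi]
      simp [R, Rhombus.translate, add_comm]
    · rw [hOcc]
      have : (f.R e.1 (z + e.2)).translate w0 =
          ⟨w0 + f.vec z + f.vec e.2, (shapes e.1).u, (shapes e.1).v⟩ := by
        simp only [R, Rhombus.translate, map_add]; congr 1; abel
      rw [this]
      exact ⟨fun h => ⟨f.mem_rel.1 he, h⟩, fun h => h.2⟩
  · intro hall
    refine hF n ⟨w0 + f.vec z, ?_⟩
    rintro _ ⟨_, ⟨e, he, rfl⟩, rfl⟩
    have := (hOcc _ _).1 (hall e he)
    convert this using 1
    simp only [R, Rhombus.translate, dat, map_add, vec_pt]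
    congr 1
    abel

theorem vertex_vec {i : Fin k} {r : Rhombus} (hu : r.u = (shapes i).u) (hv : r.v = (shapes i).v) {v : Pt}
    (h : v ∈ r.vertices) : ∃ a, v = r.pos + f.vec a := by
  simp only [Rhombus.vertices, mem_insert_iff, mem_singleton_iff, hu, hv, ← f.hU, ← f.hV] at h
  rcases h with h | h | h | h
  · exact ⟨0, by simp [h]⟩
  · exact ⟨_, h⟩
  · exact ⟨_, h⟩
  · exact ⟨f.U i + f.V i, by rw [h, map_add, add_assoc]⟩

theorem backward (hval : ∀ i, (shapes i).IsValid) (T : List (SymbTile k)) (F : ℕ → PatternCode k)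
    (h : ∃ S, ∀ z n, K f.dat T (z, F n) S) :
    DominoPred shapes (SubshiftOfForbidden (range shapes) (fun n => decodePattern shapes (F n))) T := by
  obtain ⟨S, hK⟩ := h
  let Y : Set Rhombus := {r | ∃ i z, Occ f.dat T S i z ∧ r = f.R i z}
  have sr : ∀ i, f.dat.sm i i := fun i => ⟨rfl, rfl⟩
  have neY : Y.Nonempty := by
    obtain ⟨p, hp, hS⟩ := (hK 0 0).a rfl
    exact ⟨_, p.1, 0, ⟨p, hp, sr _, hS⟩, rfl⟩
  have svR : ∀ i z j z', SV (f.R i z) (f.R j z') ↔ (j, z' - z) ∈ f.rs i := by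
    intro i z j z'
    have e1 : f.R i z = (f.R i 0).translate (f.vec z) := by rw [R_translate, add_zero]
    have e2 : f.R j z' = (f.R j (z' - z)).translate (f.vec z) := by rw [R_translate]; congr 1; abel
    rw [e1, e2, translate_SV]
    rfl
  obtain ⟨Y', hY', hti⟩ := gen_tiling (shapes := shapes) hval neY (by
    rintro r ⟨i, z, ⟨p, hp, hs, hS⟩, rfl⟩
    rw [← f.R_congr hs]
    obtain ⟨κ, hκ, hκ'⟩ := (hK z 0).g p.1 (List.mem_finRange _) p hp rfl hS
    obtain ⟨x, w, hx, hwx, rfl⟩ := f.mem_tab.1 hκ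
    have memx : ∀ j z', f.R j z' ∈ translatePatch x (f.vec z - w) ↔
        (⟨w + f.vec (z' - z), (shapes j).u, (shapes j).v⟩ : Rhombus) ∈ x := by
      intro j z'
      rw [mem_translatePatch]
      have : (f.R j z').translate (-(f.vec z - w)) =
        ⟨w + f.vec (z' - z), (shapes j).u, (shapes j).v⟩ := by
        simp only [R, Rhombus.translate, map_sub]; congr 1; abel
      rw [this]
    have hx' := tiling_translate hx (f.vec z - w)
    refine ⟨translatePatch x (f.vec z - w), hx', ?_, ?_⟩
    · rw [memx]; simpa using hwx
    · ext s
      constructor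
      · rintro ⟨⟨j, z', hO, rfl⟩, hsv⟩
        refine ⟨?_, hsv⟩
        rw [svR] at hsv
        rw [memx]
        have := (hκ' (j, z' - z) (f.mem_rel.2 hsv)).1 (by simpa using hO)
        exact this.2
      · rintro ⟨hsx, hsv⟩
        refine ⟨?_, hsv⟩
        obtain ⟨j, hu, hv⟩ := shape_of hx' hsx
        obtain ⟨v, hv1, hv2⟩ := hsv
        obtain ⟨a, ha⟩ := f.vertex_vec (i := p.1) (r := f.R p.1 z) rfl rfl hv1
        obtain ⟨b, hb⟩ := f.vertex_vec hu hv hv2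
        have hs' : s = f.R j (z + a - b) := by
          obtain ⟨sp, su, sv⟩ := s
          simp only at hu hv hb
          simp only [R] at ha
          simp only [R, hu, hv, map_sub, map_add, Rhombus.mk.injEq, and_true]
          rw [← ha, hb]; abel
        subst hs'
        refine ⟨j, z + a - b, ?_, rfl⟩
        have hsv : SV (f.R p.1 z) (f.R j (z + a - b)) := ⟨v, hv1, hv2⟩
        rw [svR] at hsv
        rw [memx] at hsx
        have := (hκ' (j, z + a - b - z) (f.mem_rel.2 hsv)).2 ⟨hsv, hsx⟩
        simpa using this)
  let y : Set ColoredRhombus := {t | ∃ p ∈ T, ∃ z, (p, z) ∈ S ∧ f.R p.1 z ∈ Y' ∧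
    t = ⟨f.R p.1 z, SymbTile.colors p⟩}
  have hy : eraseColors y = Y' := by
    ext r
    constructor
    · rintro ⟨_, ⟨p, hp, z, hS, hr, rfl⟩, rfl⟩; exact hr
    · intro hr
      obtain ⟨i, z, ⟨p, hp, hs, hS⟩, rfl⟩ := hY' hr
      rw [← f.R_congr hs] at hr ⊢
      exact ⟨_, ⟨p, hp, z, hS, hr, rfl⟩, rfl⟩
  refine ⟨y, ⟨by rw [hy]; exact hti.1, ?_, ?_⟩, ?_, ?_⟩
  · rintro _ ⟨p, hp, z, hS, hr, rfl⟩ _ ⟨q, hq, z', hS', hr', rfl⟩ he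
    simp only at he
    obtain ⟨rfl, hs⟩ := f.R_inj he
    have := (hK z 0).b p hp q hq hs hS hS'
    rw [he, colors_inj.2 this]
  · rintro _ ⟨p, hp, z, hS, hr, rfl⟩ _ ⟨q, hq, z', hS', hr', rfl⟩ hne i j hij
    simp only at hne hij ⊢
    have e1 : f.R p.1 z = (f.R p.1 0).translate (f.vec z) := by rw [R_translate, add_zero]
    have e2 : f.R q.1 z' = (f.R q.1 (z' - z)).translate (f.vec z) := by rw [R_translate]; congr 1; abel
    refine (hK z 0).c (p.1, q.1, z' - z, i, j) (f.mem_ed.2 ⟨?_, ?_, ?_⟩) p hp q hq rfl rfl hS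
      (by simpa using hS')
    · rw [← svR]
      obtain ⟨v, c, d, d', ha, hb, -⟩ := common_edge (e := (f.R p.1 z).edge i) ⟨i, rfl⟩
        (by rw [hij]; exact ⟨j, rfl⟩)
      exact ⟨v, ha.vertex, hb.vertex⟩
    · intro h; exact hne (by rw [e1, e2, h])
    · rw [e1, e2, edge_translate_iff] at hij; exact hij
  · rintro _ ⟨p, hp, z, hS, hr, rfl⟩
    exact ⟨p, hp, ⟨rfl, rfl⟩, rfl⟩
  · rw [hy]
    refine ⟨hti, ?_⟩
    rintro n ⟨w, hw⟩
    have hw' : ∀ e ∈ F n, (⟨(shapes e.1).pos + dispVec shapes e.2 + w, (shapes e.1).u, (shapes e.1).v⟩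
        : Rhombus) ∈ Y' := fun e he => hw ⟨_, ⟨e, he, rfl⟩, rfl⟩
    have hz : ∃ z, ∀ e ∈ F n, (shapes e.1).pos + dispVec shapes e.2 + w = f.vec (z + f.pt e) := by
      rcases hFn : F n with _ | ⟨e0, l⟩
      · exact ⟨0, by simp⟩
      · obtain ⟨i, z0, -, h0⟩ := hY' (hw' e0 (by simp [hFn]))
        simp only [R, Rhombus.mk.injEq] at h0
        refine ⟨z0 - f.pt e0, fun e _ => ?_⟩
        have := h0.1
        rw [← f.vec_pt] at this ⊢
        rw [map_add, map_sub, ← this]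
        abel
    obtain ⟨z, hz⟩ := hz
    refine (hK z n).e fun e he => ?_
    obtain ⟨i, z', ⟨p, hp, hs, hS⟩, h0⟩ := hY' (hw' e he)
    rw [hz e he] at h0
    obtain ⟨h1, h2⟩ := f.R_inj (i := e.1) (z := z + f.pt e) h0
    rw [← h1] at hS
    exact ⟨p, hp, ⟨hs.1.trans h2.1.symm, hs.2.trans h2.2.symm⟩, hS⟩

end Frame

theorem domino_pi01 {k : ℕ} {shapes : Fin k → Rhombus} (hval : ∀ i, (shapes i).IsValid)
    {F : ℕ → PatternCode k} (hF : Computable F) :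
    Pi01 (DominoPred shapes (SubshiftOfForbidden (range shapes) (fun n => decodePattern shapes (F n)))) := by
  obtain ⟨f⟩ := exists_frame shapes
  obtain ⟨g, hg, hg'⟩ := pi01 f.dat f.pt_primrec hF
  exact ⟨g, hg, fun T => (Iff.intro (f.forward T F) (f.backward hval T F)).trans (hg' T)⟩

end Con
end

open Set Metric
section

theorem compl_halting_pi01 : Pi01 fun c : Nat.Partrec.Code => ¬ (c.eval 0).Dom := by
  refine ⟨fun c n => (Nat.Partrec.Code.evaln n c 0).isNone, ?_, fun c => ?_⟩
  · have h : Primrec fun x : Nat.Partrec.Code × ℕ => Nat.Partrec.Code.evaln x.2 x.1 0 :=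
      Nat.Partrec.Code.primrec_evaln.comp (Primrec.pair (Primrec.pair Primrec.snd Primrec.fst) (Primrec.const 0))
    have h2 : Primrec fun x : Nat.Partrec.Code × ℕ => (Nat.Partrec.Code.evaln x.2 x.1 0).isNone := by
      refine (Primrec.not.comp (Primrec.option_isSome.comp h)).of_eq fun x => ?_
      cases Nat.Partrec.Code.evaln x.2 x.1 0 <;> rfl
    exact h2.to_comp
  · refine (not_congr Part.dom_iff_mem).trans ?_
    simp only [Nat.Partrec.Code.evaln_complete, Option.isNone_iff_eq_none]
    constructor
    · intro h n
      rw [Option.eq_none_iff_forall_not_mem]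
      exact fun a ha => h ⟨a, n, ha⟩
    · rintro h ⟨a, n, ha⟩
      rw [h n] at ha
      cases ha

theorem not_computable_of_hard {α : Type} [Primcodable α] {A : α → Prop} (h : Pi01Hard A) :
    ¬ ComputablePred A := by
  intro hA
  have h2 : ComputablePred fun c : Nat.Partrec.Code => ¬ (c.eval 0).Dom :=
    ComputablePred.computable_of_manyOneReducible (h _ _ compl_halting_pi01) hA
  refine ComputablePred.halting_problem 0 ?_
  exact h2.not.of_eq fun c => not_not

end

/-- For any non-empty effective subshift `X` of edge-to-edge
rhombus tilings (given by a computable enumeration of forbidden patterns),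
`Domino(X)` is many-one equivalent to the classical Domino problem, i.e.
`Π⁰₁`-complete (`Π⁰₁` and `Π⁰₁`-hard); in particular it is undecidable. -/
theorem statement_14 (k : ℕ) (shapes : Fin k → Rhombus)
    (hval : ∀ i, (shapes i).IsValid)
    (F : ℕ → PatternCode k) (hF : Computable F)
    (X : Set (Set Rhombus))
    (hX : X = SubshiftOfForbidden (Set.range shapes)
      (fun n => decodePattern shapes (F n)))
    (hne : X.Nonempty) :
    ManyOneEquiv (DominoPred shapes X) WangDomino ∧
    Pi01 (DominoPred shapes X) ∧ Pi01Hard (DominoPred shapes X) ∧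
    ¬ ComputablePred (DominoPred shapes X) := by
  have hT : ∀ x ∈ X, IsTilingOn (range shapes) x := by
    intro x hx; rw [hX] at hx; exact hx.1
  have hred := Red.wang_reduces hval hT hne
  have hpi : Pi01 (DominoPred shapes X) := by rw [hX]; exact Con.domino_pi01 hval hF
  have hhard : Pi01Hard (DominoPred shapes X) := fun β _ B hB => (wang_hard β B hB).trans hred
  exact ⟨⟨wang_hard _ _ hpi, hred⟩, hpi, hhard, not_computable_of_hard hhard⟩
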